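/- Let n = 3 (space dimension) and let s₀, s₁, s₂, b₀, b₁, b₂ ∈ ℝ satisfy: b₀+b₁+b₂ > 1/2; b₀+b₁ ≥ 0; b₀+b₂ ≥ 0; b₁+b₂ ≥ 0; s₀+s₁+s₂ > 2 − (b₀+b₁+b₂); s₀+s₁+s₂ > 3/2 − min(b₀+b₁, b₀+b₂, b₁+b₂); s₀+s₁+s₂ > 1 − min(b₀, b₁, b₂); s₀+s₁+s₂ > 1; (s₀+b₀)+2s₁+2s₂ > 3/2; 2s₀+(s₁+b₁)+2s₂ > 3/2; 2s₀+2s₁+(s₂+b₂) > 3/2; s₁+s₂ ≥ max(0, −b₀); s₀+s₂ ≥ max(0, −b₁); s₀+s₁ ≥ max(0, −b₂). Then for all Schwartz functions u, v on ℝ^{3+1} one has the product estimate ‖uv‖_{H^{−s₀,−b₀}} ≲ ‖u‖_{H^{s₁,b₁}} ‖v‖_{H^{s₂,b₂}}, with an implicit constant independent of u and v. -/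

import Mathlib

noncomputable section

open MeasureTheory Complex
open scoped FourierTransform RealInnerProductSpace BigOperators

/-! ## Basic setup: space-time `ℝ^{1+3}` and Fourier analytic toolbox -/

/-- Space-time `ℝ^{1+3}` (used both for physical points `(t,x)` and
Fourier variables `(τ,ξ)`); coordinate `0` is time. -/
abbrev SpaceTime : Type := EuclideanSpace ℝ (Fin 4)

/-- Space `ℝ³`. -/
abbrev Space : Type := EuclideanSpace ℝ (Fin 3)

/-- The spatial part of a space-time point / frequency. -/
def spt (z : SpaceTime) : Space := (WithLp.equiv 2 (Fin 3 → ℝ)).symm fun i => z i.succ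

/-- The space-time point `(t, x)`. -/
def stpt (t : ℝ) (x : Space) : SpaceTime :=
  (WithLp.equiv 2 (Fin 4 → ℝ)).symm fun μ => Fin.cases t (fun i => x i) μ

/-- Japanese bracket `⟨x⟩ = (1+x²)^{1/2}`. -/
def jap (x : ℝ) : ℝ := Real.sqrt (1 + x ^ 2)

/-- The sign `±1` encoded by a boolean (`true ↦ +1`). -/
def sgnv (sg : Bool) : ℝ := if sg then 1 else -1

/-- Minkowski metric coefficient `η^{μμ}`, used to raise indices. -/
def mink (μ : Fin 4) : ℝ := if μ = 0 then -1 else 1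

section Ops

variable {E : Type*} [NormedAddCommGroup E] [NormedSpace ℂ E]

/-- Space-time Fourier transform. -/
def FT (u : SpaceTime → E) : SpaceTime → E := fun ζ => 𝓕 u ζ

/-- Inverse space-time Fourier transform. -/
def FTinv (u : SpaceTime → E) : SpaceTime → E := fun x => 𝓕⁻ u x

/-- Spatial Fourier transform. -/
def FT3 (u : Space → E) : Space → E := fun ξ => 𝓕 u ξ

/-- Inverse spatial Fourier transform. -/
def FT3inv (u : Space → E) : Space → E := fun x => 𝓕⁻ u x

/-- Weighted `L²`-norm (on the Fourier side). -/
def wnorm (w : SpaceTime → ℝ) (f : SpaceTime → E) : ℝ := (∫ ζ, (w ζ * ‖f ζ‖) ^ 2) ^ ((1:ℝ)/2)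

/-- Finiteness of the weighted `L²`-norm. -/
def wfin (w : SpaceTime → ℝ) (f : SpaceTime → E) : Prop :=
  MeasureTheory.HasFiniteIntegral (fun ζ => (w ζ * ‖f ζ‖) ^ 2) volume

/-- The weight of the wave-Sobolev space `H^{s,b}`. -/
def hWt (s b : ℝ) (ζ : SpaceTime) : ℝ := jap ‖spt ζ‖ ^ s * jap (|ζ 0| - ‖spt ζ‖) ^ b

/-- The weight of the space `X^{s,b}_±`. -/
def xWt (sg : Bool) (s b : ℝ) (ζ : SpaceTime) : ℝ :=
  jap ‖spt ζ‖ ^ s * jap (-(ζ 0) + sgnv sg * ‖spt ζ‖) ^ b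

/-- The norm of the wave-Sobolev space `H^{s,b}`:
`‖u‖ = ‖⟨ξ⟩^s ⟨|τ|-|ξ|⟩^b ũ(τ,ξ)‖_{L²}`. -/
def HsbNorm (s b : ℝ) (u : SpaceTime → E) : ℝ := wnorm (hWt s b) (FT u)

/-- Membership (finiteness of the norm) for `H^{s,b}`. -/
def HsbFin (s b : ℝ) (u : SpaceTime → E) : Prop := wfin (hWt s b) (FT u)

/-- The norm of `X^{s,b}_±` : `‖u‖ = ‖⟨ξ⟩^s ⟨-τ ± |ξ|⟩^b ũ(τ,ξ)‖_{L²}`. -/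
def XsbNorm (sg : Bool) (s b : ℝ) (u : SpaceTime → E) : ℝ := wnorm (xWt sg s b) (FT u)

/-- Membership (finiteness of the norm) for `X^{s,b}_±`. -/
def XsbFin (sg : Bool) (s b : ℝ) (u : SpaceTime → E) : Prop := wfin (xWt sg s b) (FT u)

/-- Fourier multiplier with (complex) symbol `m`. -/
def mult (m : SpaceTime → ℂ) (u : SpaceTime → E) : SpaceTime → E := FTinv fun ζ => m ζ • FT u ζ

/-- Fourier multiplier with real symbol `m`. -/
def rmult (m : SpaceTime → ℝ) (u : SpaceTime → E) : SpaceTime → E := mult (fun ζ => (m ζ : ℂ)) u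

/-- `Λ^α`, the multiplier with symbol `⟨ξ⟩^α`. -/
def Lam (α : ℝ) (u : SpaceTime → E) : SpaceTime → E := rmult (fun ζ => jap ‖spt ζ‖ ^ α) u

/-- `Λ₊^α`, the multiplier with symbol `⟨|τ|+|ξ|⟩^α`. -/
def LamPlus (α : ℝ) (u : SpaceTime → E) : SpaceTime → E := rmult (fun ζ => jap (|ζ 0| + ‖spt ζ‖) ^ α) u

/-- `Λ₋^α`, the multiplier with symbol `⟨|τ|-|ξ|⟩^α`. -/
def LamMinus (α : ℝ) (u : SpaceTime → E) : SpaceTime → E := rmult (fun ζ => jap (|ζ 0| - ‖spt ζ‖) ^ α) u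

/-- `D^α`, the multiplier with symbol `|ξ|^α`. -/
def Dop (α : ℝ) (u : SpaceTime → E) : SpaceTime → E := rmult (fun ζ => ‖spt ζ‖ ^ α) u

/-- `D₊^α`, the multiplier with symbol `(|τ|+|ξ|)^α`. -/
def DPlus (α : ℝ) (u : SpaceTime → E) : SpaceTime → E := rmult (fun ζ => (|ζ 0| + ‖spt ζ‖) ^ α) u

/-- `D₋^α`, the multiplier with symbol `||τ|-|ξ||^α`. -/
def DMinus (α : ℝ) (u : SpaceTime → E) : SpaceTime → E := rmult (fun ζ => |(|ζ 0| - ‖spt ζ‖)| ^ α) u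

/-- `|∇|`, the multiplier with symbol `|ξ|`. -/
def absNabla (u : SpaceTime → E) : SpaceTime → E := Dop 1 u

/-- The partial derivative `∂_μ` on space-time. -/
def pd (μ : Fin 4) (u : SpaceTime → E) : SpaceTime → E := fun x => fderiv ℝ u x (EuclideanSpace.single μ 1)

/-- The spatial partial derivative `∂_i` on `ℝ³`. -/
def pd3 (i : Fin 3) (u : Space → E) : Space → E := fun x => fderiv ℝ u x (EuclideanSpace.single i 1)

/-- The (inhomogeneous) Riesz transform `R_j = Λ^{-1} ∂_j`. -/
def Riesz (j : Fin 3) (u : SpaceTime → E) : SpaceTime → E := Lam (-1) (pd j.succ u)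

/-- The d'Alembertian `□ = ∂_t² - Δ`. -/
def box (u : SpaceTime → E) : SpaceTime → E :=
  fun x => pd 0 (pd 0 u) x - ∑ j : Fin 3, pd j.succ (pd j.succ u) x

/-- The `F^s` norm, `‖u‖_{F^s} = ‖Λ₊ u‖_{H^{s-1,3/4+ε}}`. -/
def FsNorm (ε s : ℝ) (u : SpaceTime → E) : ℝ := HsbNorm (s - 1) (3/4 + ε) (LamPlus 1 u)

/-- Membership in `F^s`. -/
def FsFin (ε s : ℝ) (u : SpaceTime → E) : Prop := HsbFin (s - 1) (3/4 + ε) (LamPlus 1 u)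

/-- The `G^r` norm, `‖v‖_{G^r} = ‖Λ₊ v‖_{H^{r-1,1/2+ε}}`. -/
def GrNorm (ε r : ℝ) (v : SpaceTime → E) : ℝ := HsbNorm (r - 1) (1/2 + ε) (LamPlus 1 v)

/-- Membership in `G^r`. -/
def GrFin (ε r : ℝ) (v : SpaceTime → E) : Prop := HsbFin (r - 1) (1/2 + ε) (LamPlus 1 v)

/-- The time slab `[0,T] × ℝ³`. -/
def slab (T : ℝ) : Set SpaceTime := {x | x 0 ∈ Set.Icc 0 T}

/-- `u` belongs to the restriction to `[0,T]` of the space with defining predicate `P`: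
it has an extension lying in that space. -/
def MemRestrict (P : (SpaceTime → E) → Prop) (T : ℝ) (u : SpaceTime → E) : Prop :=
  ∃ U : SpaceTime → E, P U ∧ Set.EqOn U u (slab T)

/-- The spatial Sobolev `H^s(ℝ³)` norm. -/
def HNorm (s : ℝ) (f : Space → E) : ℝ :=
  (∫ ξ, (jap ‖ξ‖ ^ s * ‖FT3 f ξ‖) ^ 2) ^ ((1:ℝ)/2)

/-- Membership in the spatial Sobolev space `H^s(ℝ³)`. -/
def MemHs (s : ℝ) (f : Space → E) : Prop :=
  MeasureTheory.HasFiniteIntegral (fun ξ => (jap ‖ξ‖ ^ s * ‖FT3 f ξ‖) ^ 2) volume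

/-- Continuity with values in `H^s` on the time interval `[0,T]` (for a space-time function). -/
def ContHsOn (s T : ℝ) (u : SpaceTime → E) : Prop :=
  (∀ t ∈ Set.Icc (0:ℝ) T, MemHs s fun ξ => u (stpt t ξ)) ∧
  ∀ t ∈ Set.Icc (0:ℝ) T,
    Filter.Tendsto (fun t' => HNorm s fun ξ => u (stpt t' ξ) - u (stpt t ξ))
      (nhdsWithin t (Set.Icc 0 T)) (nhds 0)

end Ops

/-- The angle weight `|∠(±₁ξ₁, ±₂ξ₂)|`. -/
def angleWt (sg1 sg2 : Bool) (η θ : SpaceTime) : ℝ :=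
  |InnerProductGeometry.angle (sgnv sg1 • spt η) (sgnv sg2 • spt θ)|

/-- The bilinear null-form operator `B_{±₁,±₂}`, defined by its space-time Fourier transform
`𝓕(B(u,v))(ζ) = ∫ |∠(±₁ξ₁, ±₂ξ₂)| ũ(ζ₁) ṽ(ζ-ζ₁) dζ₁`. -/
def Bop (sg1 sg2 : Bool) (u v : SpaceTime → ℂ) : SpaceTime → ℂ :=
  FTinv fun ζ => ∫ η, (angleWt sg1 sg2 η (ζ - η) : ℂ) * FT u η * FT v (ζ - η)

/-! ## Null forms -/

/-- The null form `Q₀(u,v) = ∂_α u ∂^α v`. -/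
def Q0f (u v : SpaceTime → ℂ) : SpaceTime → ℂ := fun x => ∑ μ : Fin 4, mink μ • (pd μ u x * pd μ v x)

/-- The null form `Q_{αβ}(u,v) = ∂_α u ∂_β v - ∂_β u ∂_α v`. -/
def Qf (α β : Fin 4) (u v : SpaceTime → ℂ) : SpaceTime → ℂ :=
  fun x => pd α u x * pd β v x - pd β u x * pd α v x

/-! ## Matrix-valued (Lie algebra) objects -/

/-- `n×n` complex matrices, the ambient space of `su(n,ℂ)`. -/
abbrev G (n : ℕ) : Type := Matrix (Fin n) (Fin n) ℂ

attribute [local instance] Matrix.frobeniusNormedAddCommGroup Matrix.frobeniusNormedSpace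

/-- Membership in the Lie algebra `su(n,ℂ)` (trace-free skew-hermitian matrices). -/
def IsSu {n : ℕ} (X : G n) : Prop := X.conjTranspose = -X ∧ X.trace = 0

/-- The matrix commutator `[X,Y] = XY - YX`. -/
def mcomm {n : ℕ} (X Y : G n) : G n := X * Y - Y * X

/-- The commutator null form `Q_{αβ}[u,v] = [∂_α u, ∂_β v] - [∂_β u, ∂_α v]`. -/
def Qc {n : ℕ} (α β : Fin 4) (u v : SpaceTime → G n) : SpaceTime → G n :=
  fun x => mcomm (pd α u x) (pd β v x) - mcomm (pd β u x) (pd α v x)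

/-- The commutator null form `Q₀[u,v] = [∂_α u, ∂^α v]`. -/
def Q0c {n : ℕ} (u v : SpaceTime → G n) : SpaceTime → G n :=
  fun x => ∑ μ : Fin 4, mink μ • mcomm (pd μ u x) (pd μ v x)

/-! ## Dirac operators -/

/-- The spinor space `ℂ⁴`. -/
abbrev C4 : Type := EuclideanSpace ℂ (Fin 4)

/-- A `4×4` matrix acting on `ℂ⁴`. -/
def matAct (M : Matrix (Fin 4) (Fin 4) ℂ) (v : C4) : C4 :=
  (WithLp.equiv 2 (Fin 4 → ℂ)).symm (M.mulVec ((WithLp.equiv 2 (Fin 4 → ℂ)) v))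

/-- The Dirac matrices `α^0 = I`, `α^j = ((0,σ^j),(σ^j,0))`. -/
def alphaMat : Fin 4 → Matrix (Fin 4) (Fin 4) ℂ
  | 0 => 1
  | 1 => !![0,0,0,1; 0,0,1,0; 0,1,0,0; 1,0,0,0]
  | 2 => !![0,0,0,-I; 0,0,I,0; 0,-I,0,0; I,0,0,0]
  | 3 => !![0,0,1,0; 0,0,0,-1; 1,0,0,0; 0,-1,0,0]

/-- Matrix-symbol Fourier multiplier on spinor fields (space-time). -/
def multM (m : SpaceTime → Matrix (Fin 4) (Fin 4) ℂ) (u : SpaceTime → C4) : SpaceTime → C4 :=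
  FTinv fun ζ => matAct (m ζ) (FT u ζ)

/-- Matrix-symbol Fourier multiplier on spinor fields (space). -/
def multM3 (m : Space → Matrix (Fin 4) (Fin 4) ℂ) (u : Space → C4) : Space → C4 :=
  FT3inv fun ξ => matAct (m ξ) (FT3 u ξ)

/-- The symbol `Π(±ξ) = ½(I ± ξ_j α^j / |ξ|)` of the Dirac projections. -/
def PiSymb (sg : Bool) (ξ : Space) : Matrix (Fin 4) (Fin 4) ℂ :=
  (2⁻¹ : ℂ) • (1 + ∑ j : Fin 3, ((sgnv sg * ξ j / ‖ξ‖ : ℝ) : ℂ) • alphaMat j.succ)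

/-- The Dirac projection `Π_± = Π_±(∇/i)` (space-time version). -/
def PiProj (sg : Bool) (u : SpaceTime → C4) : SpaceTime → C4 := multM (fun ζ => PiSymb sg (spt ζ)) u

/-- The Dirac projection `Π_± = Π_±(∇/i)` acting on functions of the space variable. -/
def PiProj3 (sg : Bool) (u : Space → C4) : Space → C4 := multM3 (fun ξ => PiSymb sg ξ) u

open scoped ENNReal

/-! ## Trilinear convolution forms -/

section Trilinear

set_option linter.unusedSectionVars false

variable {X : Type*} [AddCommGroup X] [MeasureSpace X]

/-- The trilinear form `∫∫ f(-x-y) g(x) h(y) dx dy`. -/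
def tri (f g h : X → ℝ≥0∞) : ℝ≥0∞ := ∫⁻ x, ∫⁻ y, f (-x - y) * (g x * h y)

/-- The `L²` norm of an extended nonnegative function. -/
def nrm {Y : Type*} [MeasureSpace Y] (f : Y → ℝ≥0∞) : ℝ≥0∞ := (∫⁻ x, f x ^ 2) ^ (1 / 2 : ℝ)

/-- `tri` is bounded by `C` times the product of `L²` norms for functions supported in `A`, `B`,
`D`. -/
def TriBound (A B D : Set X) (C : ℝ≥0∞) : Prop :=
  ∀ f g h : X → ℝ≥0∞, Measurable f → Measurable g → Measurable h →
    (∀ x, x ∉ A → f x = 0) → (∀ x, x ∉ B → g x = 0) → (∀ x, x ∉ D → h x = 0) →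
      tri f g h ≤ C * (nrm f * nrm g * nrm h)

theorem lintegral_mul_le_nrm {Y : Type*} [MeasurableSpace Y] (μ : Measure Y) {f g : Y → ℝ≥0∞}
    (hf : AEMeasurable f μ) (hg : AEMeasurable g μ) :
    ∫⁻ x, f x * g x ∂μ ≤ (∫⁻ x, f x ^ 2 ∂μ) ^ (1 / 2 : ℝ) * (∫⁻ x, g x ^ 2 ∂μ) ^ (1 / 2 : ℝ) := by
  have := ENNReal.lintegral_mul_le_Lp_mul_Lq μ Real.HolderConjugate.two_two hf hg
  simpa [ENNReal.rpow_ofNat] using this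

theorem nrm_sq {Y : Type*} [MeasureSpace Y] (f : Y → ℝ≥0∞) : nrm f ^ 2 = ∫⁻ x, f x ^ 2 := by
  rw [nrm, ← ENNReal.rpow_natCast, ← ENNReal.rpow_mul]; norm_num

theorem sq_rpow_half (a : ℝ≥0∞) : (a ^ 2) ^ (1 / 2 : ℝ) = a := by
  rw [← ENNReal.rpow_natCast, ← ENNReal.rpow_mul]; norm_num

theorem nrm_mono {Y : Type*} [MeasureSpace Y] {f g : Y → ℝ≥0∞} (h : ∀ x, f x ≤ g x) :
    nrm f ≤ nrm g := by
  unfold nrm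
  gcongr with x
  exact h x

theorem TriBound.mono {A B D A' B' D' : Set X} {C C' : ℝ≥0∞} (h : TriBound A B D C)
    (hA : A' ⊆ A) (hB : B' ⊆ B) (hD : D' ⊆ D) (hC : C ≤ C') : TriBound A' B' D' C' := by
  intro f g k hf hg hk hfA hgB hkD
  refine (h f g k hf hg hk (fun x hx => hfA x fun h => hx (hA h)) (fun x hx => hgB x fun h => hx (hB h))
    (fun x hx => hkD x fun h => hx (hD h))).trans ?_
  gcongr

theorem nrm_indicator_le {Y : Type*} [MeasureSpace Y] (A : Set Y) (f : Y → ℝ≥0∞) :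
    nrm (A.indicator f) ≤ nrm f :=
  nrm_mono fun x => Set.indicator_le_self _ _ x

variable [MeasurableAdd₂ X] [MeasurableNeg X]

@[fun_prop]
theorem measurable_tri_integrand {f g h : X → ℝ≥0∞} (hf : Measurable f) (hg : Measurable g)
    (hh : Measurable h) :
    Measurable fun p : X × X => f (-p.1 - p.2) * (g p.1 * h p.2) := by
  have : Measurable fun p : X × X => -p.1 - p.2 := by
    simp only [sub_eq_add_neg]; fun_prop
  fun_prop

variable [SFinite (volume : Measure X)]

theorem tri_swap_right {f g h : X → ℝ≥0∞} (hf : Measurable f) (hg : Measurable g)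
    (hh : Measurable h) : tri f g h = tri f h g := by
  unfold tri
  rw [lintegral_lintegral_swap]
  · refine lintegral_congr fun x => lintegral_congr fun y => ?_
    rw [mul_comm (h x), show -y - x = -x - y by abel]
  · exact (measurable_tri_integrand hf hg hh).aemeasurable

variable [(volume : Measure X).IsAddLeftInvariant] [(volume : Measure X).IsNegInvariant]

theorem lintegral_neg_sub (f : X → ℝ≥0∞) (x : X) : ∫⁻ y, f (-x - y) = ∫⁻ y, f y :=
  lintegral_sub_left_eq_self f (-x)

theorem tri_swap_left {f g h : X → ℝ≥0∞} (hf : Measurable f) (hg : Measurable g)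
    (hh : Measurable h) : tri f g h = tri g f h := by
  rw [tri_swap_right hf hg hh, tri_swap_right hg hf hh]
  unfold tri
  refine lintegral_congr fun x => ?_
  rw [← lintegral_neg_sub _ x]
  refine lintegral_congr fun y => ?_
  rw [show -x - (-x - y) = y by abel]; ring

theorem TriBound.swap_right {A B D : Set X} {C : ℝ≥0∞} (h : TriBound A B D C) :
    TriBound A D B C := by
  intro f g k hf hg hk hfA hgB hkD
  rw [tri_swap_right hf hg hk]
  refine (h f k g hf hk hg hfA hkD hgB).trans_eq ?_
  ring

theorem TriBound.swap_left {A B D : Set X} {C : ℝ≥0∞} (h : TriBound A B D C) :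
    TriBound B A D C := by
  intro f g k hf hg hk hfA hgB hkD
  rw [tri_swap_left hf hg hk]
  refine (h g f k hg hf hk hgB hfA hkD).trans_eq ?_
  ring

theorem tri_union_le {B₁ B₂ : Set X} (hB₁ : MeasurableSet B₁)
    {f g h : X → ℝ≥0∞} (hf : Measurable f) (hg : Measurable g) (hh : Measurable h)
    (hgB : ∀ x, x ∉ B₁ ∪ B₂ → g x = 0) :
    tri f g h ≤ tri f (B₁.indicator g) h + tri f (B₂.indicator g) h := by
  unfold tri
  rw [← lintegral_add_left]
  · refine lintegral_mono fun x => ?_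
    rw [← lintegral_add_left]
    · refine lintegral_mono fun y => ?_
      rw [← mul_add, ← add_mul]
      gcongr
      by_cases h1 : x ∈ B₁
      · simp [h1]
      · by_cases h2 : x ∈ B₂
        · simp [h2]
        · simp [hgB x (by simp [h1, h2])]
    · exact (measurable_tri_integrand hf (hg.indicator hB₁) hh).comp measurable_prodMk_left
  · exact (measurable_tri_integrand hf (hg.indicator hB₁) hh).lintegral_prod_right'

theorem TriBound.union_mid {A B₁ B₂ D : Set X} {C₁ C₂ : ℝ≥0∞} (hB₁ : MeasurableSet B₁)
    (hB₂ : MeasurableSet B₂) (h₁ : TriBound A B₁ D C₁) (h₂ : TriBound A B₂ D C₂) :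
    TriBound A (B₁ ∪ B₂) D (C₁ + C₂) := by
  intro f g k hf hg hk hfA hgB hkD
  refine (tri_union_le hB₁ hf hg hk hgB).trans ?_
  rw [add_mul]
  refine add_le_add ((h₁ f _ k hf (hg.indicator hB₁) hk hfA (fun x hx => by simp [hx]) hkD).trans ?_)
    ((h₂ f _ k hf (hg.indicator hB₂) hk hfA (fun x hx => by simp [hx]) hkD).trans ?_)
  all_goals gcongr; exact nrm_indicator_le _ _

/-- Cauchy–Schwarz: the form is controlled by the size of the fibres over the third variable. -/
theorem TriBound.of_fibre {A B D : Set X} (hA : MeasurableSet A) (hB : MeasurableSet B)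
    {V : ℝ≥0∞} (hV : ∀ y ∈ D, volume {x | x ∈ B ∧ -x - y ∈ A} ≤ V) :
    TriBound A B D (V ^ (1 / 2 : ℝ)) := by
  intro f g h hf hg hh hfA hgB hhD
  have hsub : Measurable fun p : X × X => -p.1 - p.2 := by
    simp only [sub_eq_add_neg]; fun_prop
  have hS : MeasurableSet {p : X × X | p.1 ∈ B ∧ -p.1 - p.2 ∈ A} :=
    (measurable_fst hB).inter (hsub hA)
  have h1 : tri f g h = ∫⁻ p : X × X, (f (-p.1 - p.2) * g p.1) *
      ({p : X × X | p.1 ∈ B ∧ -p.1 - p.2 ∈ A}.indicator (fun p => h p.2) p) := by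
    unfold tri
    rw [Measure.volume_eq_prod, lintegral_prod _ (by
      exact (((hf.comp hsub).mul (hg.comp measurable_fst)).mul
        ((hh.comp measurable_snd).indicator hS)).aemeasurable)]
    refine lintegral_congr fun x => lintegral_congr fun y => ?_
    by_cases hx : x ∈ B
    · by_cases hy : -x - y ∈ A
      · simp [hx, hy, mul_assoc]
      · simp [hfA _ hy]
    · simp [hgB _ hx]
  have h2 : ∫⁻ p : X × X, (f (-p.1 - p.2) * g p.1) ^ 2 = nrm f ^ 2 * nrm g ^ 2 := by
    rw [Measure.volume_eq_prod, lintegral_prod _ (by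
      exact (((hf.comp hsub).mul (hg.comp measurable_fst)).pow_const 2).aemeasurable)]
    simp_rw [mul_pow]
    rw [nrm_sq, nrm_sq, ← lintegral_const_mul _ (hg.pow_const 2)]
    refine lintegral_congr fun x => ?_
    have : Measurable fun y => f (-x - y) ^ 2 := by
      exact (hf.comp (hsub.comp measurable_prodMk_left)).pow_const 2
    rw [lintegral_mul_const _ this, lintegral_neg_sub (fun y => f y ^ 2) x]
  have h3 : ∫⁻ p : X × X, ({p : X × X | p.1 ∈ B ∧ -p.1 - p.2 ∈ A}.indicator (fun p => h p.2) p) ^ 2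
      ≤ V * nrm h ^ 2 := by
    rw [Measure.volume_eq_prod, lintegral_prod_symm _ (by
      exact (((hh.comp measurable_snd).indicator hS).pow_const 2).aemeasurable), nrm_sq,
      ← lintegral_const_mul _ (hh.pow_const 2)]
    refine lintegral_mono fun y => ?_
    by_cases hy : y ∈ D
    · have hm : MeasurableSet {x | x ∈ B ∧ -x - y ∈ A} :=
        hB.inter ((hsub.comp measurable_prodMk_right) hA)
      calc ∫⁻ x, ({p : X × X | p.1 ∈ B ∧ -p.1 - p.2 ∈ A}.indicator (fun p => h p.2) (x, y)) ^ 2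
          = ∫⁻ x, {x | x ∈ B ∧ -x - y ∈ A}.indicator (fun _ => h y ^ 2) x := by
            refine lintegral_congr fun x => ?_
            by_cases hx : x ∈ B ∧ -x - y ∈ A
            · simp [Set.indicator, hx]
            · simp [Set.indicator, hx]
        _ = h y ^ 2 * volume {x | x ∈ B ∧ -x - y ∈ A} := lintegral_indicator_const hm _
        _ ≤ V * h y ^ 2 := by rw [mul_comm]; gcongr; exact hV y hy
    · simp [Set.indicator, hhD y hy]
  rw [h1]
  have hm1 : Measurable fun p : X × X => f (-p.1 - p.2) * g p.1 :=
    (hf.comp hsub).mul (hg.comp measurable_fst)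
  have hm2 : Measurable fun p : X × X =>
      {p : X × X | p.1 ∈ B ∧ -p.1 - p.2 ∈ A}.indicator (fun p => h p.2) p :=
    (hh.comp measurable_snd).indicator hS
  refine (lintegral_mul_le_nrm _ hm1.aemeasurable hm2.aemeasurable).trans ?_
  rw [h2]
  calc (nrm f ^ 2 * nrm g ^ 2) ^ (1 / 2 : ℝ) * _
      ≤ (nrm f ^ 2 * nrm g ^ 2) ^ (1 / 2 : ℝ) * (V * nrm h ^ 2) ^ (1 / 2 : ℝ) := by gcongr
    _ = V ^ (1 / 2 : ℝ) * (nrm f * nrm g * nrm h) := by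
      rw [ENNReal.mul_rpow_of_nonneg _ _ (by norm_num), ENNReal.mul_rpow_of_nonneg _ _ (by norm_num),
        sq_rpow_half, sq_rpow_half, sq_rpow_half]
      ring

/-- A bound on the `L²` norm of the correlation gives a bound on the trilinear form, because
convolution and correlation of nonnegative functions have the same `L²` norm. -/
theorem TriBound.of_fibre_correlation {A B D : Set X} (hB : MeasurableSet B)
    (hD : MeasurableSet D) {V : ℝ≥0∞} (hV : ∀ z, volume {x | x ∈ B ∧ x + z ∈ D} ≤ V) :
    TriBound A B D (V ^ (1 / 2 : ℝ)) := by
  intro f g h hf hg hh hfA hgB hhD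
  have hsub : Measurable fun p : X × X => -p.1 - p.2 := by
    simp only [sub_eq_add_neg]; fun_prop
  have hconv : Measurable fun z => ∫⁻ x, g x * h (-x - z) := by
    refine Measurable.lintegral_prod_left' (f := fun p : X × X => g p.1 * h (-p.1 - p.2)) ?_
    exact (hg.comp measurable_fst).mul (hh.comp hsub)
  have h1 : tri f g h = ∫⁻ z, f z * ∫⁻ x, g x * h (-x - z) := by
    have e : tri f g h = tri h f g := by
      rw [tri_swap_right hf hg hh, tri_swap_left hf hh hg]
    rw [e]
    unfold tri
    refine lintegral_congr fun z => ?_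
    have hm : Measurable fun x => g x * h (-x - z) :=
      hg.mul (hh.comp (hsub.comp measurable_prodMk_right))
    rw [← lintegral_const_mul _ hm]
    refine lintegral_congr fun x => ?_
    rw [show -z - x = -x - z by abel]; ring
  have h2 : ∫⁻ z, (∫⁻ x, g x * h (-x - z)) ^ 2 = ∫⁻ z, (∫⁻ x, g x * h (x + z)) ^ 2 := by
    have e1 : ∀ φ : X → ℝ≥0∞, Measurable φ →
        (∫⁻ x, φ x) ^ 2 = ∫⁻ x, ∫⁻ y, φ x * φ y := fun φ hφ => by
      rw [sq, ← lintegral_mul_const _ hφ]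
      exact lintegral_congr fun x => (lintegral_const_mul _ hφ).symm
    have e2 : ∀ (ψ : X → X → X) , (Measurable fun p : X × X => ψ p.1 p.2) →
        ∫⁻ z, (∫⁻ x, g x * h (ψ x z)) ^ 2
          = ∫⁻ x, ∫⁻ y, ∫⁻ z, (g x * h (ψ x z)) * (g y * h (ψ y z)) := by
      intro ψ hψ
      have hm : Measurable fun q : (X × X) × X =>
          (g q.1.2 * h (ψ q.1.2 q.1.1)) * (g q.2 * h (ψ q.2 q.1.1)) := by
        have a1 : Measurable fun q : (X × X) × X => ψ q.1.2 q.1.1 :=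
          hψ.comp (f := fun q : (X × X) × X => (q.1.2, q.1.1)) (by fun_prop)
        have a2 : Measurable fun q : (X × X) × X => ψ q.2 q.1.1 :=
          hψ.comp (f := fun q : (X × X) × X => (q.2, q.1.1)) (by fun_prop)
        fun_prop
      calc ∫⁻ z, (∫⁻ x, g x * h (ψ x z)) ^ 2
          = ∫⁻ z, ∫⁻ x, ∫⁻ y, (g x * h (ψ x z)) * (g y * h (ψ y z)) :=
            lintegral_congr fun z => e1 _
              (hg.mul (hh.comp (hψ.comp (measurable_prodMk_right (y := z)))))
        _ = ∫⁻ x, ∫⁻ z, ∫⁻ y, (g x * h (ψ x z)) * (g y * h (ψ y z)) := by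
            rw [lintegral_lintegral_swap]
            exact (hm.lintegral_prod_right' (f := fun q : (X × X) × X =>
              (g q.1.2 * h (ψ q.1.2 q.1.1)) * (g q.2 * h (ψ q.2 q.1.1)))).aemeasurable
        _ = _ := by
            refine lintegral_congr fun x => ?_
            rw [lintegral_lintegral_swap]
            exact (hm.comp (f := fun q : X × X => ((q.1, x), q.2)) (by fun_prop)).aemeasurable
    rw [e2 (fun x z => -x - z) hsub, e2 (fun x z => x + z) (by fun_prop)]
    refine lintegral_congr fun x => lintegral_congr fun y => ?_
    rw [← lintegral_sub_left_eq_self (fun z => g x * h (-x - z) * (g y * h (-y - z))) (-x - y)]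
    refine lintegral_congr fun z => ?_
    rw [show -x - (-x - y - z) = y + z by abel, show -y - (-x - y - z) = x + z by abel]
    ring
  have h3 : ∫⁻ z, (∫⁻ x, g x * h (x + z)) ^ 2 ≤ V * (nrm g ^ 2 * nrm h ^ 2) := by
    have hpt : ∀ z, (∫⁻ x, g x * h (x + z)) ^ 2 ≤ V * ∫⁻ x, g x ^ 2 * h (x + z) ^ 2 := by
      intro z
      have hm : MeasurableSet {x | x ∈ B ∧ x + z ∈ D} :=
        hB.inter ((measurable_add_const z) hD)
      have hmm : Measurable fun x => g x * h (x + z) := by fun_prop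
      have e : ∫⁻ x, g x * h (x + z)
          = ∫⁻ x, {x | x ∈ B ∧ x + z ∈ D}.indicator 1 x * (g x * h (x + z)) := by
        refine lintegral_congr fun x => ?_
        by_cases hx : x ∈ B
        · by_cases hy : x + z ∈ D
          · simp [hx, hy]
          · simp [hhD _ hy]
        · simp [hgB _ hx]
      have e' : ∫⁻ x, ({x | x ∈ B ∧ x + z ∈ D}.indicator (1 : X → ℝ≥0∞) x) ^ 2
          = volume {x | x ∈ B ∧ x + z ∈ D} := by
        rw [← lintegral_indicator_one hm]
        refine lintegral_congr fun x => ?_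
        by_cases hx : x ∈ {x | x ∈ B ∧ x + z ∈ D} <;> simp only [Set.indicator, hx] <;> simp
      rw [e]
      refine (pow_le_pow_left' (lintegral_mul_le_nrm volume
        ((measurable_one.indicator hm).aemeasurable) hmm.aemeasurable) 2).trans ?_
      have hsq : ∀ a : ℝ≥0∞, (a ^ (1 / 2 : ℝ)) ^ 2 = a := fun a => by
        rw [← ENNReal.rpow_natCast, ← ENNReal.rpow_mul]; norm_num
      rw [mul_pow, hsq, hsq, e']
      simp_rw [mul_pow]
      gcongr
      exact hV z
    refine (lintegral_mono hpt).trans_eq ?_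
    have hm : Measurable fun p : X × X => g p.2 ^ 2 * h (p.2 + p.1) ^ 2 := by fun_prop
    rw [lintegral_const_mul _ hm.lintegral_prod_right', lintegral_lintegral_swap hm.aemeasurable,
      nrm_sq, nrm_sq, ← lintegral_mul_const _ (hg.pow_const 2)]
    congr 1
    refine lintegral_congr fun x => ?_
    have hx : ∫⁻ z, g x ^ 2 * h (x + z) ^ 2 = g x ^ 2 * ∫⁻ z, h z ^ 2 := by
      rw [lintegral_const_mul _ (by fun_prop), lintegral_add_left_eq_self (fun z => h z ^ 2) x]
    exact hx
  rw [h1]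
  refine (lintegral_mul_le_nrm _ hf.aemeasurable hconv.aemeasurable).trans ?_
  rw [h2]
  calc nrm f * (∫⁻ z, (∫⁻ x, g x * h (x + z)) ^ 2) ^ (1 / 2 : ℝ)
      ≤ nrm f * (V * (nrm g ^ 2 * nrm h ^ 2)) ^ (1 / 2 : ℝ) := by gcongr
    _ = V ^ (1 / 2 : ℝ) * (nrm f * nrm g * nrm h) := by
      rw [ENNReal.mul_rpow_of_nonneg _ _ (by norm_num), ENNReal.mul_rpow_of_nonneg _ _ (by norm_num),
        sq_rpow_half, sq_rpow_half]
      ring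

/-- Localization to a measurable family of product sets with bounded overlap. -/
theorem TriBound.of_local {Ω : Type*} [MeasurableSpace Ω] (ν : Measure Ω) [SFinite ν]
    {A B D : Set X} (β γ : Set (Ω × X)) (hβ : MeasurableSet β) (hγ : MeasurableSet γ)
    {C m M₁ M₂ : ℝ≥0∞} (hm0 : m ≠ 0) (hm : m ≠ ⊤)
    (hlow : ∀ x ∈ B, ∀ y ∈ D, -x - y ∈ A → m ≤ ν {ω | (ω, x) ∈ β ∧ (ω, y) ∈ γ})
    (h₁ : ∀ x, ν {ω | (ω, x) ∈ β} ≤ M₁) (h₂ : ∀ y, ν {ω | (ω, y) ∈ γ} ≤ M₂)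
    (hloc : ∀ ω, TriBound A (B ∩ {x | (ω, x) ∈ β}) (D ∩ {y | (ω, y) ∈ γ}) C) :
    TriBound A B D (m⁻¹ * (C * (M₁ ^ (1 / 2 : ℝ) * M₂ ^ (1 / 2 : ℝ)))) := by
  intro f g h hf hg hh hfA hgB hhD
  have hsub : Measurable fun p : X × X => -p.1 - p.2 := by
    simp only [sub_eq_add_neg]; fun_prop
  have hβs : ∀ ω, MeasurableSet {x | (ω, x) ∈ β} := fun ω => measurable_prodMk_left hβ
  have hγs : ∀ ω, MeasurableSet {x | (ω, x) ∈ γ} := fun ω => measurable_prodMk_left hγ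
  have hmass : ∀ (δ : Set (Ω × X)) (k : X → ℝ≥0∞) (M : ℝ≥0∞), MeasurableSet δ → Measurable k →
      (∀ x, ν {ω | (ω, x) ∈ δ} ≤ M) →
      ∫⁻ ω, nrm ({x | (ω, x) ∈ δ}.indicator k) ^ 2 ∂ν ≤ M * nrm k ^ 2 := by
    intro δ k M hδ hk hM
    have hmk : Measurable fun q : Ω × X => δ.indicator (fun q => k q.2 ^ 2) q :=
      ((hk.comp measurable_snd).pow_const 2).indicator hδ
    have e : ∀ ω, nrm ({x | (ω, x) ∈ δ}.indicator k) ^ 2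
        = ∫⁻ x, δ.indicator (fun q => k q.2 ^ 2) (ω, x) := by
      intro ω
      rw [nrm_sq]
      refine lintegral_congr fun x => ?_
      by_cases hx : (ω, x) ∈ δ <;> simp [Set.indicator, hx]
    simp_rw [e]
    rw [lintegral_lintegral_swap hmk.aemeasurable, nrm_sq, ← lintegral_const_mul _ (hk.pow_const 2)]
    refine lintegral_mono fun x => ?_
    have hms : MeasurableSet {ω | (ω, x) ∈ δ} := measurable_prodMk_right hδ
    have : ∫⁻ ω, δ.indicator (fun q => k q.2 ^ 2) (ω, x) ∂ν = k x ^ 2 * ν {ω | (ω, x) ∈ δ} := by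
      rw [← lintegral_indicator_const hms]
      refine lintegral_congr fun ω => ?_
      by_cases hx : (ω, x) ∈ δ <;> simp [Set.indicator, hx]
    rw [this, mul_comm]
    gcongr
    exact hM x
  have hnm : ∀ (δ : Set (Ω × X)) (k : X → ℝ≥0∞), MeasurableSet δ → Measurable k →
      Measurable fun ω => nrm ({x | (ω, x) ∈ δ}.indicator k) := by
    intro δ k hδ hk
    unfold nrm
    refine Measurable.pow_const ?_ _
    refine Measurable.lintegral_prod_right' (f := fun q : Ω × X =>
      ({x | (q.1, x) ∈ δ}.indicator k q.2) ^ 2) ?_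
    refine Measurable.pow_const ?_ _
    exact (hk.comp measurable_snd).indicator hδ
  have hF : Measurable fun q : Ω × (X × X) =>
      f (-q.2.1 - q.2.2) * ({x | (q.1, x) ∈ β}.indicator g q.2.1 *
        {x | (q.1, x) ∈ γ}.indicator h q.2.2) := by
    have a1 : Measurable fun q : Ω × (X × X) => {x | (q.1, x) ∈ β}.indicator g q.2.1 := by
      have : Measurable fun q : Ω × X => β.indicator (fun q => g q.2) q :=
        (hg.comp measurable_snd).indicator hβ
      exact this.comp (f := fun q : Ω × (X × X) => (q.1, q.2.1)) (by fun_prop)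
    have a2 : Measurable fun q : Ω × (X × X) => {x | (q.1, x) ∈ γ}.indicator h q.2.2 := by
      have : Measurable fun q : Ω × X => γ.indicator (fun q => h q.2) q :=
        (hh.comp measurable_snd).indicator hγ
      exact this.comp (f := fun q : Ω × (X × X) => (q.1, q.2.2)) (by fun_prop)
    exact (hf.comp (hsub.comp measurable_snd)).mul (a1.mul a2)
  have key : m * tri f g h ≤
      ∫⁻ ω, tri f ({x | (ω, x) ∈ β}.indicator g) ({x | (ω, x) ∈ γ}.indicator h) ∂ν := by
    have e : ∀ ω, tri f ({x | (ω, x) ∈ β}.indicator g) ({x | (ω, x) ∈ γ}.indicator h)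
        = ∫⁻ p : X × X, f (-p.1 - p.2) * ({x | (ω, x) ∈ β}.indicator g p.1 *
          {x | (ω, x) ∈ γ}.indicator h p.2) := by
      intro ω
      unfold tri
      rw [Measure.volume_eq_prod, lintegral_prod _ (by
        exact (hF.comp measurable_prodMk_left).aemeasurable)]
    have e0 : tri f g h = ∫⁻ p : X × X, f (-p.1 - p.2) * (g p.1 * h p.2) := by
      unfold tri
      rw [Measure.volume_eq_prod, lintegral_prod _
        (measurable_tri_integrand hf hg hh).aemeasurable]
    simp_rw [e]
    rw [lintegral_lintegral_swap hF.aemeasurable, e0,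
      ← lintegral_const_mul _ (measurable_tri_integrand hf hg hh)]
    refine lintegral_mono fun p => ?_
    by_cases hx : p.1 ∈ B
    swap
    · simp [hgB _ hx]
    by_cases hy : p.2 ∈ D
    swap
    · simp [hhD _ hy]
    by_cases hz : -p.1 - p.2 ∈ A
    swap
    · simp [hfA _ hz]
    have hms : MeasurableSet {ω | (ω, p.1) ∈ β ∧ (ω, p.2) ∈ γ} :=
      (measurable_prodMk_right hβ).inter (measurable_prodMk_right hγ)
    calc m * (f (-p.1 - p.2) * (g p.1 * h p.2))
        ≤ (f (-p.1 - p.2) * (g p.1 * h p.2)) * ν {ω | (ω, p.1) ∈ β ∧ (ω, p.2) ∈ γ} := by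
          rw [mul_comm]; gcongr; exact hlow _ hx _ hy hz
      _ = ∫⁻ ω, {ω | (ω, p.1) ∈ β ∧ (ω, p.2) ∈ γ}.indicator
            (fun _ => f (-p.1 - p.2) * (g p.1 * h p.2)) ω ∂ν :=
          (lintegral_indicator_const hms _).symm
      _ ≤ _ := by
          refine lintegral_mono fun ω => ?_
          by_cases h1 : (ω, p.1) ∈ β <;> by_cases h2 : (ω, p.2) ∈ γ <;>
            simp [Set.indicator, h1, h2]
  have key2 : m * tri f g h ≤
      C * (M₁ ^ (1 / 2 : ℝ) * M₂ ^ (1 / 2 : ℝ)) * (nrm f * nrm g * nrm h) := by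
    refine key.trans ?_
    have hb := hnm β g hβ hg
    have hc := hnm γ h hγ hh
    calc ∫⁻ ω, tri f ({x | (ω, x) ∈ β}.indicator g) ({x | (ω, x) ∈ γ}.indicator h) ∂ν
        ≤ ∫⁻ ω, C * nrm f * (nrm ({x | (ω, x) ∈ β}.indicator g) *
            nrm ({x | (ω, x) ∈ γ}.indicator h)) ∂ν := by
          refine lintegral_mono fun ω => ?_
          refine (hloc ω f _ _ hf (hg.indicator (hβs ω)) (hh.indicator (hγs ω)) hfA ?_ ?_).trans_eq
            (by ring)
          · intro x hx
            by_cases h' : (ω, x) ∈ β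
            · rw [Set.indicator_of_mem (by exact h')]
              exact hgB x fun hxB => hx ⟨hxB, h'⟩
            · rw [Set.indicator_of_notMem (by exact h')]
          · intro x hx
            by_cases h' : (ω, x) ∈ γ
            · rw [Set.indicator_of_mem (by exact h')]
              exact hhD x fun hxB => hx ⟨hxB, h'⟩
            · rw [Set.indicator_of_notMem (by exact h')]
      _ = C * nrm f * ∫⁻ ω, nrm ({x | (ω, x) ∈ β}.indicator g) *
            nrm ({x | (ω, x) ∈ γ}.indicator h) ∂ν := lintegral_const_mul _ (hb.mul hc)
      _ ≤ C * nrm f * ((∫⁻ ω, nrm ({x | (ω, x) ∈ β}.indicator g) ^ 2 ∂ν) ^ (1 / 2 : ℝ) *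
            (∫⁻ ω, nrm ({x | (ω, x) ∈ γ}.indicator h) ^ 2 ∂ν) ^ (1 / 2 : ℝ)) := by
          gcongr
          exact lintegral_mul_le_nrm _ hb.aemeasurable hc.aemeasurable
      _ ≤ C * nrm f * ((M₁ * nrm g ^ 2) ^ (1 / 2 : ℝ) * (M₂ * nrm h ^ 2) ^ (1 / 2 : ℝ)) := by
          gcongr
          · exact hmass β g M₁ hβ hg h₁
          · exact hmass γ h M₂ hγ hh h₂
      _ = _ := by
          rw [ENNReal.mul_rpow_of_nonneg _ _ (by norm_num),
            ENNReal.mul_rpow_of_nonneg _ _ (by norm_num), sq_rpow_half, sq_rpow_half]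
          ring
  calc tri f g h = m⁻¹ * (m * tri f g h) := by
        rw [← mul_assoc, ENNReal.inv_mul_cancel hm0 hm, one_mul]
    _ ≤ m⁻¹ * (C * (M₁ ^ (1 / 2 : ℝ) * M₂ ^ (1 / 2 : ℝ)) * (nrm f * nrm g * nrm h)) := by gcongr
    _ = _ := by ring

end Trilinear

/-! ## Volume estimates in `ℝ³` -/

/-- Separate the first coordinate. -/
def splitHead {n : ℕ} (ξ : EuclideanSpace ℝ (Fin (n + 1))) : ℝ × EuclideanSpace ℝ (Fin n) :=
  (ξ 0, WithLp.toLp 2 fun i => ξ i.succ)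

theorem measurePreserving_splitHead {n : ℕ} :
    MeasurePreserving (splitHead (n := n)) volume volume := by
  have h1 := PiLp.volume_preserving_ofLp (ι := Fin (n + 1))
  have h2 := volume_preserving_piFinSuccAbove (fun _ : Fin (n + 1) => ℝ) 0
  have h3 : MeasurePreserving (Prod.map id (WithLp.toLp 2) : ℝ × (Fin n → ℝ) → _) volume volume :=
    (MeasurePreserving.id volume).prod (PiLp.volume_preserving_toLp (ι := Fin n))
  exact h3.comp (h2.comp h1)

theorem norm_sq_splitHead {n : ℕ} (ξ : EuclideanSpace ℝ (Fin (n + 1))) :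
    ‖ξ‖ ^ 2 = (splitHead ξ).1 ^ 2 + ‖(splitHead ξ).2‖ ^ 2 := by
  simp [EuclideanSpace.norm_sq_eq, splitHead, Fin.sum_univ_succ]

theorem splitHead_sub {n : ℕ} (ξ η : EuclideanSpace ℝ (Fin (n + 1))) :
    splitHead (ξ - η) = splitHead ξ - splitHead η := rfl

theorem map_norm_sq_plane :
    (volume : Measure (EuclideanSpace ℝ (Fin 2))).map (fun y => ‖y‖ ^ 2)
      = ENNReal.ofReal Real.pi • volume.restrict (Set.Ici (0 : ℝ)) := by
  have hm : Measurable fun y : EuclideanSpace ℝ (Fin 2) => ‖y‖ ^ 2 := by fun_prop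
  have hlt : ∀ b : ℝ, volume {y : EuclideanSpace ℝ (Fin 2) | ‖y‖ ^ 2 < b}
      = ENNReal.ofReal b * ENNReal.ofReal Real.pi := by
    intro b
    rcases le_or_gt b 0 with hb | hb
    · have : {y : EuclideanSpace ℝ (Fin 2) | ‖y‖ ^ 2 < b} = ∅ := by
        ext y; simp; nlinarith [sq_nonneg ‖y‖]
      simp [this, ENNReal.ofReal_of_nonpos hb]
    · have : {y : EuclideanSpace ℝ (Fin 2) | ‖y‖ ^ 2 < b} = Metric.ball 0 (√b) := by
        ext y
        simp [Real.lt_sqrt (norm_nonneg y)]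
      rw [this, EuclideanSpace.volume_ball_fin_two, ← ENNReal.ofReal_pow (Real.sqrt_nonneg _),
        Real.sq_sqrt hb.le]
  have hle : ∀ b : ℝ, volume {y : EuclideanSpace ℝ (Fin 2) | ‖y‖ ^ 2 ≤ b}
      = ENNReal.ofReal b * ENNReal.ofReal Real.pi := by
    intro b
    rcases lt_or_ge b 0 with hb | hb
    · have : {y : EuclideanSpace ℝ (Fin 2) | ‖y‖ ^ 2 ≤ b} = ∅ := by
        ext y; simp; nlinarith [sq_nonneg ‖y‖]
      simp [this, ENNReal.ofReal_of_nonpos hb.le]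
    · have : {y : EuclideanSpace ℝ (Fin 2) | ‖y‖ ^ 2 ≤ b} = Metric.closedBall 0 (√b) := by
        ext y
        simp [Real.le_sqrt (norm_nonneg y) hb]
      rw [this, EuclideanSpace.volume_closedBall_fin_two, ← ENNReal.ofReal_pow (Real.sqrt_nonneg _),
        Real.sq_sqrt hb]
  have hIoo : ∀ a b : ℝ, a < b →
      (volume : Measure (EuclideanSpace ℝ (Fin 2))).map (fun y => ‖y‖ ^ 2) (Set.Ioo a b)
        = (ENNReal.ofReal b - ENNReal.ofReal a) * ENNReal.ofReal Real.pi := by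
    intro a b hab
    have : (fun y : EuclideanSpace ℝ (Fin 2) => ‖y‖ ^ 2) ⁻¹' Set.Ioo a b
        = {y | ‖y‖ ^ 2 < b} \ {y | ‖y‖ ^ 2 ≤ a} := by
      ext y; simp [and_comm]
    rw [Measure.map_apply hm measurableSet_Ioo, this, measure_sdiff ?_
      (measurableSet_le hm measurable_const).nullMeasurableSet (by
        rw [hle]; exact ENNReal.mul_ne_top ENNReal.ofReal_ne_top ENNReal.ofReal_ne_top), hlt, hle,
      ENNReal.sub_mul]
    · intros; exact ENNReal.ofReal_ne_top
    · exact fun y hy => lt_of_le_of_lt (Set.mem_ofPred.1 hy) hab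
  have : IsLocallyFiniteMeasure
      ((volume : Measure (EuclideanSpace ℝ (Fin 2))).map (fun y => ‖y‖ ^ 2)) := by
    refine ⟨fun x => ⟨Set.Ioo (x - 1) (x + 1), Ioo_mem_nhds (by linarith) (by linarith), ?_⟩⟩
    rw [hIoo _ _ (by linarith)]
    exact ENNReal.mul_lt_top (lt_of_le_of_lt tsub_le_self ENNReal.ofReal_lt_top)
      ENNReal.ofReal_lt_top
  refine Real.measure_ext_Ioo_rat fun a b => ?_
  rcases le_or_gt b a with hab | hab
  · simp [Set.Ioo_eq_empty (not_lt.2 (by exact_mod_cast hab : (b : ℝ) ≤ a))]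
  have hab' : (a : ℝ) < b := by exact_mod_cast hab
  rw [hIoo _ _ hab', Measure.smul_apply, Measure.restrict_apply measurableSet_Ioo, smul_eq_mul,
    mul_comm]
  congr 1
  rcases le_or_gt 0 (a : ℝ) with ha | ha
  · rw [Set.inter_eq_left.2 (fun x (hx : x ∈ Set.Ioo (a : ℝ) b) => Set.mem_Ici.2 (ha.trans hx.1.le)), Real.volume_Ioo,
      ENNReal.ofReal_sub _ ha]
  · have : Set.Ioo (a : ℝ) b ∩ Set.Ici 0 = Set.Ico 0 (b : ℝ) := by
      ext x; simp; constructor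
      · rintro ⟨⟨_, h⟩, h'⟩; exact ⟨h', h⟩
      · rintro ⟨h, h'⟩; exact ⟨⟨by linarith, h'⟩, h⟩
    rw [this, Real.volume_Ico, ENNReal.ofReal_of_nonpos ha.le, tsub_zero, sub_zero]

theorem volume_le_of_abs_sub_le {s : Set ℝ} {d : ℝ} (h : ∀ x ∈ s, ∀ y ∈ s, |x - y| ≤ d) :
    volume s ≤ ENNReal.ofReal d := by
  refine (Real.volume_le_diam s).trans (Metric.ediam_le_of_forall_dist_le ?_)
  simpa [Real.dist_eq] using h

/-- Reduction to a set of pairs (first coordinate, squared norm). -/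
theorem volume_le_of_polar {S : Set Space} {T : Set (ℝ × ℝ)} (hT : MeasurableSet T)
    (hST : ∀ ξ ∈ S, (ξ 0, ‖ξ‖ ^ 2) ∈ T) {a b : ℝ} {d : ℝ}
    (hq : ∀ p ∈ T, p.2 ∈ Set.Icc a b)
    (hd : ∀ z q z', (z, q) ∈ T → (z', q) ∈ T → |z - z'| ≤ d) :
    volume S ≤ ENNReal.ofReal Real.pi * (ENNReal.ofReal (b - a) * ENNReal.ofReal d) := by
  have hm1 : Measurable fun p : ℝ × EuclideanSpace ℝ (Fin 2) => (p.1, p.1 ^ 2 + ‖p.2‖ ^ 2) := by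
    fun_prop
  have hm2 : Measurable fun p : ℝ × ℝ => (p.1, p.1 ^ 2 + p.2) := by fun_prop
  calc volume S ≤ volume (splitHead ⁻¹' {p : ℝ × EuclideanSpace ℝ (Fin 2) |
        (p.1, p.1 ^ 2 + ‖p.2‖ ^ 2) ∈ T}) := by
        refine measure_mono fun ξ hξ => ?_
        have := hST ξ hξ
        rw [norm_sq_splitHead] at this
        exact this
    _ = volume {p : ℝ × EuclideanSpace ℝ (Fin 2) | (p.1, p.1 ^ 2 + ‖p.2‖ ^ 2) ∈ T} :=
        measurePreserving_splitHead.measure_preimage (hm1 hT).nullMeasurableSet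
    _ = ∫⁻ z, volume {y : EuclideanSpace ℝ (Fin 2) | (z, z ^ 2 + ‖y‖ ^ 2) ∈ T} :=
        Measure.prod_apply (hm1 hT)
    _ ≤ ∫⁻ z, ENNReal.ofReal Real.pi * volume {p : ℝ | (z, p) ∈ T} := by
        refine lintegral_mono fun z => ?_
        have hz : MeasurableSet {p : ℝ | (z, z ^ 2 + p) ∈ T} :=
          (hm2.comp measurable_prodMk_left) hT
        have e : volume {y : EuclideanSpace ℝ (Fin 2) | (z, z ^ 2 + ‖y‖ ^ 2) ∈ T}
            = ENNReal.ofReal Real.pi * volume.restrict (Set.Ici 0) {p : ℝ | (z, z ^ 2 + p) ∈ T} := by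
          rw [← smul_eq_mul, ← Measure.smul_apply, ← map_norm_sq_plane,
            Measure.map_apply (by fun_prop) hz]
          rfl
        rw [e]
        refine mul_le_mul' le_rfl ((Measure.le_iff'.1 Measure.restrict_le_self _).trans_eq ?_)
        exact measure_preimage_add volume (z ^ 2) {p : ℝ | (z, p) ∈ T}
    _ = ENNReal.ofReal Real.pi * ∫⁻ z, volume {p : ℝ | (z, p) ∈ T} :=
        lintegral_const_mul _ (measurable_measure_prodMk_left hT)
    _ = ENNReal.ofReal Real.pi * ∫⁻ q, volume {z : ℝ | (z, q) ∈ T} := by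
        congr 1
        exact (Measure.prod_apply (μ := volume) (ν := volume) hT).symm.trans
          (Measure.prod_apply_symm hT)
    _ ≤ ENNReal.ofReal Real.pi * ∫⁻ q, (Set.Icc a b).indicator (fun _ => ENNReal.ofReal d) q := by
        gcongr with q
        by_cases hqm : q ∈ Set.Icc a b
        · rw [Set.indicator_of_mem hqm]
          exact volume_le_of_abs_sub_le fun z hz z' hz' => hd z q z' hz hz'
        · have : {z : ℝ | (z, q) ∈ T} = ∅ := by
            ext z; simp only [Set.mem_ofPred_eq, Set.mem_empty_iff_false, iff_false]
            exact fun h => hqm (hq _ h)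
          simp [this]
    _ = _ := by
        rw [lintegral_indicator_const measurableSet_Icc, Real.volume_Icc, mul_comm (ENNReal.ofReal d)]

theorem exists_reflection (a : Space) :
    ∃ e : Space ≃ₗᵢ[ℝ] Space, e a = ‖a‖ • EuclideanSpace.single 0 1 := by
  refine ⟨(ℝ ∙ (a - ‖a‖ • EuclideanSpace.single 0 (1 : ℝ)))ᗮ.reflection,
    Submodule.reflection_sub ?_⟩
  simp [norm_smul]

theorem volume_le_of_isometry (e : Space ≃ₗᵢ[ℝ] Space) {S S' : Set Space}
    (h : ∀ ξ ∈ S, e ξ ∈ S') (hS' : MeasurableSet S') : volume S ≤ volume S' := by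
  rw [← e.measurePreserving.measure_preimage hS'.nullMeasurableSet]
  exact measure_mono h

/-- Volume of a thin shell between two confocal quadrics, intersected with an annulus. -/
theorem volume_confocal_shell {a : Space} (ha : a ≠ 0) {r₁ r₂ ρ δ c σ σ' : ℝ} (hr : 0 ≤ r₁)
    (hσ : σ' = 1 ∨ σ' = -1) :
    volume {ξ : Space | (r₁ ≤ ‖ξ‖ ∧ ‖ξ‖ ≤ r₂) ∧ ‖ξ - a‖ ≤ ρ ∧ |σ * ‖ξ‖ + σ' * ‖ξ - a‖ - c| ≤ δ}
      ≤ ENNReal.ofReal (Real.pi * ((r₂ ^ 2 - r₁ ^ 2) * (2 * δ * ρ / ‖a‖))) := by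
  have ha0 : 0 < ‖a‖ := norm_pos_iff.2 ha
  set S := {ξ : Space | (r₁ ≤ ‖ξ‖ ∧ ‖ξ‖ ≤ r₂) ∧ ‖ξ - a‖ ≤ ρ ∧ |σ * ‖ξ‖ + σ' * ‖ξ - a‖ - c| ≤ δ}
  rcases S.eq_empty_or_nonempty with hS | ⟨ξ₀, h₀⟩
  · simp [hS]
  have hrr : r₁ ≤ r₂ := h₀.1.1.trans h₀.1.2
  have hr12 : 0 ≤ r₂ ^ 2 - r₁ ^ 2 := by nlinarith
  obtain ⟨e, he⟩ := exists_reflection a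
  set a' : Space := ‖a‖ • EuclideanSpace.single 0 1
  let S' : Set Space :=
    {ξ | (r₁ ≤ ‖ξ‖ ∧ ‖ξ‖ ≤ r₂) ∧ ‖ξ - a'‖ ≤ ρ ∧ |σ * ‖ξ‖ + σ' * ‖ξ - a'‖ - c| ≤ δ}
  have hS' : MeasurableSet S' := Measurable.setOf (by fun_prop)
  refine (volume_le_of_isometry e (S' := S') (fun ξ hξ => ?_) hS').trans ?_
  · have h1 : ‖e ξ‖ = ‖ξ‖ := e.norm_map ξ
    have h2 : ‖e ξ - a'‖ = ‖ξ - a‖ := by rw [← he, ← map_sub, e.norm_map]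
    change (r₁ ≤ ‖e ξ‖ ∧ ‖e ξ‖ ≤ r₂) ∧ ‖e ξ - a'‖ ≤ ρ ∧ |σ * ‖e ξ‖ + σ' * ‖e ξ - a'‖ - c| ≤ δ
    rw [h1, h2]; exact hξ
  have hdist2 : ∀ ξ : Space, ‖ξ - a'‖ ^ 2 = ‖ξ‖ ^ 2 - 2 * ‖a‖ * ξ 0 + ‖a‖ ^ 2 := by
    intro ξ
    rw [norm_sub_sq_real, ← he, e.norm_map, he, real_inner_smul_right,
      EuclideanSpace.inner_single_right]
    simp
    ring
  have hdist : ∀ ξ : Space, ‖ξ - a'‖ = √(‖ξ‖ ^ 2 - 2 * ‖a‖ * ξ 0 + ‖a‖ ^ 2) := by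
    intro ξ
    rw [← hdist2, Real.sqrt_sq (norm_nonneg _)]
  let T : Set (ℝ × ℝ) := {p | p.2 ∈ Set.Icc (r₁ ^ 2) (r₂ ^ 2) ∧
    0 ≤ p.2 - 2 * ‖a‖ * p.1 + ‖a‖ ^ 2 ∧
    √(p.2 - 2 * ‖a‖ * p.1 + ‖a‖ ^ 2) ≤ ρ ∧
    |σ * √p.2 + σ' * √(p.2 - 2 * ‖a‖ * p.1 + ‖a‖ ^ 2) - c| ≤ δ}
  have hT : MeasurableSet T := Measurable.setOf (by simp only [Set.mem_Icc]; fun_prop)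
  refine (volume_le_of_polar (a := r₁ ^ 2) (b := r₂ ^ 2) (d := 2 * δ * ρ / ‖a‖) hT ?_
    (fun p hp => hp.1) ?_).trans_eq ?_
  · rintro ξ ⟨⟨h1, h2⟩, h3, h4⟩
    have hn : 0 ≤ ‖ξ‖ ^ 2 - 2 * ‖a‖ * ξ 0 + ‖a‖ ^ 2 := by
      rw [← hdist2]; positivity
    refine ⟨⟨pow_le_pow_left₀ hr h1 2, pow_le_pow_left₀ (norm_nonneg _) h2 2⟩, hn, ?_, ?_⟩
    · rw [hdist] at h3; exact h3
    · rw [hdist] at h4; simpa [Real.sqrt_sq (norm_nonneg ξ)] using h4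
  · rintro z q z' ⟨-, n1, h1, h1'⟩ ⟨-, n2, h2, h2'⟩
    simp only at n1 h1 h1' n2 h2 h2'
    set A := √(q - 2 * ‖a‖ * z + ‖a‖ ^ 2)
    set A' := √(q - 2 * ‖a‖ * z' + ‖a‖ ^ 2)
    have hA : A ^ 2 = q - 2 * ‖a‖ * z + ‖a‖ ^ 2 := Real.sq_sqrt n1
    have hA' : A' ^ 2 = q - 2 * ‖a‖ * z' + ‖a‖ ^ 2 := Real.sq_sqrt n2
    have hA0 : 0 ≤ A := Real.sqrt_nonneg _
    have hA0' : 0 ≤ A' := Real.sqrt_nonneg _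
    have hAA : |A - A'| ≤ 2 * δ := by
      rw [abs_le] at *
      rcases hσ with rfl | rfl <;> constructor <;> linarith
    rw [le_div_iff₀ ha0]
    have e1 : |z - z'| * ‖a‖ * 2 = |A - A'| * (A + A') := by
      have : (z' - z) * ‖a‖ * 2 = (A - A') * (A + A') := by nlinarith
      have h' := congrArg abs this
      rw [abs_mul, abs_mul, abs_mul, abs_of_pos ha0, abs_of_nonneg (by positivity : 0 ≤ A + A'),
        abs_of_pos (by norm_num : (0 : ℝ) < 2), abs_sub_comm] at h'
      exact h'
    have : |A - A'| * (A + A') ≤ 2 * δ * (2 * ρ) := by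
      apply mul_le_mul hAA (by linarith) (by positivity)
      linarith [abs_nonneg (A - A')]
    nlinarith
  · rw [ENNReal.ofReal_mul Real.pi_nonneg, ENNReal.ofReal_mul hr12]

/-- A point with large first coordinate moves away from the origin when it is shifted to the
right. -/
theorem norm_splitHead_increment {ξ η : Space} (h2 : (splitHead ξ).2 = (splitHead η).2)
    (h1 : ξ 0 ≤ η 0) {R : ℝ} (hξ : R ≤ ξ 0) (hR : ‖(splitHead ξ).2‖ ≤ R) :
    (η 0 - ξ 0) / 2 ≤ ‖η‖ - ‖ξ‖ := by
  have e1 : ‖ξ‖ ^ 2 = ξ 0 ^ 2 + ‖(splitHead ξ).2‖ ^ 2 := norm_sq_splitHead ξ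
  have e2 : ‖η‖ ^ 2 = η 0 ^ 2 + ‖(splitHead ξ).2‖ ^ 2 := h2 ▸ norm_sq_splitHead η
  have n0 := norm_nonneg (splitHead ξ).2
  have b1 : ‖ξ‖ ≤ 2 * ξ 0 := by
    refine abs_le_of_sq_le_sq' ?_ (by linarith) |>.2
    nlinarith
  have b2 : ‖η‖ ≤ 2 * η 0 := by
    refine abs_le_of_sq_le_sq' ?_ (by linarith) |>.2
    nlinarith
  have c1 : ‖ξ‖ ≤ ‖η‖ := by
    refine abs_le_of_sq_le_sq' ?_ (norm_nonneg _) |>.2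
    nlinarith
  rcases eq_or_lt_of_le (add_nonneg (norm_nonneg ξ) (norm_nonneg η)) with h | h
  · have p1 : ξ 0 = 0 ∧ η 0 = 0 := by
      have := norm_nonneg ξ
      have := norm_nonneg η
      have hξ0 : ‖ξ‖ = 0 := by linarith
      have hη0 : ‖η‖ = 0 := by linarith
      rw [norm_eq_zero] at hξ0 hη0
      simp [hξ0, hη0]
    rw [p1.1, p1.2]; linarith
  · have : (η 0 - ξ 0) * (η 0 + ξ 0) = (‖η‖ - ‖ξ‖) * (‖ξ‖ + ‖η‖) := by nlinarith
    by_contra! hlt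
    nlinarith [mul_lt_mul_of_pos_right hlt h, mul_nonneg (sub_nonneg.2 h1)
      (by linarith : 0 ≤ 2 * (η 0 + ξ 0) - (‖ξ‖ + ‖η‖))]

/-- Volume of the part of a thin ellipsoidal shell in a ball that is far from both foci. -/
theorem volume_transversal_shell {a c : Space} {R δ k : ℝ} (hR : 0 ≤ R) (ha : ‖a‖ ≤ R)
    (hc : 4 * R ≤ ‖c‖) :
    volume {ξ : Space | ‖ξ - c‖ ≤ R ∧ |‖ξ‖ + ‖ξ - a‖ - k| ≤ δ}
      ≤ ENNReal.ofReal (Real.pi * R ^ 2 * (2 * δ)) := by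
  obtain ⟨e, he⟩ := exists_reflection c
  set c' : Space := ‖c‖ • EuclideanSpace.single 0 1 with hc'
  have hs1 : MeasurableSet {ξ : Space | ‖ξ - c'‖ ≤ R ∧ |‖ξ‖ + ‖ξ - e a‖ - k| ≤ δ} :=
    Measurable.setOf (by fun_prop)
  refine (volume_le_of_isometry e (S' := {ξ | ‖ξ - c'‖ ≤ R ∧ |‖ξ‖ + ‖ξ - e a‖ - k| ≤ δ})
    (fun ξ hξ => ?_) hs1).trans ?_
  · change ‖e ξ - c'‖ ≤ R ∧ |‖e ξ‖ + ‖e ξ - e a‖ - k| ≤ δ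
    rw [← he, ← map_sub, ← map_sub, e.norm_map, e.norm_map, e.norm_map]
    exact hξ
  have ha' : ‖e a‖ ≤ R := by rwa [e.norm_map]
  generalize e a = b at ha' hs1
  set S := {ξ : Space | ‖ξ - c'‖ ≤ R ∧ |‖ξ‖ + ‖ξ - b‖ - k| ≤ δ}
  let Ψ : ℝ × EuclideanSpace ℝ (Fin 2) → Space :=
    fun p => WithLp.toLp 2 (Fin.cons p.1 (WithLp.ofLp p.2) : Fin 3 → ℝ)
  have hΨ : ∀ ξ, Ψ (splitHead ξ) = ξ := by
    intro ξ; ext i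
    refine Fin.cases ?_ (fun j => ?_) i <;> simp [Ψ, splitHead]
  have hΨ' : ∀ p, splitHead (Ψ p) = p := by
    intro p; simp [Ψ, splitHead]
  have hmΨ : Measurable Ψ := by
    refine (WithLp.measurable_toLp 2 _).comp (measurable_pi_lambda _ fun i => ?_)
    refine Fin.cases ?_ (fun j => ?_) i
    · simp only [Fin.cons_zero]; fun_prop
    · simp only [Fin.cons_succ]; fun_prop
  have hcs : splitHead c' = (‖c‖, 0) := by
    ext i
    · simp [hc', splitHead]
    · simp [hc', splitHead]
  have hnle : ∀ ξ : Space, |ξ 0| ≤ ‖ξ‖ ∧ ‖(splitHead ξ).2‖ ≤ ‖ξ‖ := by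
    intro ξ
    have e1 : ‖ξ‖ ^ 2 = ξ 0 ^ 2 + ‖(splitHead ξ).2‖ ^ 2 := norm_sq_splitHead ξ
    constructor
    · refine abs_le_of_sq_le_sq ?_ (norm_nonneg _); nlinarith [sq_nonneg ‖(splitHead ξ).2‖]
    · refine abs_le_of_sq_le_sq' ?_ (norm_nonneg _) |>.2; nlinarith [sq_nonneg (ξ 0)]
  calc volume S ≤ volume (splitHead ⁻¹' (Ψ ⁻¹' S)) := by
        refine measure_mono fun ξ hξ => ?_
        simpa [hΨ] using hξ
    _ = volume (Ψ ⁻¹' S) :=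
        measurePreserving_splitHead.measure_preimage (hmΨ hs1).nullMeasurableSet
    _ = ∫⁻ y, volume {z : ℝ | Ψ (z, y) ∈ S} := Measure.prod_apply_symm (hmΨ hs1)
    _ ≤ ∫⁻ y, (Metric.closedBall (0 : EuclideanSpace ℝ (Fin 2)) R).indicator
          (fun _ => ENNReal.ofReal (2 * δ)) y := by
        refine lintegral_mono fun y => ?_
        by_cases hy : y ∈ Metric.closedBall (0 : EuclideanSpace ℝ (Fin 2)) R
        · rw [Set.indicator_of_mem hy]
          have hyR : ‖y‖ ≤ R := by simpa using hy
          refine volume_le_of_abs_sub_le ?_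
          have key : ∀ z z' : ℝ, Ψ (z, y) ∈ S → Ψ (z', y) ∈ S → z ≤ z' → z' - z ≤ 2 * δ := by
            rintro z z' ⟨h1, h2⟩ ⟨h1', h2'⟩ hz
            have hz1 : R * 3 ≤ z := by
              have := (hnle (Ψ (z, y) - c')).1.trans h1
              have e0 : (Ψ (z, y) - c') 0 = z - ‖c‖ := by simp [Ψ, hc']
              rw [e0, abs_le] at this
              linarith
            have i1 := norm_splitHead_increment (ξ := Ψ (z, y)) (η := Ψ (z', y)) (R := R)
              (by rw [hΨ', hΨ']) (by simpa [Ψ] using hz) (by simp [Ψ]; linarith)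
              (by rw [hΨ']; exact hyR)
            have hb := hnle b
            have hb1 := abs_le.1 hb.1
            have i2 := norm_splitHead_increment (ξ := Ψ (z, y) - b) (η := Ψ (z', y) - b) (R := 2 * R)
              (by rw [splitHead_sub, splitHead_sub, hΨ', hΨ']; rfl) (by simpa [Ψ] using hz)
              (by simp [Ψ]; linarith)
              (by
                rw [splitHead_sub, hΨ']
                refine (norm_sub_le _ _).trans ?_
                have := hb.2
                simp only
                linarith)
            have e1 : (Ψ (z', y)) 0 - (Ψ (z, y)) 0 = z' - z := by simp [Ψ]
            have e2 : (Ψ (z', y) - b) 0 - (Ψ (z, y) - b) 0 = z' - z := by simp [Ψ]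
            rw [e1] at i1
            rw [e2] at i2
            rw [abs_le] at h2 h2'
            linarith
          intro z hz z' hz'
          rcases le_total z z' with h | h
          · rw [abs_sub_comm, abs_of_nonneg (sub_nonneg.2 h)]; exact key z z' hz hz' h
          · rw [abs_of_nonneg (sub_nonneg.2 h)]; exact key z' z hz' hz h
        · have : {z : ℝ | Ψ (z, y) ∈ S} = ∅ := by
            ext z
            simp only [Set.mem_ofPred_eq, Set.mem_empty_iff_false, iff_false]
            rintro ⟨h1, -⟩
            have h3 := (hnle (Ψ (z, y) - c')).2.trans h1
            rw [splitHead_sub, hΨ', hcs] at h3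
            simp at h3 hy
            linarith
          simp [this]
    _ = _ := by
        rw [lintegral_indicator_const measurableSet_closedBall,
          EuclideanSpace.volume_closedBall_fin_two, ← ENNReal.ofReal_pow hR,
          ENNReal.ofReal_mul (p := Real.pi * R ^ 2) (by positivity),
          ENNReal.ofReal_mul Real.pi_nonneg]
        ring

/-! ## Trilinear bounds for neighbourhoods of the light cone -/

instance : (volume : Measure (ℝ × Space)).IsAddHaarMeasure :=
  inferInstanceAs ((volume : Measure ℝ).prod (volume : Measure Space)).IsAddHaarMeasure

theorem volume_time_slice {Ω : Set Space} (hΩ : MeasurableSet Ω) {φ ψ : Space → ℝ}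
    (hφ : Measurable φ) (hψ : Measurable ψ) (L₁ L₂ : ℝ) :
    volume {x : ℝ × Space | x.2 ∈ Ω ∧ |x.1 - φ x.2| ≤ L₁ ∧ |x.1 - ψ x.2| ≤ L₂}
      ≤ ENNReal.ofReal (2 * min L₁ L₂) * volume {ξ | ξ ∈ Ω ∧ |φ ξ - ψ ξ| ≤ L₁ + L₂} := by
  have hm : MeasurableSet {x : ℝ × Space | x.2 ∈ Ω ∧ |x.1 - φ x.2| ≤ L₁ ∧ |x.1 - ψ x.2| ≤ L₂} := by
    refine Measurable.setOf ?_
    have : Measurable fun x : ℝ × Space => x.2 ∈ Ω := (measurable_mem.2 hΩ).comp measurable_snd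
    fun_prop
  have hm2 : MeasurableSet {ξ | ξ ∈ Ω ∧ |φ ξ - ψ ξ| ≤ L₁ + L₂} := by
    refine Measurable.setOf ?_
    have : Measurable fun x : Space => x ∈ Ω := measurable_mem.2 hΩ
    fun_prop
  rw [Measure.volume_eq_prod, Measure.prod_apply_symm hm, ← lintegral_indicator_const hm2]
  refine lintegral_mono fun ξ => ?_
  by_cases hξ : ξ ∈ {ξ | ξ ∈ Ω ∧ |φ ξ - ψ ξ| ≤ L₁ + L₂}
  · rw [Set.indicator_of_mem hξ]
    refine volume_le_of_abs_sub_le ?_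
    rintro t ⟨-, h1, h2⟩ t' ⟨-, h1', h2'⟩
    simp only [abs_le] at *
    rcases min_choice L₁ L₂ with h | h <;> rw [h] <;> constructor <;> linarith
  · rw [Set.indicator_of_notMem hξ]
    refine le_of_eq (measure_mono_null (fun t ht => hξ ?_) measure_empty)
    obtain ⟨h0, h1, h2⟩ := ht
    refine ⟨h0, ?_⟩
    simp only [abs_le] at *
    constructor <;> linarith

/-- The `L`-neighbourhood of the half cone of sign `σ`. -/
def halfCone (σ L : ℝ) : Set (ℝ × Space) := {x | |x.1 - σ * ‖x.2‖| ≤ L}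

/-- The `L`-neighbourhood of the light cone. -/
def coneNhd (L : ℝ) : Set (ℝ × Space) := {x | |(|x.1| - ‖x.2‖)| ≤ L}

/-- Low spatial frequencies. -/
def lowFreq (r : ℝ) : Set (ℝ × Space) := {x | ‖x.2‖ ≤ r}

/-- High spatial frequencies. -/
def highFreq (r : ℝ) : Set (ℝ × Space) := {x | r ≤ ‖x.2‖}

theorem measurableSet_halfCone (σ L : ℝ) : MeasurableSet (halfCone σ L) :=
  Measurable.setOf (by fun_prop)

theorem measurableSet_coneNhd (L : ℝ) : MeasurableSet (coneNhd L) :=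
  Measurable.setOf (by fun_prop)

theorem measurableSet_lowFreq (r : ℝ) : MeasurableSet (lowFreq r) :=
  Measurable.setOf (by fun_prop)

theorem measurableSet_highFreq (r : ℝ) : MeasurableSet (highFreq r) :=
  Measurable.setOf (by fun_prop)

theorem coneNhd_subset (L : ℝ) : coneNhd L ⊆ halfCone 1 L ∪ halfCone (-1) L := by
  intro x hx
  have hx' : |(|x.1| - ‖x.2‖)| ≤ L := hx
  rcases le_total 0 x.1 with h | h
  · left
    rw [abs_of_nonneg h] at hx'
    simpa [halfCone] using hx'
  · right
    rw [abs_of_nonpos h, ← abs_neg] at hx'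
    change |x.1 - -1 * ‖x.2‖| ≤ L
    convert hx' using 2; ring

theorem min_mul_add_le {L₁ L₂ : ℝ} (h₁ : 0 ≤ L₁) (h₂ : 0 ≤ L₂) :
    min L₁ L₂ * (L₁ + L₂) ≤ 2 * (L₁ * L₂) := by
  rcases le_total L₁ L₂ with h | h
  · rw [min_eq_left h]; nlinarith
  · rw [min_eq_right h]; nlinarith

theorem volume_ball_halfCone_le (σ : ℝ) {r L : ℝ} (hr : 0 ≤ r) (hL : 0 ≤ L) (c : Space) :
    volume {x | ‖x.2 - c‖ ≤ r ∧ x ∈ halfCone σ L} ≤ ENNReal.ofReal (12 * (r ^ 3 * L)) := by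
  have h := volume_time_slice (Ω := Metric.closedBall c r) measurableSet_closedBall
    (φ := fun ξ => σ * ‖ξ‖) (ψ := fun ξ => σ * ‖ξ‖) (by fun_prop) (by fun_prop) L L
  refine (measure_mono ?_).trans (h.trans ?_)
  · rintro x ⟨h1, h2⟩
    exact ⟨by rw [Metric.mem_closedBall, dist_eq_norm]; exact h1, h2, h2⟩
  · refine (mul_le_mul' le_rfl (measure_mono (t := Metric.closedBall c r) fun ξ hξ => hξ.1)).trans ?_
    rw [EuclideanSpace.volume_closedBall_fin_three, ← ENNReal.ofReal_pow hr, min_self,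
      ← ENNReal.ofReal_mul (by positivity), ← ENNReal.ofReal_mul (by positivity)]
    refine ENNReal.ofReal_le_ofReal ?_
    have := Real.pi_lt_d2
    have h3 : 0 ≤ r ^ 3 * L := by positivity
    nlinarith

theorem triBound_low {r L : ℝ} (hr : 0 ≤ r) (hL : 0 ≤ L) (D : Set (ℝ × Space)) :
    TriBound (lowFreq r) (coneNhd L) D (ENNReal.ofReal (24 * (r ^ 3 * L)) ^ (1 / 2 : ℝ)) := by
  refine TriBound.of_fibre (measurableSet_lowFreq r) (measurableSet_coneNhd L) fun y _ => ?_
  have hsub : {x | x ∈ coneNhd L ∧ -x - y ∈ lowFreq r}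
      ⊆ {x | ‖x.2 - -y.2‖ ≤ r ∧ x ∈ halfCone 1 L} ∪ {x | ‖x.2 - -y.2‖ ≤ r ∧ x ∈ halfCone (-1) L} := by
    rintro x ⟨h2, h1⟩
    have h1' : ‖(-x - y).2‖ ≤ r := h1
    have e : ‖(-x - y).2‖ = ‖x.2 - -y.2‖ := by
      rw [← norm_neg]; congr 1; simp; abel
    rw [e] at h1'
    rcases coneNhd_subset L h2 with h | h
    exacts [Or.inl ⟨h1', h⟩, Or.inr ⟨h1', h⟩]
  refine (measure_mono hsub).trans ((measure_union_le _ _).trans ?_)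
  refine (add_le_add (volume_ball_halfCone_le 1 hr hL _)
    (volume_ball_halfCone_le (-1) hr hL _)).trans_eq ?_
  rw [← ENNReal.ofReal_add (by positivity) (by positivity)]
  congr 1; ring

theorem triBound_low_self {r L : ℝ} (hr : 0 ≤ r) (hL : 0 ≤ L) (B D : Set (ℝ × Space)) :
    TriBound (lowFreq r ∩ coneNhd L) B D (ENNReal.ofReal (24 * (r ^ 3 * L)) ^ (1 / 2 : ℝ)) := by
  refine TriBound.swap_left (TriBound.mono (TriBound.of_fibre (A := Set.univ)
    (B := lowFreq r ∩ coneNhd L) (D := Set.univ) MeasurableSet.univ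
    ((measurableSet_lowFreq r).inter (measurableSet_coneNhd L)) fun y _ => ?_)
    (Set.subset_univ _) le_rfl (Set.subset_univ _) le_rfl)
  have hsub : {x | x ∈ lowFreq r ∩ coneNhd L ∧ -x - y ∈ Set.univ}
      ⊆ {x | ‖x.2 - 0‖ ≤ r ∧ x ∈ halfCone 1 L} ∪ {x | ‖x.2 - 0‖ ≤ r ∧ x ∈ halfCone (-1) L} := by
    rintro x ⟨⟨h1, h2⟩, -⟩
    have h1' : ‖x.2 - 0‖ ≤ r := by rw [sub_zero]; exact h1
    rcases coneNhd_subset L h2 with h | h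
    exacts [Or.inl ⟨h1', h⟩, Or.inr ⟨h1', h⟩]
  refine (measure_mono hsub).trans ((measure_union_le _ _).trans ?_)
  refine (add_le_add (volume_ball_halfCone_le 1 hr hL _)
    (volume_ball_halfCone_le (-1) hr hL _)).trans_eq ?_
  rw [← ENNReal.ofReal_add (by positivity) (by positivity)]
  congr 1; ring

theorem volume_fibre_halfCone_le {σ σ' r ρ R L₁ L₂ : ℝ} (hσ' : σ' = 1 ∨ σ' = -1)
    (hR : 0 < R) (h₁ : 0 ≤ L₁) (h₂ : 0 ≤ L₂) (hρ : 0 ≤ ρ) {y : ℝ × Space} (hy : R ≤ ‖y.2‖) :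
    volume {x | x ∈ lowFreq r ∩ halfCone σ L₁ ∧ -x - y ∈ lowFreq ρ ∩ halfCone σ' L₂}
      ≤ ENNReal.ofReal (32 * (r ^ 2 * ρ / R * (L₁ * L₂))) := by
  have h := volume_time_slice (Ω := {ξ | ‖ξ‖ ≤ r ∧ ‖ξ - -y.2‖ ≤ ρ}) (Measurable.setOf (by fun_prop))
    (φ := fun ξ => σ * ‖ξ‖) (ψ := fun ξ => -y.1 - σ' * ‖ξ - -y.2‖) (by fun_prop) (by fun_prop) L₁ L₂
  have hn : 0 < ‖y.2‖ := hR.trans_le hy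
  refine (measure_mono ?_).trans (h.trans ?_)
  · rintro x ⟨⟨h1, h2⟩, h3, h4⟩
    have e : ‖(-x - y).2‖ = ‖x.2 - -y.2‖ := by
      rw [← norm_neg]; congr 1; simp; abel
    have h3' : ‖(-x - y).2‖ ≤ ρ := h3
    have h4' : |(-x - y).1 - σ' * ‖(-x - y).2‖| ≤ L₂ := h4
    rw [e] at h3' h4'
    refine ⟨⟨h1, h3'⟩, h2, ?_⟩
    rw [← abs_neg]
    convert h4' using 2
    simp; ring
  · have hv := volume_confocal_shell (a := -y.2) (by simpa using hn.ne') (r₁ := 0) (r₂ := r)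
      (ρ := ρ) (δ := L₁ + L₂) (c := -y.1) (σ := σ) le_rfl hσ'
    refine (mul_le_mul' le_rfl ((measure_mono ?_).trans hv)).trans ?_
    · rintro ξ ⟨⟨h1, h2⟩, h3⟩
      refine ⟨⟨norm_nonneg _, h1⟩, h2, ?_⟩
      convert h3 using 2; ring
    · rw [← ENNReal.ofReal_mul (by positivity)]
      refine ENNReal.ofReal_le_ofReal ?_
      rw [norm_neg]
      have e : 2 * min L₁ L₂ * (Real.pi * ((r ^ 2 - 0 ^ 2) * (2 * (L₁ + L₂) * ρ / ‖y.2‖)))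
          = 4 * Real.pi * (r ^ 2 * ρ / ‖y.2‖ * (min L₁ L₂ * (L₁ + L₂))) := by ring
      rw [e]
      have := min_mul_add_le h₁ h₂
      calc 4 * Real.pi * (r ^ 2 * ρ / ‖y.2‖ * (min L₁ L₂ * (L₁ + L₂)))
          ≤ 4 * 4 * (r ^ 2 * ρ / R * (2 * (L₁ * L₂))) := by
            gcongr
            exact Real.pi_lt_four.le
        _ = _ := by ring

theorem triBound_transfer {r ρ R L₁ L₂ : ℝ} (hR : 0 < R) (h₁ : 0 ≤ L₁) (h₂ : 0 ≤ L₂)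
    (hρ : 0 ≤ ρ) :
    TriBound (lowFreq ρ ∩ coneNhd L₂) (lowFreq r ∩ coneNhd L₁) (highFreq R)
      (ENNReal.ofReal (128 * (r ^ 2 * ρ / R * (L₁ * L₂))) ^ (1 / 2 : ℝ)) := by
  refine TriBound.of_fibre ((measurableSet_lowFreq _).inter (measurableSet_coneNhd _))
    ((measurableSet_lowFreq _).inter (measurableSet_coneNhd _)) fun y hy => ?_
  let W : ℝ → ℝ → Set (ℝ × Space) := fun σ σ' =>
    {x | x ∈ lowFreq r ∩ halfCone σ L₁ ∧ -x - y ∈ lowFreq ρ ∩ halfCone σ' L₂}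
  have hsub : {x | x ∈ lowFreq r ∩ coneNhd L₁ ∧ -x - y ∈ lowFreq ρ ∩ coneNhd L₂}
      ⊆ (W 1 1 ∪ W 1 (-1)) ∪ (W (-1) 1 ∪ W (-1) (-1)) := by
    rintro x ⟨⟨h1, h2⟩, h3, h4⟩
    rcases coneNhd_subset _ h2 with h | h <;> rcases coneNhd_subset _ h4 with h' | h'
    exacts [Or.inl (Or.inl ⟨⟨h1, h⟩, h3, h'⟩), Or.inl (Or.inr ⟨⟨h1, h⟩, h3, h'⟩),
      Or.inr (Or.inl ⟨⟨h1, h⟩, h3, h'⟩), Or.inr (Or.inr ⟨⟨h1, h⟩, h3, h'⟩)]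
  have hW : ∀ σ σ' : ℝ, σ' = 1 ∨ σ' = -1 → volume (W σ σ')
      ≤ ENNReal.ofReal (32 * (r ^ 2 * ρ / R * (L₁ * L₂))) := fun σ σ' hσ' =>
    volume_fibre_halfCone_le hσ' hR h₁ h₂ hρ hy
  refine (measure_mono hsub).trans ((measure_union_le _ _).trans ((add_le_add
    (measure_union_le _ _) (measure_union_le _ _)).trans ((add_le_add
    (add_le_add (hW _ _ (.inl rfl)) (hW _ _ (.inr rfl)))
    (add_le_add (hW _ _ (.inl rfl)) (hW _ _ (.inr rfl)))).trans_eq ?_)))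
  rw [← ENNReal.ofReal_add (by positivity) (by positivity),
    ← ENNReal.ofReal_add (by positivity) (by positivity)]
  congr 1; ring

/-- Localization of two high frequencies with low sum to antipodal balls. -/
theorem TriBound.of_balls {A B D : Set (ℝ × Space)} {R : ℝ} (hR : 0 < R) {C : ℝ≥0∞}
    (hA : A ⊆ lowFreq R)
    (hloc : ∀ c : Space, TriBound A (B ∩ {x | ‖x.2 - c‖ ≤ R}) (D ∩ {y | ‖y.2 + c‖ ≤ 2 * R}) C) :
    TriBound A B D (3 * C) := by
  set m : ℝ≥0∞ := volume (Metric.closedBall (0 : Space) R) with hm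
  have hball : ∀ c : Space, volume (Metric.closedBall c R) = m := fun c => by
    rw [hm, EuclideanSpace.volume_closedBall_fin_three, EuclideanSpace.volume_closedBall_fin_three]
  have hball2 : ∀ c : Space, volume (Metric.closedBall c (2 * R)) = 8 * m := fun c => by
    rw [hm, EuclideanSpace.volume_closedBall_fin_three, EuclideanSpace.volume_closedBall_fin_three,
      ENNReal.ofReal_mul (by norm_num), mul_pow]
    norm_num [mul_assoc]
  have hm0 : m ≠ 0 := (Metric.measure_closedBall_pos _ _ hR).ne'
  have hmt : m ≠ ⊤ := measure_closedBall_lt_top.ne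
  refine (TriBound.of_local (volume : Measure Space)
    {p : Space × (ℝ × Space) | ‖p.2.2 - p.1‖ ≤ R} {p : Space × (ℝ × Space) | ‖p.2.2 + p.1‖ ≤ 2 * R}
    (Measurable.setOf (by fun_prop)) (Measurable.setOf (by fun_prop)) (m := m) (M₁ := m)
    (M₂ := 8 * m) (C := C) hm0 hmt ?_ ?_ ?_ hloc).mono le_rfl le_rfl le_rfl ?_
  · intro x _ y _ hxy
    have h : ‖(-x - y).2‖ ≤ R := hA hxy
    rw [← hball x.2]
    refine measure_mono fun ω hω => ?_
    rw [Metric.mem_closedBall, dist_eq_norm, norm_sub_rev] at hω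
    refine ⟨hω, ?_⟩
    have : y.2 + ω = -(-x - y).2 - (x.2 - ω) := by simp; abel
    change ‖y.2 + ω‖ ≤ 2 * R
    rw [this]
    refine (norm_sub_le _ _).trans ?_
    rw [norm_neg]; linarith
  · intro x
    rw [← hball x.2]
    refine measure_mono fun ω hω => ?_
    rw [Metric.mem_closedBall, dist_eq_norm, norm_sub_rev]
    exact hω
  · intro y
    rw [← hball2 (-y.2)]
    refine measure_mono fun ω hω => ?_
    rw [Metric.mem_closedBall, dist_eq_norm, sub_neg_eq_add, add_comm]
    exact hω
  · rw [ENNReal.mul_rpow_of_nonneg _ _ (by norm_num)]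
    have h8 : (8 : ℝ≥0∞) ^ (1 / 2 : ℝ) ≤ 3 := by
      calc (8 : ℝ≥0∞) ^ (1 / 2 : ℝ) ≤ (3 ^ 2 : ℝ≥0∞) ^ (1 / 2 : ℝ) := by gcongr; norm_num
        _ = 3 := sq_rpow_half 3
    have hmm : m ^ (1 / 2 : ℝ) * m ^ (1 / 2 : ℝ) = m := by
      rw [← ENNReal.rpow_add _ _ hm0 hmt]; norm_num
    calc m⁻¹ * (C * (m ^ (1 / 2 : ℝ) * (8 ^ (1 / 2 : ℝ) * m ^ (1 / 2 : ℝ))))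
        = m⁻¹ * (m ^ (1 / 2 : ℝ) * m ^ (1 / 2 : ℝ)) * (8 ^ (1 / 2 : ℝ) * C) := by ring
      _ = 8 ^ (1 / 2 : ℝ) * C := by rw [hmm, ENNReal.inv_mul_cancel hm0 hmt, one_mul]
      _ ≤ _ := by gcongr

theorem triBound_opposite {σ r R L₁ L₂ : ℝ} (hσ : σ = 1 ∨ σ = -1) (hR : 0 < R) (h₁ : 0 ≤ L₁)
    (h₂ : 0 ≤ L₂) {A B D : Set (ℝ × Space)} (hA : A ⊆ lowFreq R)
    (hB : B ⊆ lowFreq r ∩ highFreq (5 * R) ∩ halfCone σ L₁) (hD : D ⊆ halfCone (-σ) L₂) :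
    TriBound A B D (3 * ENNReal.ofReal (512 * (r * R * (L₁ * L₂))) ^ (1 / 2 : ℝ)) := by
  refine TriBound.of_balls hR hA fun c => ?_
  refine (TriBound.of_fibre_correlation (A := A)
    (B := (lowFreq r ∩ highFreq (5 * R) ∩ halfCone σ L₁) ∩ {x | ‖x.2 - c‖ ≤ R})
    (D := halfCone (-σ) L₂ ∩ {y | ‖y.2 + c‖ ≤ 2 * R}) ?_ ?_ fun z => ?_).mono le_rfl
    (Set.inter_subset_inter_left _ hB) (Set.inter_subset_inter_left _ hD) le_rfl
  · exact (((measurableSet_lowFreq _).inter (measurableSet_highFreq _)).inter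
      (measurableSet_halfCone _ _)).inter (Measurable.setOf (by fun_prop))
  · exact (measurableSet_halfCone _ _).inter (Measurable.setOf (by fun_prop))
  set W := {x | x ∈ (lowFreq r ∩ highFreq (5 * R) ∩ halfCone σ L₁) ∩ {x | ‖x.2 - c‖ ≤ R} ∧
    x + z ∈ halfCone (-σ) L₂ ∩ {y | ‖y.2 + c‖ ≤ 2 * R}} with hWdef
  rcases W.eq_empty_or_nonempty with hW | ⟨x₀, ⟨⟨⟨k1, k2⟩, -⟩, k3⟩, -, k4⟩
  · simp [hW]
  have k1' : ‖x₀.2‖ ≤ r := k1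
  have k2' : 5 * R ≤ ‖x₀.2‖ := k2
  have k3' : ‖x₀.2 - c‖ ≤ R := k3
  have k4' : ‖x₀.2 + z.2 + c‖ ≤ 2 * R := k4
  have hc1 : 4 * R ≤ ‖c‖ := by
    have := norm_le_norm_add_norm_sub' x₀.2 c
    linarith
  have hc2 : ‖c‖ ≤ 2 * r := by
    have := norm_le_norm_add_norm_sub x₀.2 c
    linarith
  have hz : ‖c‖ ≤ ‖z.2‖ := by
    have e : (2 : ℝ) • c = (x₀.2 + z.2 + c) - (x₀.2 - c) - z.2 := by module
    have := norm_sub_le ((x₀.2 + z.2 + c) - (x₀.2 - c)) z.2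
    have := norm_sub_le (x₀.2 + z.2 + c) (x₀.2 - c)
    have e2 : ‖(2 : ℝ) • c‖ = 2 * ‖c‖ := by simp [norm_smul]
    rw [e] at e2
    linarith
  have hcpos : 0 < ‖c‖ := by linarith
  have hzpos : 0 < ‖z.2‖ := by linarith
  have h := volume_time_slice
    (Ω := {ξ | (‖c‖ - R ≤ ‖ξ‖ ∧ ‖ξ‖ ≤ ‖c‖ + R) ∧ ‖ξ - -z.2‖ ≤ 2 * ‖c‖})
    (Measurable.setOf (by fun_prop))
    (φ := fun ξ => σ * ‖ξ‖) (ψ := fun ξ => -z.1 - σ * ‖ξ - -z.2‖) (by fun_prop) (by fun_prop) L₁ L₂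
  refine (measure_mono ?_).trans (h.trans ?_)
  · rintro x ⟨⟨⟨-, a1⟩, a2⟩, a3, a4⟩
    have a2' : ‖x.2 - c‖ ≤ R := a2
    have a4' : ‖x.2 + z.2 + c‖ ≤ 2 * R := a4
    have a3' : |x.1 + z.1 - -σ * ‖x.2 + z.2‖| ≤ L₂ := a3
    have b1 := norm_le_norm_add_norm_sub' x.2 c
    have b2 := norm_le_norm_add_norm_sub x.2 c
    have b3 := norm_sub_le (x.2 + z.2 + c) c
    rw [add_sub_cancel_right] at b3
    refine ⟨⟨⟨by linarith, by linarith⟩, ?_⟩, a1, ?_⟩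
    · rw [sub_neg_eq_add]; linarith
    · rw [sub_neg_eq_add]; convert a3' using 2; ring
  · have hv := volume_confocal_shell (a := -z.2) (by simpa using hzpos.ne') (r₁ := ‖c‖ - R)
      (r₂ := ‖c‖ + R) (ρ := 2 * ‖c‖) (δ := L₁ + L₂) (c := -z.1) (σ := σ) (by linarith) hσ
    refine (mul_le_mul' le_rfl ((measure_mono ?_).trans hv)).trans ?_
    · rintro ξ ⟨⟨a1, a2⟩, a3⟩
      refine ⟨a1, a2, ?_⟩
      convert a3 using 2; ring
    · rw [← ENNReal.ofReal_mul (by positivity)]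
      refine ENNReal.ofReal_le_ofReal ?_
      rw [norm_neg]
      have e : 2 * min L₁ L₂ * (Real.pi * (((‖c‖ + R) ^ 2 - (‖c‖ - R) ^ 2) *
          (2 * (L₁ + L₂) * (2 * ‖c‖) / ‖z.2‖)))
          = 32 * Real.pi * (‖c‖ * R * (‖c‖ / ‖z.2‖) * (min L₁ L₂ * (L₁ + L₂))) := by ring
      rw [e]
      have := min_mul_add_le h₁ h₂
      have hr : 0 ≤ r := by linarith
      have hq : ‖c‖ / ‖z.2‖ ≤ 1 := (div_le_one hzpos).2 hz
      calc 32 * Real.pi * (‖c‖ * R * (‖c‖ / ‖z.2‖) * (min L₁ L₂ * (L₁ + L₂)))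
          ≤ 32 * 4 * (2 * r * R * 1 * (2 * (L₁ * L₂))) := by
            gcongr
            exact Real.pi_lt_four.le
        _ = _ := by ring

theorem triBound_same {σ R L₁ L₂ : ℝ} (hσ : σ = 1 ∨ σ = -1) (hR : 0 < R) (h₁ : 0 ≤ L₁)
    (h₂ : 0 ≤ L₂) {A B D : Set (ℝ × Space)} (hA : A ⊆ lowFreq R)
    (hB : B ⊆ highFreq (5 * R) ∩ halfCone σ L₁) (hD : D ⊆ halfCone σ L₂) :
    TriBound A B D (3 * ENNReal.ofReal (32 * (R ^ 2 * (L₁ * L₂))) ^ (1 / 2 : ℝ)) := by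
  refine TriBound.of_balls hR hA fun c => ?_
  refine TriBound.mono (TriBound.swap_right (TriBound.swap_left (TriBound.swap_right
    (TriBound.of_fibre (A := halfCone σ L₂)
    (B := (highFreq (5 * R) ∩ halfCone σ L₁) ∩ {x | ‖x.2 - c‖ ≤ R})
    (D := lowFreq R) (V := ENNReal.ofReal (32 * (R ^ 2 * (L₁ * L₂)))) ?_ ?_ fun y hy => ?_)))) hA
    (Set.inter_subset_inter_left _ hB) (Set.inter_subset_left.trans hD) le_rfl
  · exact measurableSet_halfCone _ _
  · exact ((measurableSet_highFreq _).inter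
      (measurableSet_halfCone _ _)).inter (Measurable.setOf (by fun_prop))
  set W := {x | x ∈ (highFreq (5 * R) ∩ halfCone σ L₁) ∩ {x | ‖x.2 - c‖ ≤ R} ∧
    -x - y ∈ halfCone σ L₂} with hWdef
  rcases W.eq_empty_or_nonempty with hW | ⟨x₀, ⟨⟨k2, -⟩, k3⟩, -⟩
  · simp [hW]
  have k2' : 5 * R ≤ ‖x₀.2‖ := k2
  have k3' : ‖x₀.2 - c‖ ≤ R := k3
  have hc1 : 4 * R ≤ ‖c‖ := by
    have := norm_le_norm_add_norm_sub' x₀.2 c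
    linarith
  have h := volume_time_slice (Ω := Metric.closedBall c R) measurableSet_closedBall
    (φ := fun ξ => σ * ‖ξ‖) (ψ := fun ξ => -y.1 - σ * ‖ξ - -y.2‖) (by fun_prop) (by fun_prop) L₁ L₂
  refine (measure_mono ?_).trans (h.trans ?_)
  · rintro x ⟨⟨⟨-, a1⟩, a2⟩, a3⟩
    have a3' : |(-x - y).1 - σ * ‖(-x - y).2‖| ≤ L₂ := a3
    have e : ‖(-x - y).2‖ = ‖x.2 - -y.2‖ := by
      rw [← norm_neg]; congr 1; simp; abel
    rw [e] at a3'
    refine ⟨by rw [Metric.mem_closedBall, dist_eq_norm]; exact a2, a1, ?_⟩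
    rw [← abs_neg]
    convert a3' using 2
    simp; ring
  · have hv := volume_transversal_shell (a := -y.2) (c := c) (R := R) (δ := L₁ + L₂)
      (k := -σ * y.1) hR.le (by rw [norm_neg]; exact hy) hc1
    refine (mul_le_mul' le_rfl ((measure_mono ?_).trans hv)).trans ?_
    · rintro ξ ⟨a1, a2⟩
      refine ⟨by simpa [dist_eq_norm] using a1, ?_⟩
      rcases hσ with rfl | rfl
      · convert a2 using 2; ring
      · rw [← abs_neg]; convert a2 using 2; ring
    · rw [← ENNReal.ofReal_mul (by positivity)]
      refine ENNReal.ofReal_le_ofReal ?_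
      have e : 2 * min L₁ L₂ * (Real.pi * R ^ 2 * (2 * (L₁ + L₂)))
          = 4 * Real.pi * (R ^ 2 * (min L₁ L₂ * (L₁ + L₂))) := by ring
      rw [e]
      have := min_mul_add_le h₁ h₂
      calc 4 * Real.pi * (R ^ 2 * (min L₁ L₂ * (L₁ + L₂)))
          ≤ 4 * 4 * (R ^ 2 * (2 * (L₁ * L₂))) := by
            gcongr
            exact Real.pi_lt_four.le
        _ = _ := by ring

/-! ## Dyadic pieces -/

section Pieces

/-- The dyadic piece where `1 + |ξ| ∼ 2 ^ n` and `1 + ||τ| - |ξ|| ∼ 2 ^ l`. -/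
def piece (p : ℕ × ℕ) : Set (ℝ × Space) :=
  {x | ((2:ℝ) ^ p.1 ≤ 1 + ‖x.2‖ ∧ 1 + ‖x.2‖ < 2 ^ (p.1 + 1)) ∧
    (2:ℝ) ^ p.2 ≤ 1 + |(|x.1| - ‖x.2‖)| ∧ 1 + |(|x.1| - ‖x.2‖)| < 2 ^ (p.2 + 1)}

theorem measurableSet_piece (p : ℕ × ℕ) : MeasurableSet (piece p) :=
  Measurable.setOf (by fun_prop)

variable {n l n₀ n₁ n₂ l₀ l₁ l₂ c : ℕ}

theorem piece_subset_lowFreq : piece (n, l) ⊆ lowFreq (2 ^ (n + 1)) := fun x hx => by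
  have h : 1 + ‖x.2‖ < 2 ^ (n + 1) := hx.1.2
  show ‖x.2‖ ≤ 2 ^ (n + 1)
  linarith

theorem piece_subset_coneNhd : piece (n, l) ⊆ coneNhd (2 ^ (l + 1)) := fun x hx => by
  have h : 1 + |(|x.1| - ‖x.2‖)| < 2 ^ (l + 1) := hx.2.2
  show |(|x.1| - ‖x.2‖)| ≤ 2 ^ (l + 1)
  linarith

theorem piece_subset_highFreq : piece (n + 1, l) ⊆ highFreq (2 ^ n) := fun x hx => by
  have h : (2:ℝ) ^ (n + 1) ≤ 1 + ‖x.2‖ := hx.1.1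
  have h1 : (1:ℝ) ≤ 2 ^ n := one_le_pow₀ (by norm_num)
  show 2 ^ n ≤ ‖x.2‖
  rw [pow_succ] at h; linarith

theorem piece_subset : piece (n, l) ⊆ lowFreq (2 ^ (n + 1)) ∩ coneNhd (2 ^ (l + 1)) :=
  Set.subset_inter piece_subset_lowFreq piece_subset_coneNhd

theorem ofReal_rpow_half_le {x : ℝ} {m : ℕ} (h : x ≤ 2 ^ m) :
    ENNReal.ofReal x ^ (1 / 2 : ℝ) ≤ (2:ℝ≥0∞) ^ ((m : ℝ) / 2) := by
  have h1 : ENNReal.ofReal x ≤ (2:ℝ≥0∞) ^ (m : ℝ) := by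
    refine (ENNReal.ofReal_le_ofReal h).trans_eq ?_
    rw [ENNReal.ofReal_pow (by norm_num), ENNReal.rpow_natCast]; norm_num
  calc _ ≤ ((2:ℝ≥0∞) ^ (m : ℝ)) ^ (1 / 2 : ℝ) := by gcongr
    _ = _ := by rw [← ENNReal.rpow_mul]; ring_nf

theorem triBound_piece_low_self (B D : Set (ℝ × Space)) :
    TriBound (piece (n, l)) B D (2 ^ (((3 * n + l + 9 : ℕ) : ℝ) / 2)) := by
  refine (triBound_low_self (by positivity) (by positivity) B D).mono piece_subset le_rfl le_rfl
    (ofReal_rpow_half_le ?_)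
  have : (0:ℝ) < 2 ^ (3 * n + l) := by positivity
  calc 24 * (((2:ℝ) ^ (n + 1)) ^ 3 * 2 ^ (l + 1)) = 384 * 2 ^ (3 * n + l) := by ring
    _ ≤ 512 * 2 ^ (3 * n + l) := by linarith
    _ = _ := by ring

theorem triBound_piece_low (D : Set (ℝ × Space)) :
    TriBound (piece (n₀, l₀)) (piece (n₁, l₁)) D (2 ^ (((3 * n₀ + l₁ + 9 : ℕ) : ℝ) / 2)) := by
  refine (triBound_low (by positivity) (by positivity) D).mono piece_subset_lowFreq
    piece_subset_coneNhd le_rfl (ofReal_rpow_half_le ?_)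
  have : (0:ℝ) < 2 ^ (3 * n₀ + l₁) := by positivity
  calc 24 * (((2:ℝ) ^ (n₀ + 1)) ^ 3 * 2 ^ (l₁ + 1)) = 384 * 2 ^ (3 * n₀ + l₁) := by ring
    _ ≤ 512 * 2 ^ (3 * n₀ + l₁) := by linarith
    _ = _ := by ring

theorem two_rpow_le_two_rpow {s t : ℝ} (h : s ≤ t) : (2:ℝ≥0∞) ^ s ≤ 2 ^ t :=
  ENNReal.rpow_le_rpow_of_exponent_le (by norm_num) h

theorem two_rpow_half_mono {m m' : ℕ} (h : m ≤ m') :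
    (2:ℝ≥0∞) ^ ((m : ℝ) / 2) ≤ 2 ^ ((m' : ℝ) / 2) :=
  two_rpow_le_two_rpow (by gcongr)

theorem triBound_piece_transfer (h₀ : n₀ ≤ n₂ + c) (h₁ : n₁ ≤ n₂ + c) :
    TriBound (piece (n₀, l₀)) (piece (n₁, l₁)) (piece (n₂, l₂))
      (2 ^ (((2 * n₀ + l₀ + l₁ + c + 13 : ℕ) : ℝ) / 2)) := by
  rcases n₂ with _ | k
  · refine TriBound.mono (triBound_piece_low_self _ _) le_rfl le_rfl le_rfl
      (two_rpow_half_mono (by omega))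
  · refine TriBound.swap_left (TriBound.mono (triBound_transfer (r := 2 ^ (n₀ + 1))
      (ρ := 2 ^ (n₁ + 1)) (R := 2 ^ k) (by positivity) (by positivity) (by positivity)
      (by positivity)) piece_subset piece_subset piece_subset_highFreq (ofReal_rpow_half_le ?_))
    have h1 : (2:ℝ) ^ (n₁ + 1) / 2 ^ k ≤ 2 ^ (c + 2) := by
      rw [div_le_iff₀ (by positivity), ← pow_add]
      exact pow_le_pow_right₀ (by norm_num) (by omega)
    calc 128 * (((2:ℝ) ^ (n₀ + 1)) ^ 2 * 2 ^ (n₁ + 1) / 2 ^ k * (2 ^ (l₀ + 1) * 2 ^ (l₁ + 1)))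
        = 128 * (((2:ℝ) ^ (n₀ + 1)) ^ 2 * (2 ^ (n₁ + 1) / 2 ^ k) * (2 ^ (l₀ + 1) * 2 ^ (l₁ + 1))) := by
          ring
      _ ≤ 128 * (((2:ℝ) ^ (n₀ + 1)) ^ 2 * 2 ^ (c + 2) * (2 ^ (l₀ + 1) * 2 ^ (l₁ + 1))) := by gcongr
      _ = _ := by ring

theorem TriBound.of_empty {A B D : Set (ℝ × Space)}
    (h : ∀ x ∈ B, ∀ y ∈ D, -x - y ∉ A) : TriBound A B D 0 := by
  intro f g k _ _ _ hfA hgB hkD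
  have : tri f g k = 0 := by
    unfold tri
    refine (lintegral_congr (g := fun _ => 0) fun x =>
      (lintegral_congr (g := fun _ => 0) fun y => ?_).trans lintegral_zero).trans lintegral_zero
    by_cases hx : x ∈ B
    · by_cases hy : y ∈ D
      · simp [hfA _ (h x hx y hy)]
      · simp [hkD y hy]
    · simp [hgB x hx]
  simp [this]

/-- The half-space of times of sign `σ`. -/
def signSet (σ : ℝ) : Set (ℝ × Space) := {x | 0 ≤ σ * x.1}

theorem measurableSet_signSet (σ : ℝ) : MeasurableSet (signSet σ) :=
  measurableSet_le (by fun_prop) (by fun_prop)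

theorem signSet_union : signSet 1 ∪ signSet (-1) = Set.univ := by
  ext x
  have h : 0 ≤ 1 * x.1 ∨ 0 ≤ (-1) * x.1 := by
    rcases le_total 0 x.1 with h | h
    · left; linarith
    · right; linarith
  exact ⟨fun _ => trivial, fun _ => h⟩

theorem coneNhd_inter_signSet {σ L : ℝ} (hσ : σ = 1 ∨ σ = -1) :
    coneNhd L ∩ signSet σ ⊆ halfCone σ L := by
  rintro x ⟨h1, h2⟩
  have h1 : |(|x.1| - ‖x.2‖)| ≤ L := h1
  have h2 : 0 ≤ σ * x.1 := h2
  show |x.1 - σ * ‖x.2‖| ≤ L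
  rcases hσ with rfl | rfl
  · rw [abs_of_nonneg (by linarith : 0 ≤ x.1)] at h1; simpa using h1
  · rw [abs_of_nonpos (by linarith : x.1 ≤ 0)] at h1
    rw [← abs_neg]; convert h1 using 2; ring

theorem TriBound.of_signs {A B D : Set (ℝ × Space)} {C : ℝ≥0∞} (hB : MeasurableSet B)
    (hD : MeasurableSet D)
    (h : ∀ σ σ' : ℝ, (σ = 1 ∨ σ = -1) → (σ' = 1 ∨ σ' = -1) →
      TriBound A (B ∩ signSet σ) (D ∩ signSet σ') C) : TriBound A B D (4 * C) := by
  have e : ∀ S : Set (ℝ × Space), S = (S ∩ signSet 1) ∪ (S ∩ signSet (-1)) := fun S => by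
    rw [← Set.inter_union_distrib_left, signSet_union, Set.inter_univ]
  have h1 : ∀ σ, (σ = 1 ∨ σ = -1) → TriBound A (B ∩ signSet σ) D (C + C) := fun σ hσ => by
    rw [e D]
    exact ((TriBound.union_mid (hD.inter (measurableSet_signSet _))
      (hD.inter (measurableSet_signSet _)) (h σ 1 hσ (Or.inl rfl)).swap_right
      (h σ (-1) hσ (Or.inr rfl)).swap_right)).swap_right
  have h2 := TriBound.union_mid (hB.inter (measurableSet_signSet _))
      (hB.inter (measurableSet_signSet _)) (h1 1 (Or.inl rfl)) (h1 (-1) (Or.inr rfl))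
  rw [← e B] at h2
  convert h2 using 1
  ring

theorem four_mul_three_mul_le {x : ℝ} {m : ℕ} (h : x ≤ 2 ^ m) :
    4 * (3 * ENNReal.ofReal x ^ (1 / 2 : ℝ)) ≤ 2 ^ (((m + 8 : ℕ) : ℝ) / 2) := by
  have e : (2:ℝ≥0∞) ^ (((m + 8 : ℕ) : ℝ) / 2) = 16 * 2 ^ ((m : ℝ) / 2) := by
    rw [show ((m + 8 : ℕ) : ℝ) / 2 = (4 : ℕ) + (m : ℝ) / 2 by push_cast; ring,
      ENNReal.rpow_add _ _ (by norm_num) (by norm_num), ENNReal.rpow_natCast]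
    norm_num
  rw [e, ← mul_assoc]
  gcongr
  · norm_num
  · exact ofReal_rpow_half_le h

theorem triBound_piece_same (h : n₀ + 5 ≤ n₁) {σ : ℝ} (hσ : σ = 1 ∨ σ = -1) :
    TriBound (piece (n₀, l₀)) (piece (n₁, l₁) ∩ signSet σ) (piece (n₂, l₂) ∩ signSet σ)
      (3 * ENNReal.ofReal (2 ^ (2 * n₀ + l₁ + l₂ + 9)) ^ (1 / 2 : ℝ)) := by
  obtain ⟨k, rfl⟩ : ∃ k, n₁ = k + 1 := ⟨n₁ - 1, by omega⟩
  refine TriBound.mono (triBound_same (R := 2 ^ (n₀ + 1)) (L₁ := 2 ^ (l₁ + 1)) (L₂ := 2 ^ (l₂ + 1))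
    hσ (by positivity) (by positivity) (by positivity) piece_subset_lowFreq ?_ ?_)
    le_rfl le_rfl le_rfl ?_
  · rintro x ⟨hx, hs⟩
    refine ⟨?_, coneNhd_inter_signSet hσ ⟨piece_subset_coneNhd hx, hs⟩⟩
    have h1 : 2 ^ k ≤ ‖x.2‖ := piece_subset_highFreq hx
    have h2 : (2:ℝ) ^ (n₀ + 4) ≤ 2 ^ k := pow_le_pow_right₀ (by norm_num) (by omega)
    have h3 : (0:ℝ) < 2 ^ n₀ := by positivity
    show 5 * 2 ^ (n₀ + 1) ≤ ‖x.2‖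
    rw [pow_add] at h2 ⊢; linarith
  · rintro x ⟨hx, hs⟩
    exact coneNhd_inter_signSet hσ ⟨piece_subset_coneNhd hx, hs⟩
  · gcongr
    exact le_of_eq (by ring)

theorem triBound_piece_bilinear (h₁ : n₀ ≤ n₁) (h : n₁ ≤ n₂ + 1) (h' : n₂ ≤ n₁ + 1) :
    TriBound (piece (n₀, l₀)) (piece (n₁, l₁)) (piece (n₂, l₂))
      (2 ^ (((n₀ + n₁ + l₁ + l₂ + 24 : ℕ) : ℝ) / 2)) := by
  rcases le_or_gt (n₀ + 5) n₁ with h5 | h5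
  · refine (TriBound.of_signs (C := 3 * ENNReal.ofReal (2 ^ (n₀ + n₁ + l₁ + l₂ + 16)) ^ (1 / 2 : ℝ))
      (measurableSet_piece _) (measurableSet_piece _) ?_).mono
      le_rfl le_rfl le_rfl (four_mul_three_mul_le le_rfl)
    intro σ σ' hσ hσ'
    by_cases e : σ' = σ
    · subst e
      refine (triBound_piece_same h5 hσ).mono le_rfl le_rfl le_rfl ?_
      gcongr 3 * ENNReal.ofReal (2 ^ ?_) ^ (1 / 2 : ℝ)
      · norm_num
      · omega
    · have e' : σ' = -σ := by
        rcases hσ with rfl | rfl <;> rcases hσ' with rfl | rfl <;> simp_all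
      subst e'
      obtain ⟨k, rfl⟩ : ∃ k, n₁ = k + 1 := ⟨n₁ - 1, by omega⟩
      refine TriBound.mono (triBound_opposite (R := 2 ^ (n₀ + 1)) (r := 2 ^ (k + 2))
        (L₁ := 2 ^ (l₁ + 1)) (L₂ := 2 ^ (l₂ + 1))
        hσ (by positivity) (by positivity) (by positivity) piece_subset_lowFreq ?_ ?_)
        le_rfl le_rfl le_rfl ?_
      · rintro x ⟨hx, hs⟩
        refine ⟨⟨piece_subset_lowFreq hx, ?_⟩,
          coneNhd_inter_signSet hσ ⟨piece_subset_coneNhd hx, hs⟩⟩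
        have h1 : 2 ^ k ≤ ‖x.2‖ := piece_subset_highFreq hx
        have h2 : (2:ℝ) ^ (n₀ + 4) ≤ 2 ^ k := pow_le_pow_right₀ (by norm_num) (by omega)
        have h3 : (0:ℝ) < 2 ^ n₀ := by positivity
        show 5 * 2 ^ (n₀ + 1) ≤ ‖x.2‖
        rw [pow_add] at h2 ⊢; linarith
      · rintro x ⟨hx, hs⟩
        exact coneNhd_inter_signSet hσ' ⟨piece_subset_coneNhd hx, hs⟩
      · gcongr
        have : (0:ℝ) < 2 ^ (n₀ + k + l₁ + l₂) := by positivity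
        calc 512 * ((2:ℝ) ^ (k + 2) * 2 ^ (n₀ + 1) * (2 ^ (l₁ + 1) * 2 ^ (l₂ + 1)))
            = 16384 * 2 ^ (n₀ + k + l₁ + l₂) := by ring
          _ ≤ 131072 * 2 ^ (n₀ + k + l₁ + l₂) := by linarith
          _ = _ := by ring
  · refine TriBound.mono (TriBound.swap_left (TriBound.swap_right (TriBound.swap_left
      (triBound_piece_transfer (n₀ := n₁) (n₁ := n₂) (n₂ := n₀) (c := 6) (by omega)
      (by omega))))).swap_right le_rfl le_rfl le_rfl (two_rpow_half_mono (by omega))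

theorem triBound_piece_bilinear_same (h : n₀ + 5 ≤ n₁)
    (hopp : ∀ σ : ℝ, (σ = 1 ∨ σ = -1) → ∀ x ∈ piece (n₁, l₁) ∩ signSet σ,
      ∀ y ∈ piece (n₂, l₂) ∩ signSet (-σ), -x - y ∉ piece (n₀, l₀)) :
    TriBound (piece (n₀, l₀)) (piece (n₁, l₁)) (piece (n₂, l₂))
      (2 ^ (((2 * n₀ + l₁ + l₂ + 17 : ℕ) : ℝ) / 2)) := by
  refine (TriBound.of_signs (C := 3 * ENNReal.ofReal (2 ^ (2 * n₀ + l₁ + l₂ + 9)) ^ (1 / 2 : ℝ))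
    (measurableSet_piece _) (measurableSet_piece _) ?_).mono
    le_rfl le_rfl le_rfl (four_mul_three_mul_le le_rfl)
  intro σ σ' hσ hσ'
  by_cases e : σ' = σ
  · subst e
    exact triBound_piece_same h hσ
  · have e' : σ' = -σ := by
      rcases hσ with rfl | rfl <;> rcases hσ' with rfl | rfl <;> simp_all
    subst e'
    exact (TriBound.of_empty (hopp σ hσ)).mono le_rfl le_rfl le_rfl zero_le

end Pieces

/-! ## Constraints on interacting dyadic pieces -/

section Interaction

variable {n₀ n₁ n₂ l₀ l₁ l₂ : ℕ} {x y : ℝ × Space}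

theorem le_of_two_pow_lt {a M k : ℕ} (h : (2:ℝ) ^ a < 2 ^ (M + k + 1)) : a ≤ M + k := by
  have := (pow_lt_pow_iff_right₀ (by norm_num : (1:ℝ) < 2)).1 h
  omega

theorem two_pow_succ_le {a M : ℕ} (h : a ≤ M) : (2:ℝ) ^ (a + 1) ≤ 2 * 2 ^ M := by
  rw [pow_succ, mul_comm]
  gcongr
  norm_num

theorem norm_snd_neg_sub_le (x y : ℝ × Space) :
    ‖(-x - y).2‖ ≤ ‖x.2‖ + ‖y.2‖ ∧ ‖x.2‖ ≤ ‖(-x - y).2‖ + ‖y.2‖ ∧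
      ‖y.2‖ ≤ ‖(-x - y).2‖ + ‖x.2‖ := by
  have e : (-x - y).2 = -(x.2 + y.2) := by simp [sub_eq_add_neg, add_comm]
  rw [e, norm_neg]
  refine ⟨norm_add_le _ _, ?_, ?_⟩
  · simpa using norm_sub_le (x.2 + y.2) y.2
  · simpa using norm_sub_le (x.2 + y.2) x.2

theorem frequency_comparable (hx : x ∈ piece (n₁, l₁)) (hy : y ∈ piece (n₂, l₂))
    (hz : -x - y ∈ piece (n₀, l₀)) (h₁ : n₀ ≤ n₁) (h₂ : n₀ ≤ n₂) : n₂ ≤ n₁ + 1 ∧ n₁ ≤ n₂ + 1 := by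
  obtain ⟨h0, hx2, hy2⟩ := norm_snd_neg_sub_le x y
  have hp : ∀ M : ℕ, (0:ℝ) < 2 ^ M := fun M => by positivity
  have x1 := hx.1.1; have x2 := hx.1.2; have y1 := hy.1.1; have y2 := hy.1.2
  have z2 := hz.1.2
  dsimp only at x1 x2 y1 y2 z2
  constructor
  · refine le_of_two_pow_lt (M := n₁) (k := 1) ?_
    have := two_pow_succ_le h₁
    have := two_pow_succ_le (le_refl n₁)
    rw [show n₁ + 1 + 1 = n₁ + 2 from rfl, pow_add]
    linarith
  · refine le_of_two_pow_lt (M := n₂) (k := 1) ?_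
    have := two_pow_succ_le h₂
    have := two_pow_succ_le (le_refl n₂)
    rw [show n₂ + 1 + 1 = n₂ + 2 from rfl, pow_add]
    linarith

theorem modulation_le (hx : x ∈ piece (n₁, l₁)) (hy : y ∈ piece (n₂, l₂))
    (hz : -x - y ∈ piece (n₀, l₀)) : l₂ ≤ max l₀ (max l₁ n₀) + 2 := by
  obtain ⟨h0, hx2, hy2⟩ := norm_snd_neg_sub_le x y
  have x2 := hx.2.2; have y1 := hy.2.1; have z2 := hz.2.2; have z2' := hz.1.2
  dsimp only at x2 y1 z2 z2'
  set M := max l₀ (max l₁ n₀)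
  refine le_of_two_pow_lt ?_
  have i0 := two_pow_succ_le (show l₀ ≤ M by omega)
  have i1 := two_pow_succ_le (show l₁ ≤ M by omega)
  have i2 := two_pow_succ_le (show n₀ ≤ M by omega)
  rw [show M + 2 + 1 = M + 3 from rfl, pow_add]
  have e : (-x - y).1 = -x.1 - y.1 := rfl
  have t1 : |y.1| ≤ |(-x - y).1| + |x.1| := by
    rw [e, abs_sub_comm]
    have := abs_sub (y.1 - -x.1) x.1
    simpa using this
  have t2 : |x.1| ≤ |(-x - y).1| + |y.1| := by
    have := abs_add_le (-x.1 - y.1) y.1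
    simpa [e] using this
  have u : |(|y.1| - ‖y.2‖)| ≤
      |(|(-x - y).1| - ‖(-x - y).2‖)| + |(|x.1| - ‖x.2‖)| + 2 * ‖(-x - y).2‖ := by
    have a1 := abs_le.1 (le_refl |(|(-x - y).1| - ‖(-x - y).2‖)|)
    have a2 := abs_le.1 (le_refl |(|x.1| - ‖x.2‖)|)
    rw [abs_le]
    constructor <;> linarith [a1.1, a1.2, a2.1, a2.2]
  linarith

theorem modulation_le_frequency (hx : x ∈ piece (n₁, l₁)) (hy : y ∈ piece (n₂, l₂))
    (hz : -x - y ∈ piece (n₀, l₀)) : l₀ ≤ max (max n₁ n₂) (max l₁ l₂) + 3 := by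
  obtain ⟨h0, hx2, hy2⟩ := norm_snd_neg_sub_le x y
  have x2 := hx.2.2; have y2 := hy.2.2; have z1 := hz.2.1; have x2' := hx.1.2; have y2' := hy.1.2
  dsimp only at x2 y2 z1 x2' y2'
  set M := max (max n₁ n₂) (max l₁ l₂)
  refine le_of_two_pow_lt ?_
  have i0 := two_pow_succ_le (show n₁ ≤ M by omega)
  have i1 := two_pow_succ_le (show n₂ ≤ M by omega)
  have i2 := two_pow_succ_le (show l₁ ≤ M by omega)
  have i3 := two_pow_succ_le (show l₂ ≤ M by omega)
  rw [show M + 3 + 1 = M + 4 from rfl, pow_add]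
  have t1 : |(-x - y).1| ≤ |x.1| + |y.1| := by
    have := abs_sub (-x.1) y.1
    simpa using this
  have hp : (0:ℝ) < 2 ^ M := by positivity
  have u : |(|(-x - y).1| - ‖(-x - y).2‖)| ≤
      2 * ‖x.2‖ + 2 * ‖y.2‖ + |(|y.1| - ‖y.2‖)| + |(|x.1| - ‖x.2‖)| := by
    have a1 := abs_le.1 (le_refl |(|y.1| - ‖y.2‖)|)
    have a2 := abs_le.1 (le_refl |(|x.1| - ‖x.2‖)|)
    rw [abs_le]
    constructor <;> linarith [a1.1, a1.2, a2.1, a2.2, abs_nonneg (-x - y).1,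
      norm_nonneg x.2, norm_nonneg y.2]
  linarith

theorem abs_opposite {a b σ : ℝ} (hσ : σ = 1 ∨ σ = -1) (ha : 0 ≤ σ * a) (hb : 0 ≤ -σ * b) :
    |-a - b| = |(|a| - |b|)| := by
  rcases hσ with rfl | rfl
  · rw [abs_of_nonneg (by linarith : 0 ≤ a), abs_of_nonpos (by linarith : b ≤ 0), ← abs_neg]
    ring_nf
  · rw [abs_of_nonpos (by linarith : a ≤ 0), abs_of_nonneg (by linarith : 0 ≤ b)]

theorem abs_same {a b σ : ℝ} (hσ : σ = 1 ∨ σ = -1) (ha : 0 ≤ σ * a) (hb : 0 ≤ σ * b) :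
    |-a - b| = |a| + |b| := by
  rcases hσ with rfl | rfl
  · rw [abs_of_nonneg (by linarith : 0 ≤ a), abs_of_nonneg (by linarith : 0 ≤ b),
      abs_of_nonpos (by linarith)]
    ring_nf
  · rw [abs_of_nonpos (by linarith : a ≤ 0), abs_of_nonpos (by linarith : b ≤ 0),
      abs_of_nonneg (by linarith)]
    ring_nf

theorem modulation_le_of_opposite {σ : ℝ} (hσ : σ = 1 ∨ σ = -1)
    (hx : x ∈ piece (n₁, l₁) ∩ signSet σ) (hy : y ∈ piece (n₂, l₂) ∩ signSet (-σ))
    (hz : -x - y ∈ piece (n₀, l₀)) : l₀ ≤ max l₁ (max l₂ n₀) + 2 := by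
  obtain ⟨h0, hx2, hy2⟩ := norm_snd_neg_sub_le x y
  obtain ⟨hx, hxs⟩ := hx
  obtain ⟨hy, hys⟩ := hy
  have t : |(-x - y).1| = |(|x.1| - |y.1|)| := abs_opposite hσ hxs hys
  have x2 := hx.2.2; have y2 := hy.2.2; have z1 := hz.2.1; have z2 := hz.1.2
  dsimp only at x2 y2 z1 z2
  set M := max l₁ (max l₂ n₀)
  refine le_of_two_pow_lt ?_
  have i0 := two_pow_succ_le (show l₁ ≤ M by omega)
  have i1 := two_pow_succ_le (show l₂ ≤ M by omega)
  have i2 := two_pow_succ_le (show n₀ ≤ M by omega)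
  rw [show M + 2 + 1 = M + 3 from rfl, pow_add]
  have hp : (0:ℝ) < 2 ^ M := by positivity
  have a1 := abs_le.1 (le_refl |(|y.1| - ‖y.2‖)|)
  have a2 := abs_le.1 (le_refl |(|x.1| - ‖x.2‖)|)
  have t' : |(-x - y).1| ≤ ‖(-x - y).2‖ + |(|y.1| - ‖y.2‖)| + |(|x.1| - ‖x.2‖)| := by
    rw [t, abs_le]
    constructor <;> linarith [a1.1, a1.2, a2.1, a2.2]
  have u : |(|(-x - y).1| - ‖(-x - y).2‖)| ≤
      ‖(-x - y).2‖ + |(|y.1| - ‖y.2‖)| + |(|x.1| - ‖x.2‖)| := by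
    rw [abs_le]
    constructor <;> linarith [abs_nonneg (-x - y).1, norm_nonneg (-x - y).2,
      abs_nonneg (|y.1| - ‖y.2‖), abs_nonneg (|x.1| - ‖x.2‖)]
  linarith

theorem frequency_le_of_same {σ : ℝ} (hσ : σ = 1 ∨ σ = -1)
    (hx : x ∈ piece (n₁, l₁) ∩ signSet σ) (hy : y ∈ piece (n₂, l₂) ∩ signSet σ)
    (hz : -x - y ∈ piece (n₀, l₀)) : n₁ ≤ max (max l₀ n₀) (max l₁ l₂) + 2 := by
  obtain ⟨hx, hxs⟩ := hx
  obtain ⟨hy, hys⟩ := hy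
  have t : |(-x - y).1| = |x.1| + |y.1| := abs_same hσ hxs hys
  have x2 := hx.2.2; have y2 := hy.2.2; have z1 := hz.2.2; have z2 := hz.1.2; have x1 := hx.1.1
  dsimp only at x2 y2 z1 z2 x1
  set M := max (max l₀ n₀) (max l₁ l₂)
  refine le_of_two_pow_lt ?_
  have i0 := two_pow_succ_le (show l₁ ≤ M by omega)
  have i1 := two_pow_succ_le (show l₂ ≤ M by omega)
  have i2 := two_pow_succ_le (show n₀ ≤ M by omega)
  have i3 := two_pow_succ_le (show l₀ ≤ M by omega)
  rw [show M + 2 + 1 = M + 3 from rfl, pow_add]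
  have a1 := abs_le.1 (le_refl |(|y.1| - ‖y.2‖)|)
  have a2 := abs_le.1 (le_refl |(|x.1| - ‖x.2‖)|)
  have a3 := abs_le.1 (le_refl |(|(-x - y).1| - ‖(-x - y).2‖)|)
  linarith [a1.1, a2.1, a3.2, norm_nonneg y.2]

end Interaction

/-! ## Exponents -/

section Exponents

/-- The exponent conditions of the product estimate, with all minima and maxima expanded. -/
structure Admissible (s₀ s₁ s₂ b₀ b₁ b₂ : ℝ) : Prop where
  b_sum : 1 / 2 < b₀ + b₁ + b₂
  b₀₁ : 0 ≤ b₀ + b₁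
  b₀₂ : 0 ≤ b₀ + b₂
  b₁₂ : 0 ≤ b₁ + b₂
  sb_sum : 2 < s₀ + s₁ + s₂ + (b₀ + b₁ + b₂)
  s_b₀₁ : 3 / 2 < s₀ + s₁ + s₂ + (b₀ + b₁)
  s_b₀₂ : 3 / 2 < s₀ + s₁ + s₂ + (b₀ + b₂)
  s_b₁₂ : 3 / 2 < s₀ + s₁ + s₂ + (b₁ + b₂)
  s_b₀ : 1 < s₀ + s₁ + s₂ + b₀
  s_b₁ : 1 < s₀ + s₁ + s₂ + b₁
  s_b₂ : 1 < s₀ + s₁ + s₂ + b₂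
  s_sum : 1 < s₀ + s₁ + s₂
  s_double₀ : 3 / 2 < s₀ + b₀ + 2 * (s₁ + s₂)
  s_double₁ : 3 / 2 < s₁ + b₁ + 2 * (s₀ + s₂)
  s_double₂ : 3 / 2 < s₂ + b₂ + 2 * (s₀ + s₁)
  s₁₂ : 0 ≤ s₁ + s₂
  s₀₂ : 0 ≤ s₀ + s₂
  s₀₁ : 0 ≤ s₀ + s₁
  s₁₂_b₀ : 0 ≤ s₁ + s₂ + b₀
  s₀₂_b₁ : 0 ≤ s₀ + s₂ + b₁
  s₀₁_b₂ : 0 ≤ s₀ + s₁ + b₂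

theorem Admissible.swap_right {s₀ s₁ s₂ b₀ b₁ b₂ : ℝ} (h : Admissible s₀ s₁ s₂ b₀ b₁ b₂) :
    Admissible s₀ s₂ s₁ b₀ b₂ b₁ := by
  obtain ⟨⟩ := h
  constructor <;> linarith

theorem Admissible.swap_left {s₀ s₁ s₂ b₀ b₁ b₂ : ℝ} (h : Admissible s₀ s₁ s₂ b₀ b₁ b₂) :
    Admissible s₁ s₀ s₂ b₁ b₀ b₂ := by
  obtain ⟨⟩ := h
  constructor <;> linarith

/-- A quantitative form of the strict inequalities in `Admissible`. -/
structure Margins (s₀ s₁ s₂ b₀ b₁ b₂ ε K : ℝ) : Prop where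
  pos : 0 < ε
  b_sum : 4 * ε ≤ b₀ + b₁ + b₂ - 1 / 2
  sb_sum : 4 * ε ≤ s₀ + s₁ + s₂ + (b₀ + b₁ + b₂) - 2
  s_b₀₁ : 4 * ε ≤ s₀ + s₁ + s₂ + (b₀ + b₁) - 3 / 2
  s_b₀₂ : 4 * ε ≤ s₀ + s₁ + s₂ + (b₀ + b₂) - 3 / 2
  s_b₁₂ : 4 * ε ≤ s₀ + s₁ + s₂ + (b₁ + b₂) - 3 / 2
  s_b₀ : 4 * ε ≤ s₀ + s₁ + s₂ + b₀ - 1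
  s_b₁ : 4 * ε ≤ s₀ + s₁ + s₂ + b₁ - 1
  s_b₂ : 4 * ε ≤ s₀ + s₁ + s₂ + b₂ - 1
  s_sum : 4 * ε ≤ s₀ + s₁ + s₂ - 1
  s_double₀ : 4 * ε ≤ s₀ + b₀ + 2 * (s₁ + s₂) - 3 / 2
  large : 100 * (1 + ε + |s₀| + |s₁| + |s₂| + |b₀| + |b₁| + |b₂|) ≤ K

theorem exists_pos_forall_le (l : List ℝ) (h : ∀ x ∈ l, 0 < x) :
    ∃ ε > 0, ∀ x ∈ l, 4 * ε ≤ x := by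
  induction l with
  | nil => exact ⟨1, one_pos, by simp⟩
  | cons a l ih =>
    obtain ⟨ε, hε, hl⟩ := ih fun x hx => h x (List.mem_cons_of_mem _ hx)
    have ha := h a List.mem_cons_self
    refine ⟨min ε (a / 4), lt_min hε (by positivity), fun x hx => ?_⟩
    have h1 := min_le_left ε (a / 4)
    have h2 := min_le_right ε (a / 4)
    rcases List.mem_cons.1 hx with rfl | hx
    · linarith
    · linarith [hl x hx]

variable {s₀ s₁ s₂ b₀ b₁ b₂ ε K : ℝ}

theorem Admissible.exists_margins (h : Admissible s₀ s₁ s₂ b₀ b₁ b₂) :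
    ∃ ε K, Margins s₀ s₁ s₂ b₀ b₁ b₂ ε K ∧
      (0 < s₁ + s₂ + b₀ → 4 * ε ≤ s₁ + s₂ + b₀) ∧
      (0 < s₁ + s₂ + b₀ + b₂ → 4 * ε ≤ s₁ + s₂ + b₀ + b₂) := by
  obtain ⟨ε, hε, hl⟩ := exists_pos_forall_le
    [b₀ + b₁ + b₂ - 1 / 2, s₀ + s₁ + s₂ + (b₀ + b₁ + b₂) - 2, s₀ + s₁ + s₂ + (b₀ + b₁) - 3 / 2,
     s₀ + s₁ + s₂ + (b₀ + b₂) - 3 / 2, s₀ + s₁ + s₂ + (b₁ + b₂) - 3 / 2, s₀ + s₁ + s₂ + b₀ - 1,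
     s₀ + s₁ + s₂ + b₁ - 1, s₀ + s₁ + s₂ + b₂ - 1, s₀ + s₁ + s₂ - 1,
     s₀ + b₀ + 2 * (s₁ + s₂) - 3 / 2,
     if 0 < s₁ + s₂ + b₀ then s₁ + s₂ + b₀ else 1,
     if 0 < s₁ + s₂ + b₀ + b₂ then s₁ + s₂ + b₀ + b₂ else 1] (by
    obtain ⟨⟩ := h
    simp only [List.forall_mem_cons, List.not_mem_nil, false_imp_iff, implies_true, and_true]
    refine ⟨?_, ?_, ?_, ?_, ?_, ?_, ?_, ?_, ?_, ?_, ?_, ?_⟩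
    on_goal 11 => split_ifs <;> linarith
    on_goal 11 => split_ifs <;> linarith
    all_goals linarith)
  simp only [List.forall_mem_cons, List.not_mem_nil, false_imp_iff, implies_true, and_true] at hl
  obtain ⟨h1, h2, h3, h4, h5, h6, h7, h8, h9, h10, h11, h12⟩ := hl
  refine ⟨ε, _, ⟨hε, h1, h2, h3, h4, h5, h6, h7, h8, h9, h10, le_rfl⟩, fun hp => ?_, fun hp => ?_⟩
  · rwa [if_pos hp] at h11
  · rwa [if_pos hp] at h12

variable {n₀ n₁ n₂ l₀ l₁ l₂ : ℝ}

theorem frequency_weight_le (h : |n₁ - n₂| ≤ 1) :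
    - s₁ * n₁ - s₂ * n₂ ≤ - (s₁ + s₂) * n₁ + |s₂| := by
  have : s₂ * (n₁ - n₂) ≤ |s₂| * 1 :=
    (le_abs_self _).trans ((abs_mul _ _).trans_le (by gcongr))
  linarith

/-- Collects the elementary bounds on the parameters by their absolute values. -/
theorem abs_bounds (a : ℝ) : a ≤ |a| ∧ -a ≤ |a| := ⟨le_abs_self a, neg_le_abs a⟩

theorem exponent_comparable₁_transfer (A : Admissible s₀ s₁ s₂ b₀ b₁ b₂)
    (M : Margins s₀ s₁ s₂ b₀ b₁ b₂ ε K) (hl₀ : 0 ≤ l₀) (hn : n₀ ≤ n₁) (h₁₂ : |n₁ - n₂| ≤ 1)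
    (hl : l₁ ≤ l₂) (hl' : l₂ ≤ l₁ + 2) (h : l₀ ≤ l₁) (h' : l₁ ≤ n₀) :
    (2 * n₀ + l₀ + l₁ + 1 + 13) / 2 - s₀ * n₀ - s₁ * n₁ - s₂ * n₂ - b₀ * l₀ - b₁ * l₁ - b₂ * l₂
      ≤ K - ε * (|n₁ - n₂| + |l₁ - l₂| + n₀ + l₀) := by
  obtain ⟨⟩ := A
  obtain ⟨hε, -, m2, -, -, m5, -, -, -, m9, -, hK⟩ := M
  have w := frequency_weight_le (s₁ := s₁) (s₂ := s₂) h₁₂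
  have hd : |l₁ - l₂| ≤ 2 := abs_le.2 ⟨by linarith, by linarith⟩
  have hb : b₂ * (l₁ - l₂) ≤ |b₂| * 2 :=
    (le_abs_self _).trans ((abs_mul _ _).trans_le (by gcongr))
  have p1 := mul_nonneg (sub_nonneg.2 m9) (sub_nonneg.2 h')
  have p2 := mul_nonneg (sub_nonneg.2 m5) (sub_nonneg.2 h)
  have p3 := mul_nonneg (sub_nonneg.2 m2) hl₀
  have p4 := mul_nonneg ‹0 ≤ s₁ + s₂› (sub_nonneg.2 hn)
  have p5 : 0 ≤ ε * (3 + 4 * n₀ - (|n₁ - n₂| + |l₁ - l₂| + n₀ + l₀)) :=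
    mul_nonneg hε.le (by linarith)
  linarith [abs_nonneg s₀, abs_nonneg s₁, abs_nonneg s₂, abs_nonneg b₀, abs_nonneg b₁,
    abs_nonneg b₂]

theorem exponent_comparable₁_low (A : Admissible s₀ s₁ s₂ b₀ b₁ b₂)
    (M : Margins s₀ s₁ s₂ b₀ b₁ b₂ ε K) (hn₀ : 0 ≤ n₀) (hl₀ : 0 ≤ l₀) (hn : n₀ ≤ n₁)
    (h₁₂ : |n₁ - n₂| ≤ 1) (hl : l₁ ≤ l₂) (hl' : l₂ ≤ l₁ + 2) (h : l₀ ≤ l₁) (h' : n₀ ≤ l₁) :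
    (3 * n₀ + l₀ + 9) / 2 - s₀ * n₀ - s₁ * n₁ - s₂ * n₂ - b₀ * l₀ - b₁ * l₁ - b₂ * l₂
      ≤ K - ε * (|n₁ - n₂| + |l₁ - l₂| + n₀ + l₀) := by
  obtain ⟨⟩ := A
  obtain ⟨hε, m1, m2, -, -, m5, -, -, -, m9, -, hK⟩ := M
  have w := frequency_weight_le (s₁ := s₁) (s₂ := s₂) h₁₂
  have hd : |l₁ - l₂| ≤ 2 := abs_le.2 ⟨by linarith, by linarith⟩
  have hb : b₂ * (l₁ - l₂) ≤ |b₂| * 2 :=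
    (le_abs_self _).trans ((abs_mul _ _).trans_le (by gcongr))
  have p4 := mul_nonneg ‹0 ≤ s₁ + s₂› (sub_nonneg.2 hn)
  rcases le_total l₀ n₀ with h3 | h3
  · have p1 := mul_nonneg ‹0 ≤ b₁ + b₂› (sub_nonneg.2 h')
    have p2 := mul_nonneg (sub_nonneg.2 m5) (sub_nonneg.2 h3)
    have p3 := mul_nonneg (sub_nonneg.2 m2) hl₀
    have p5 : 0 ≤ ε * (3 + 4 * n₀ - (|n₁ - n₂| + |l₁ - l₂| + n₀ + l₀)) :=
      mul_nonneg hε.le (by linarith)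
    linarith [abs_nonneg s₀, abs_nonneg s₁, abs_nonneg s₂, abs_nonneg b₀, abs_nonneg b₁,
      abs_nonneg b₂]
  · have p1 := mul_nonneg ‹0 ≤ b₁ + b₂› (sub_nonneg.2 h)
    have p2 := mul_nonneg (sub_nonneg.2 m1) (sub_nonneg.2 h3)
    have p3 := mul_nonneg (sub_nonneg.2 m2) hn₀
    have p5 : 0 ≤ ε * (3 + 4 * l₀ - (|n₁ - n₂| + |l₁ - l₂| + n₀ + l₀)) :=
      mul_nonneg hε.le (by linarith)
    linarith [abs_nonneg s₀, abs_nonneg s₁, abs_nonneg s₂, abs_nonneg b₀, abs_nonneg b₁,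
      abs_nonneg b₂]

end Exponents

section Exponents

variable {s₀ s₁ s₂ b₀ b₁ b₂ ε K n₀ n₁ n₂ l₀ l₁ l₂ : ℝ}

theorem mul_sub_le_of_abs_sub_le {a b c C : ℝ} (h : |b - c| ≤ C) : a * (b - c) ≤ |a| * C :=
  (le_abs_self _).trans ((abs_mul _ _).trans_le (by gcongr))

theorem exponent_comparable₀_transfer (A : Admissible s₀ s₁ s₂ b₀ b₁ b₂)
    (M : Margins s₀ s₁ s₂ b₀ b₁ b₂ ε K) (hl₁ : 0 ≤ l₁) (hn : n₀ ≤ n₁) (h₁₂ : |n₁ - n₂| ≤ 1)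
    (hl : |l₀ - l₂| ≤ 4) (h : l₁ ≤ l₀) (h' : l₀ ≤ n₀) :
    (2 * n₀ + l₀ + l₁ + 1 + 13) / 2 - s₀ * n₀ - s₁ * n₁ - s₂ * n₂ - b₀ * l₀ - b₁ * l₁ - b₂ * l₂
      ≤ K - ε * (|n₁ - n₂| + |l₀ - l₂| + n₀ + l₁) := by
  obtain ⟨⟩ := A
  obtain ⟨hε, -, m2, -, m4, -, -, -, -, m9, -, hK⟩ := M
  have w := frequency_weight_le (s₁ := s₁) (s₂ := s₂) h₁₂
  have hb := mul_sub_le_of_abs_sub_le (a := b₂) hl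
  have p1 := mul_nonneg (sub_nonneg.2 m9) (sub_nonneg.2 h')
  have p2 := mul_nonneg (sub_nonneg.2 m4) (sub_nonneg.2 h)
  have p3 := mul_nonneg (sub_nonneg.2 m2) hl₁
  have p4 := mul_nonneg ‹0 ≤ s₁ + s₂› (sub_nonneg.2 hn)
  have p5 : 0 ≤ ε * (5 + 4 * n₀ - (|n₁ - n₂| + |l₀ - l₂| + n₀ + l₁)) :=
    mul_nonneg hε.le (by linarith)
  linarith [abs_nonneg s₀, abs_nonneg s₁, abs_nonneg s₂, abs_nonneg b₀, abs_nonneg b₁,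
    abs_nonneg b₂]

theorem exponent_comparable₀_low (A : Admissible s₀ s₁ s₂ b₀ b₁ b₂)
    (M : Margins s₀ s₁ s₂ b₀ b₁ b₂ ε K) (hn₀ : 0 ≤ n₀) (hl₁ : 0 ≤ l₁) (hn : n₀ ≤ n₁)
    (h₁₂ : |n₁ - n₂| ≤ 1) (hl : |l₀ - l₂| ≤ 4) (h : l₁ ≤ l₀) (h' : n₀ ≤ l₀) :
    (3 * n₀ + l₁ + 9) / 2 - s₀ * n₀ - s₁ * n₁ - s₂ * n₂ - b₀ * l₀ - b₁ * l₁ - b₂ * l₂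
      ≤ K - ε * (|n₁ - n₂| + |l₀ - l₂| + n₀ + l₁) := by
  obtain ⟨⟩ := A
  obtain ⟨hε, m1, m2, -, m4, -, -, -, -, -, -, hK⟩ := M
  have w := frequency_weight_le (s₁ := s₁) (s₂ := s₂) h₁₂
  have hb := mul_sub_le_of_abs_sub_le (a := b₂) hl
  have p4 := mul_nonneg ‹0 ≤ s₁ + s₂› (sub_nonneg.2 hn)
  rcases le_total l₁ n₀ with h3 | h3
  · have p1 := mul_nonneg ‹0 ≤ b₀ + b₂› (sub_nonneg.2 h')
    have p2 := mul_nonneg (sub_nonneg.2 m4) (sub_nonneg.2 h3)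
    have p3 := mul_nonneg (sub_nonneg.2 m2) hl₁
    have p5 : 0 ≤ ε * (5 + 4 * n₀ - (|n₁ - n₂| + |l₀ - l₂| + n₀ + l₁)) :=
      mul_nonneg hε.le (by linarith)
    linarith [abs_nonneg s₀, abs_nonneg s₁, abs_nonneg s₂, abs_nonneg b₀, abs_nonneg b₁,
      abs_nonneg b₂]
  · have p1 := mul_nonneg ‹0 ≤ b₀ + b₂› (sub_nonneg.2 h)
    have p2 := mul_nonneg (sub_nonneg.2 m1) (sub_nonneg.2 h3)
    have p3 := mul_nonneg (sub_nonneg.2 m2) hn₀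
    have p5 : 0 ≤ ε * (5 + 4 * l₁ - (|n₁ - n₂| + |l₀ - l₂| + n₀ + l₁)) :=
      mul_nonneg hε.le (by linarith)
    linarith [abs_nonneg s₀, abs_nonneg s₁, abs_nonneg s₂, abs_nonneg b₀, abs_nonneg b₁,
      abs_nonneg b₂]

theorem exponent_dominant₂ (A : Admissible s₀ s₁ s₂ b₀ b₁ b₂)
    (M : Margins s₀ s₁ s₂ b₀ b₁ b₂ ε K) (hl₀ : 0 ≤ l₀) (hl₁ : 0 ≤ l₁) (hn : n₀ ≤ n₁)
    (h₁₂ : |n₁ - n₂| ≤ 1) (h₀ : l₀ ≤ l₂) (h₁ : l₁ ≤ l₂) (h' : l₂ ≤ n₀ + 2) :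
    (2 * n₀ + l₀ + l₁ + 1 + 13) / 2 - s₀ * n₀ - s₁ * n₁ - s₂ * n₂ - b₀ * l₀ - b₁ * l₁ - b₂ * l₂
      ≤ K - ε * (|n₁ - n₂| + n₀ + l₀ + l₁ + l₂) := by
  obtain ⟨⟩ := A
  obtain ⟨hε, -, m2, -, m4, m5, -, -, m8, m9, -, hK⟩ := M
  have w := frequency_weight_le (s₁ := s₁) (s₂ := s₂) h₁₂
  have p1 := mul_nonneg (sub_nonneg.2 m9) (sub_nonneg.2 h')
  have p4 := mul_nonneg ‹0 ≤ s₁ + s₂› (sub_nonneg.2 hn)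
  have p5 : 0 ≤ ε * (9 + 4 * n₀ - (|n₁ - n₂| + n₀ + l₀ + l₁ + l₂)) :=
    mul_nonneg hε.le (by linarith)
  obtain ⟨c0, -⟩ := abs_bounds s₀
  obtain ⟨c1, -⟩ := abs_bounds s₁
  obtain ⟨c2, -⟩ := abs_bounds s₂
  rcases le_total l₀ l₁ with h3 | h3
  · have p2 := mul_nonneg (sub_nonneg.2 m8) (sub_nonneg.2 h₁)
    have p3 := mul_nonneg (sub_nonneg.2 m5) (sub_nonneg.2 h3)
    have p6 := mul_nonneg (sub_nonneg.2 m2) hl₀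
    linarith [abs_nonneg s₀, abs_nonneg s₁, abs_nonneg s₂, abs_nonneg b₀, abs_nonneg b₁,
      abs_nonneg b₂]
  · have p2 := mul_nonneg (sub_nonneg.2 m8) (sub_nonneg.2 h₀)
    have p3 := mul_nonneg (sub_nonneg.2 m4) (sub_nonneg.2 h3)
    have p6 := mul_nonneg (sub_nonneg.2 m2) hl₁
    linarith [abs_nonneg s₀, abs_nonneg s₁, abs_nonneg s₂, abs_nonneg b₀, abs_nonneg b₁,
      abs_nonneg b₂]

theorem exponent_dominant₀_transfer (A : Admissible s₀ s₁ s₂ b₀ b₁ b₂)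
    (M : Margins s₀ s₁ s₂ b₀ b₁ b₂ ε K) (hl₁ : 0 ≤ l₁)
    (h₁₂ : |n₁ - n₂| ≤ 1) (h₁ : l₁ ≤ l₂) (h₂ : l₂ ≤ l₀) (h' : l₀ ≤ n₀ + 8)
    (h : n₀ + l₀ - l₂ ≤ n₁) :
    (2 * n₀ + l₀ + l₁ + 1 + 13) / 2 - s₀ * n₀ - s₁ * n₁ - s₂ * n₂ - b₀ * l₀ - b₁ * l₁ - b₂ * l₂
      ≤ K - ε * (|n₁ - n₂| + n₀ + l₀ + l₁ + l₂) := by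
  obtain ⟨⟩ := A
  obtain ⟨hε, -, m2, -, m4, -, -, -, -, m9, m10, hK⟩ := M
  have w := frequency_weight_le (s₁ := s₁) (s₂ := s₂) h₁₂
  have p1 := mul_nonneg (sub_nonneg.2 m9) (sub_nonneg.2 h')
  have p2 := mul_nonneg (sub_nonneg.2 m10) (sub_nonneg.2 h₂)
  have p3 := mul_nonneg (sub_nonneg.2 m4) (sub_nonneg.2 h₁)
  have p4 := mul_nonneg (sub_nonneg.2 m2) hl₁
  have p5 := mul_nonneg ‹0 ≤ s₁ + s₂› (sub_nonneg.2 h)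
  have p6 : 0 ≤ ε * (25 + 4 * n₀ - (|n₁ - n₂| + n₀ + l₀ + l₁ + l₂)) :=
    mul_nonneg hε.le (by linarith)
  obtain ⟨c0, -⟩ := abs_bounds s₀
  obtain ⟨c1, -⟩ := abs_bounds s₁
  obtain ⟨c2, -⟩ := abs_bounds s₂
  linarith [abs_nonneg s₀, abs_nonneg s₁, abs_nonneg s₂, abs_nonneg b₀, abs_nonneg b₁,
    abs_nonneg b₂]

theorem exponent_dominant₀_bilinear (A : Admissible s₀ s₁ s₂ b₀ b₁ b₂)
    (M : Margins s₀ s₁ s₂ b₀ b₁ b₂ ε K) (hl₁ : 0 ≤ l₁) (hn : n₀ ≤ n₁)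
    (h₁₂ : |n₁ - n₂| ≤ 1) (h₁ : l₁ ≤ l₂) (h₂ : l₂ ≤ l₀) (h' : l₀ ≤ n₀ + 8)
    (h : n₁ ≤ n₀ + l₀ - l₂) :
    (n₀ + n₁ + l₁ + l₂ + 24) / 2 - s₀ * n₀ - s₁ * n₁ - s₂ * n₂ - b₀ * l₀ - b₁ * l₁ - b₂ * l₂
      ≤ K - ε * (|n₁ - n₂| + n₀ + l₀ + l₁ + l₂) := by
  obtain ⟨⟩ := A
  obtain ⟨hε, -, m2, -, m4, -, m6, -, -, m9, m10, hK⟩ := M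
  have w := frequency_weight_le (s₁ := s₁) (s₂ := s₂) h₁₂
  have p1 := mul_nonneg (sub_nonneg.2 m9) (sub_nonneg.2 h')
  have p2 := mul_nonneg (sub_nonneg.2 m10) (sub_nonneg.2 hn)
  have p3 := mul_nonneg (sub_nonneg.2 m4) (sub_nonneg.2 h₁)
  have p4 := mul_nonneg (sub_nonneg.2 m2) hl₁
  have p5 := mul_nonneg (sub_nonneg.2 m6) (sub_nonneg.2 h)
  have p6 : 0 ≤ ε * (25 + 4 * n₀ - (|n₁ - n₂| + n₀ + l₀ + l₁ + l₂)) :=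
    mul_nonneg hε.le (by linarith)
  obtain ⟨c0, -⟩ := abs_bounds s₀
  obtain ⟨c1, -⟩ := abs_bounds s₁
  obtain ⟨c2, -⟩ := abs_bounds s₂
  linarith [abs_nonneg s₀, abs_nonneg s₁, abs_nonneg s₂, abs_nonneg b₀, abs_nonneg b₁,
    abs_nonneg b₂]

theorem exponent_separated_same (A : Admissible s₀ s₁ s₂ b₀ b₁ b₂)
    (M : Margins s₀ s₁ s₂ b₀ b₁ b₂ ε K) (hl₁ : 0 ≤ l₁)
    (h₁₂ : |n₁ - n₂| ≤ 1) (h₁ : l₁ ≤ l₂) (h₂ : l₂ ≤ n₀) (h' : n₀ ≤ l₀)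
    (h : |l₀ - n₁| ≤ 4) :
    (2 * n₀ + l₁ + l₂ + 17) / 2 - s₀ * n₀ - s₁ * n₁ - s₂ * n₂ - b₀ * l₀ - b₁ * l₁ - b₂ * l₂
      ≤ K - ε * (|n₁ - n₂| + |l₀ - n₁| + n₀ + l₁ + l₂) := by
  obtain ⟨⟩ := A
  obtain ⟨hε, -, m2, -, m4, -, m6, -, -, m9, m10, hK⟩ := M
  have w := frequency_weight_le (s₁ := s₁) (s₂ := s₂) h₁₂
  have w' := mul_sub_le_of_abs_sub_le (a := s₁ + s₂) h
  have t := abs_add_le s₁ s₂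
  have p1 := mul_nonneg ‹0 ≤ s₁ + s₂ + b₀› (sub_nonneg.2 h')
  have p2 := mul_nonneg (sub_nonneg.2 m6) (sub_nonneg.2 h₂)
  have p3 := mul_nonneg (sub_nonneg.2 m4) (sub_nonneg.2 h₁)
  have p4 := mul_nonneg (sub_nonneg.2 m2) hl₁
  have p6 : 0 ≤ ε * (5 + 4 * n₀ - (|n₁ - n₂| + |l₀ - n₁| + n₀ + l₁ + l₂)) :=
    mul_nonneg hε.le (by linarith)
  linarith [abs_nonneg s₀, abs_nonneg s₁, abs_nonneg s₂, abs_nonneg b₀, abs_nonneg b₁,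
    abs_nonneg b₂]

theorem exponent_separated_low (A : Admissible s₀ s₁ s₂ b₀ b₁ b₂)
    (M : Margins s₀ s₁ s₂ b₀ b₁ b₂ ε K) (hn₀ : 0 ≤ n₀) (hl₁ : 0 ≤ l₁)
    (h₁₂ : |n₁ - n₂| ≤ 1) (h₁ : l₁ ≤ l₂) (h₂ : n₀ ≤ l₂) (h' : l₂ ≤ n₁)
    (h : |l₀ - n₁| ≤ 4) (hp : 4 * ε ≤ s₁ + s₂ + b₀ + b₂) :
    (3 * n₀ + l₁ + 9) / 2 - s₀ * n₀ - s₁ * n₁ - s₂ * n₂ - b₀ * l₀ - b₁ * l₁ - b₂ * l₂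
      ≤ K - ε * (|n₁ - n₂| + |l₀ - n₁| + n₀ + l₁ + l₂) := by
  obtain ⟨⟩ := A
  obtain ⟨hε, m1, m2, -, m4, -, -, -, -, -, -, hK⟩ := M
  have w := frequency_weight_le (s₁ := s₁) (s₂ := s₂) h₁₂
  have w' := mul_sub_le_of_abs_sub_le (a := -b₀) h
  rw [abs_neg] at w'
  have p1 := mul_nonneg ‹0 ≤ s₁ + s₂ + b₀› (sub_nonneg.2 h')
  have p5 : 0 ≤ ε * (5 + 4 * l₂ - (|n₁ - n₂| + |l₀ - n₁| + n₀ + l₁ + l₂)) :=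
    mul_nonneg hε.le (by linarith)
  rcases le_total l₁ n₀ with h3 | h3
  · have p2 := mul_nonneg (sub_nonneg.2 hp) (sub_nonneg.2 h₂)
    have p3 := mul_nonneg (sub_nonneg.2 m4) (sub_nonneg.2 h3)
    have p4 := mul_nonneg (sub_nonneg.2 m2) hl₁
    linarith [abs_nonneg s₀, abs_nonneg s₁, abs_nonneg s₂, abs_nonneg b₀, abs_nonneg b₁,
      abs_nonneg b₂]
  · have p2 := mul_nonneg (sub_nonneg.2 hp) (sub_nonneg.2 h₁)
    have p3 := mul_nonneg (sub_nonneg.2 m1) (sub_nonneg.2 h3)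
    have p4 := mul_nonneg (sub_nonneg.2 m2) hn₀
    have p6 := mul_nonneg ‹0 ≤ s₁ + s₂› (sub_nonneg.2 h3)
    linarith [abs_nonneg s₀, abs_nonneg s₁, abs_nonneg s₂, abs_nonneg b₀, abs_nonneg b₁,
      abs_nonneg b₂]

theorem exponent_separated_low' (A : Admissible s₀ s₁ s₂ b₀ b₁ b₂)
    (M : Margins s₀ s₁ s₂ b₀ b₁ b₂ ε K) (hn₀ : 0 ≤ n₀) (hl₁ : 0 ≤ l₁)
    (h₁₂ : |n₁ - n₂| ≤ 1) (h₁ : l₁ ≤ l₂) (h₂ : n₀ ≤ l₂) (h' : l₂ ≤ n₁)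
    (h : |l₀ - n₁| ≤ 4) (hp : 4 * ε ≤ s₁ + s₂ + b₀) :
    (3 * n₀ + l₁ + 9) / 2 - s₀ * n₀ - s₁ * n₁ - s₂ * n₂ - b₀ * l₀ - b₁ * l₁ - b₂ * l₂
      ≤ K - ε * (|n₁ - n₂| + |l₀ - n₁| + |n₁ - l₂| + n₀ + l₁) := by
  obtain ⟨⟩ := A
  obtain ⟨hε, m1, m2, -, m4, -, -, -, -, -, m10, hK⟩ := M
  have w := frequency_weight_le (s₁ := s₁) (s₂ := s₂) h₁₂
  have w' := mul_sub_le_of_abs_sub_le (a := -b₀) h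
  rw [abs_neg] at w'
  have p1 := mul_nonneg (sub_nonneg.2 hp) (sub_nonneg.2 h')
  have hp' : 0 ≤ s₁ + s₂ + b₀ + b₂ := by linarith
  rw [abs_of_nonneg (sub_nonneg.2 h')]
  rcases le_total l₁ n₀ with h3 | h3
  · have p2 := mul_nonneg hp' (sub_nonneg.2 h₂)
    have p3 := mul_nonneg (sub_nonneg.2 m4) (sub_nonneg.2 h3)
    have p4 := mul_nonneg (sub_nonneg.2 m2) hl₁
    have p5 : 0 ≤ ε * (5 + 4 * (n₁ - l₂ + n₀) - (|n₁ - n₂| + |l₀ - n₁| + (n₁ - l₂) + n₀ + l₁)) :=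
      mul_nonneg hε.le (by linarith)
    linarith [abs_nonneg s₀, abs_nonneg s₁, abs_nonneg s₂, abs_nonneg b₀, abs_nonneg b₁,
      abs_nonneg b₂]
  · have p2 := mul_nonneg hp' (sub_nonneg.2 h₁)
    have p3 := mul_nonneg (sub_nonneg.2 m1) (sub_nonneg.2 h3)
    have p4 := mul_nonneg (sub_nonneg.2 m2) hn₀
    have p6 := mul_nonneg ‹0 ≤ s₁ + s₂› (sub_nonneg.2 h3)
    have p5 : 0 ≤ ε * (5 + 4 * (n₁ - l₂ + l₁) - (|n₁ - n₂| + |l₀ - n₁| + (n₁ - l₂) + n₀ + l₁)) :=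
      mul_nonneg hε.le (by linarith)
    linarith [abs_nonneg s₀, abs_nonneg s₁, abs_nonneg s₂, abs_nonneg b₀, abs_nonneg b₁,
      abs_nonneg b₂]

end Exponents

section PieceBound

/-- The five patterns of decay of the weighted constants of the piecewise trilinear estimates. -/
def Decay (K ε n₀ n₁ n₂ l₀ l₁ l₂ e : ℝ) : Prop :=
  e ≤ K - ε * (|n₁ - n₂| + n₀ + l₀ + l₁ + l₂) ∨
  e ≤ K - ε * (|n₁ - n₂| + |l₁ - l₂| + n₀ + l₀) ∨
  e ≤ K - ε * (|n₁ - n₂| + |l₀ - l₂| + n₀ + l₁) ∨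
  e ≤ K - ε * (|n₁ - n₂| + |l₀ - n₁| + n₀ + l₁ + l₂) ∨
  e ≤ K - ε * (|n₁ - n₂| + |l₀ - n₁| + |n₁ - l₂| + n₀ + l₁)

theorem natCast_abs_sub_le {a b c : ℕ} (h : a ≤ b + c) (h' : b ≤ a + c) : |(a:ℝ) - b| ≤ c := by
  have h1 : (a:ℝ) ≤ b + c := by exact_mod_cast h
  have h2 : (b:ℝ) ≤ a + c := by exact_mod_cast h'
  rw [abs_le]; constructor <;> linarith

theorem triBound_piece {s₀ s₁ s₂ b₀ b₁ b₂ ε K : ℝ} (A : Admissible s₀ s₁ s₂ b₀ b₁ b₂)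
    (M : Margins s₀ s₁ s₂ b₀ b₁ b₂ ε K) (hp : 4 * ε ≤ s₁ + s₂ + b₀ ∨ 4 * ε ≤ s₁ + s₂ + b₀ + b₂)
    {n₀ n₁ n₂ l₀ l₁ l₂ : ℕ} (h₀₁ : n₀ ≤ n₁) (h₀₂ : n₀ ≤ n₂) (hl : l₁ ≤ l₂) :
    ∃ e : ℝ, TriBound (piece (n₀, l₀)) (piece (n₁, l₁)) (piece (n₂, l₂)) (2 ^ e) ∧
      Decay K ε n₀ n₁ n₂ l₀ l₁ l₂
        (e - s₀ * n₀ - s₁ * n₁ - s₂ * n₂ - b₀ * l₀ - b₁ * l₁ - b₂ * l₂) := by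
  by_cases hne : ∃ x ∈ piece (n₁, l₁), ∃ y ∈ piece (n₂, l₂), -x - y ∈ piece (n₀, l₀)
  swap
  · refine ⟨K - ε * (|(n₁:ℝ) - n₂| + n₀ + l₀ + l₁ + l₂) + s₀ * n₀ + s₁ * n₁ + s₂ * n₂ + b₀ * l₀ +
      b₁ * l₁ + b₂ * l₂, (TriBound.of_empty fun x hx y hy hz => hne ⟨x, hx, y, hy, hz⟩).mono
      le_rfl le_rfl le_rfl zero_le, Or.inl (by linarith)⟩
  obtain ⟨x, hx, y, hy, hz⟩ := hne
  obtain ⟨h₂₁, h₁₂⟩ := frequency_comparable hx hy hz h₀₁ h₀₂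
  have hmod := modulation_le hx hy hz
  have hn : |(n₁:ℝ) - n₂| ≤ 1 := by exact_mod_cast natCast_abs_sub_le h₁₂ h₂₁
  have cl : (l₁:ℝ) ≤ l₂ := by exact_mod_cast hl
  have c01 : (n₀:ℝ) ≤ n₁ := by exact_mod_cast h₀₁
  have htr := triBound_piece_transfer (n₀ := n₀) (n₁ := n₁) (n₂ := n₂) (l₀ := l₀) (l₁ := l₁)
    (l₂ := l₂) (c := 1) (by omega) h₁₂
  by_cases hb : max l₀ l₁ + 2 < l₂
  · refine ⟨_, htr, Or.inl ?_⟩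
    push_cast
    exact exponent_dominant₂ A M (by positivity) (by positivity) c01 hn
      (by exact_mod_cast (by omega : l₀ ≤ l₂)) cl (by exact_mod_cast (by omega : l₂ ≤ n₀ + 2))
  rcases le_or_gt l₀ l₁ with h01 | h10
  · have c1 : (l₂:ℝ) ≤ l₁ + 2 := by exact_mod_cast (by omega : l₂ ≤ l₁ + 2)
    have c2 : (l₀:ℝ) ≤ l₁ := by exact_mod_cast h01
    rcases le_total l₁ n₀ with h | h
    · refine ⟨_, htr, Or.inr (Or.inl ?_)⟩
      push_cast
      exact exponent_comparable₁_transfer A M (by positivity) c01 hn cl c1 c2 (by exact_mod_cast h)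
    · refine ⟨_, triBound_piece_low_self _ _, Or.inr (Or.inl ?_)⟩
      push_cast
      exact exponent_comparable₁_low A M (by positivity) (by positivity) c01 hn cl c1 c2
        (by exact_mod_cast h)
  have c10 : (l₁:ℝ) ≤ l₀ := by exact_mod_cast h10.le
  rcases le_or_gt l₀ (l₂ + 4) with h02 | h02
  · have c1 : |(l₀:ℝ) - l₂| ≤ 4 := by
      exact_mod_cast natCast_abs_sub_le h02 (by omega : l₂ ≤ l₀ + 4)
    rcases le_total l₀ n₀ with h | h
    · refine ⟨_, htr, Or.inr (Or.inr (Or.inl ?_))⟩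
      push_cast
      exact exponent_comparable₀_transfer A M (by positivity) c01 hn c1 c10 (by exact_mod_cast h)
    · refine ⟨_, triBound_piece_low _, Or.inr (Or.inr (Or.inl ?_))⟩
      push_cast
      exact exponent_comparable₀_low A M (by positivity) (by positivity) c01 hn c1 c10
        (by exact_mod_cast h)
  have c20 : (l₂:ℝ) ≤ l₀ := by exact_mod_cast (by omega : l₂ ≤ l₀)
  rcases le_or_gt l₀ (n₀ + 8) with h8 | h8
  · have c8 : (l₀:ℝ) ≤ n₀ + 8 := by exact_mod_cast h8
    rcases le_total (n₀ + l₀) (n₁ + l₂) with h | h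
    · refine ⟨_, htr, Or.inl ?_⟩
      have c : (n₀:ℝ) + l₀ ≤ n₁ + l₂ := by exact_mod_cast h
      push_cast
      exact exponent_dominant₀_transfer A M (by positivity) hn cl c20 c8 (by linarith)
    · refine ⟨_, triBound_piece_bilinear h₀₁ h₁₂ h₂₁, Or.inl ?_⟩
      have c : (n₁:ℝ) + l₂ ≤ n₀ + l₀ := by exact_mod_cast h
      push_cast
      exact exponent_dominant₀_bilinear A M (by positivity) c01 hn cl c20 c8 (by linarith)
  have hopp : ∀ σ : ℝ, (σ = 1 ∨ σ = -1) → ∀ x ∈ piece (n₁, l₁) ∩ signSet σ,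
      ∀ y ∈ piece (n₂, l₂) ∩ signSet (-σ), -x - y ∉ piece (n₀, l₀) := by
    intro σ hσ x hx y hy hz
    have := modulation_le_of_opposite hσ hx hy hz
    omega
  have hup := modulation_le_frequency hx hy hz
  have hdn : n₁ ≤ max (max l₀ n₀) (max l₁ l₂) + 2 := by
    have hs : ∀ w : ℝ × Space, ∃ σ : ℝ, (σ = 1 ∨ σ = -1) ∧ w ∈ signSet σ := fun w => by
      have hw : w ∈ signSet 1 ∪ signSet (-1) := by rw [signSet_union]; trivial
      rcases hw with h | h
      exacts [⟨1, Or.inl rfl, h⟩, ⟨-1, Or.inr rfl, h⟩]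
    obtain ⟨σ, hσ, hxs⟩ := hs x
    obtain ⟨σ', hσ', hys⟩ := hs y
    by_cases e : σ' = σ
    · subst e
      exact frequency_le_of_same hσ ⟨hx, hxs⟩ ⟨hy, hys⟩ hz
    · have e' : σ' = -σ := by
        rcases hσ with rfl | rfl <;> rcases hσ' with rfl | rfl <;> simp_all
      subst e'
      exact absurd hz (hopp σ hσ x ⟨hx, hxs⟩ y ⟨hy, hys⟩)
  have c1 : |(l₀:ℝ) - n₁| ≤ 4 := by
    exact_mod_cast natCast_abs_sub_le (by omega : l₀ ≤ n₁ + 4) (by omega : n₁ ≤ l₀ + 4)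
  rcases le_total l₂ n₀ with h | h
  · refine ⟨_, triBound_piece_bilinear_same (by omega) hopp, Or.inr (Or.inr (Or.inr (Or.inl ?_)))⟩
    push_cast
    exact exponent_separated_same A M (by positivity) hn cl (by exact_mod_cast h)
      (by exact_mod_cast (by omega : n₀ ≤ l₀)) c1
  · have c2 : (l₂:ℝ) ≤ n₁ := by exact_mod_cast (by omega : l₂ ≤ n₁)
    rcases hp with hp | hp
    · refine ⟨_, triBound_piece_low _, Or.inr (Or.inr (Or.inr (Or.inr ?_)))⟩
      push_cast
      exact exponent_separated_low' A M (by positivity) (by positivity) hn cl (by exact_mod_cast h)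
        c2 c1 hp
    · refine ⟨_, triBound_piece_low _, Or.inr (Or.inr (Or.inr (Or.inl ?_)))⟩
      push_cast
      exact exponent_separated_low A M (by positivity) (by positivity) hn cl (by exact_mod_cast h)
        c2 c1 hp

end PieceBound

/-! ## Countable decompositions of trilinear forms -/

section Additivity

set_option linter.unusedSectionVars false

variable {X : Type*} [AddCommGroup X] [MeasureSpace X] [MeasurableAdd₂ X] [MeasurableNeg X]
  [SFinite (volume : Measure X)] {ι : Type*} [Countable ι]

theorem tri_tsum_mid {f h : X → ℝ≥0∞} {g : ι → X → ℝ≥0∞} (hf : Measurable f)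
    (hg : ∀ i, Measurable (g i)) (hh : Measurable h) :
    tri f (fun x => ∑' i, g i x) h = ∑' i, tri f (g i) h := by
  unfold tri
  rw [← lintegral_tsum]
  · refine lintegral_congr fun x => ?_
    rw [← lintegral_tsum]
    · refine lintegral_congr fun y => ?_
      rw [← ENNReal.tsum_mul_right, ← ENNReal.tsum_mul_left]
    · intro i
      exact ((measurable_tri_integrand hf (hg i) hh).comp measurable_prodMk_left).aemeasurable
  · intro i
    exact (measurable_tri_integrand hf (hg i) hh).lintegral_prod_right'.aemeasurable

variable [(volume : Measure X).IsAddLeftInvariant] [(volume : Measure X).IsNegInvariant]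

theorem tri_tsum_left {g h : X → ℝ≥0∞} {f : ι → X → ℝ≥0∞} (hg : Measurable g)
    (hf : ∀ i, Measurable (f i)) (hh : Measurable h) :
    tri (fun x => ∑' i, f i x) g h = ∑' i, tri (f i) g h := by
  rw [tri_swap_left (Measurable.tsum hf) hg hh, tri_tsum_mid hg hf hh]
  exact tsum_congr fun i => tri_swap_left hg (hf i) hh

theorem tri_tsum_right {f g : X → ℝ≥0∞} {h : ι → X → ℝ≥0∞} (hf : Measurable f)
    (hg : Measurable g) (hh : ∀ i, Measurable (h i)) :
    tri f g (fun x => ∑' i, h i x) = ∑' i, tri f g (h i) := by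
  rw [tri_swap_right hf hg (Measurable.tsum hh), tri_tsum_mid hf hh hg]
  exact tsum_congr fun i => tri_swap_right hf (hh i) hg

end Additivity

section Partition

/-- The restriction of a function to a dyadic piece. -/
def cut (F : ℝ × Space → ℝ≥0∞) (p : ℕ × ℕ) : ℝ × Space → ℝ≥0∞ := (piece p).indicator F

theorem measurable_cut {F : ℝ × Space → ℝ≥0∞} (hF : Measurable F) (p : ℕ × ℕ) :
    Measurable (cut F p) := hF.indicator (measurableSet_piece p)

theorem cut_of_notMem {F : ℝ × Space → ℝ≥0∞} {p : ℕ × ℕ} {x : ℝ × Space} (h : x ∉ piece p) :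
    cut F p x = 0 := Set.indicator_of_notMem h F

theorem eq_of_two_pow_near {m n : ℕ} {a : ℝ} (h : (2:ℝ) ^ m ≤ a) (h' : a < 2 ^ (m + 1))
    (k : (2:ℝ) ^ n ≤ a) (k' : a < 2 ^ (n + 1)) : m = n := by
  have h1 := (pow_lt_pow_iff_right₀ (by norm_num : (1:ℝ) < 2)).1 (h.trans_lt k')
  have h2 := (pow_lt_pow_iff_right₀ (by norm_num : (1:ℝ) < 2)).1 (k.trans_lt h')
  omega

theorem existsUnique_piece (x : ℝ × Space) : ∃ p, x ∈ piece p ∧ ∀ q, x ∈ piece q → q = p := by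
  obtain ⟨n, hn, hn'⟩ := exists_nat_pow_near
    (le_add_of_nonneg_right (norm_nonneg x.2) : 1 ≤ 1 + ‖x.2‖) (by norm_num : (1:ℝ) < 2)
  obtain ⟨l, hl, hl'⟩ := exists_nat_pow_near
    (le_add_of_nonneg_right (abs_nonneg (|x.1| - ‖x.2‖)) : 1 ≤ 1 + |(|x.1| - ‖x.2‖)|)
    (by norm_num : (1:ℝ) < 2)
  exact ⟨(n, l), ⟨⟨hn, hn'⟩, hl, hl'⟩, fun q hq => Prod.ext
    (eq_of_two_pow_near hq.1.1 hq.1.2 hn hn') (eq_of_two_pow_near hq.2.1 hq.2.2 hl hl')⟩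

theorem tsum_cut (F : ℝ × Space → ℝ≥0∞) (x : ℝ × Space) : ∑' p, cut F p x = F x := by
  obtain ⟨p, hp, hu⟩ := existsUnique_piece x
  rw [tsum_eq_single p fun q hq => cut_of_notMem fun h => hq (hu q h)]
  exact Set.indicator_of_mem hp F

theorem tsum_nrm_cut_sq {F : ℝ × Space → ℝ≥0∞} (hF : Measurable F) :
    ∑' p, nrm (cut F p) ^ 2 = nrm F ^ 2 := by
  simp_rw [nrm_sq]
  rw [← lintegral_tsum fun p => ((measurable_cut hF p).pow_const 2).aemeasurable]
  refine lintegral_congr fun x => ?_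
  rw [← tsum_cut (fun x => F x ^ 2) x]
  refine tsum_congr fun p => ?_
  by_cases h : x ∈ piece p <;> simp [cut, h]

theorem tri_eq_tsum_cut {F G H : ℝ × Space → ℝ≥0∞} (hF : Measurable F) (hG : Measurable G)
    (hH : Measurable H) :
    tri F G H = ∑' p₀, ∑' p₁, ∑' p₂, tri (cut F p₀) (cut G p₁) (cut H p₂) := by
  have e : ∀ F : ℝ × Space → ℝ≥0∞, F = fun x => ∑' p, cut F p x := fun F =>
    funext fun x => (tsum_cut F x).symm
  conv_lhs => rw [e F]
  rw [tri_tsum_left hG (measurable_cut hF) hH]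
  refine tsum_congr fun p₀ => ?_
  conv_lhs => rw [e G]
  rw [tri_tsum_mid (measurable_cut hF p₀) (measurable_cut hG) hH]
  refine tsum_congr fun p₁ => ?_
  conv_lhs => rw [e H]
  rw [tri_tsum_right (measurable_cut hF p₀) (measurable_cut hG p₁) (measurable_cut hH)]

end Partition

/-! ## A trilinear Schur test -/

section Schur

theorem tsum_mul_le_sqrt_mul_sqrt {ι : Type*} (f g : ι → ℝ≥0∞) :
    ∑' i, f i * g i ≤ (∑' i, f i ^ 2) ^ (1 / 2 : ℝ) * (∑' i, g i ^ 2) ^ (1 / 2 : ℝ) := by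
  let _ : MeasurableSpace ι := ⊤
  have := lintegral_mul_le_nrm (Measure.count : Measure ι) (f := f) (g := g)
    measurable_from_top.aemeasurable measurable_from_top.aemeasurable
  simpa [lintegral_count' (measurable_from_top (f := _))] using this

theorem schur {I J K : Type*} (a : I → J → K → ℝ≥0∞) {C₁ C₂ : ℝ≥0∞}
    (h₁ : ∀ i j, ∑' k, a i j k ≤ C₁) (h₂ : ∀ k, ∑' j, ∑' i, a i j k ≤ C₂)
    (x : I → ℝ≥0∞) (y : J → ℝ≥0∞) (z : K → ℝ≥0∞) :
    ∑' i, ∑' j, ∑' k, a i j k * (x i * y j * z k) ≤ C₁ ^ (1 / 2 : ℝ) * C₂ ^ (1 / 2 : ℝ) *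
      ((∑' i, x i ^ 2) ^ (1 / 2 : ℝ) * (∑' j, y j ^ 2) ^ (1 / 2 : ℝ) *
        (∑' k, z k ^ 2) ^ (1 / 2 : ℝ)) := by
  have e : ∀ b : ℝ≥0∞, (b ^ (1 / 2 : ℝ)) ^ 2 = b := fun b => by
    rw [← ENNReal.rpow_natCast, ← ENNReal.rpow_mul]; norm_num
  have key := tsum_mul_le_sqrt_mul_sqrt
    (fun p : I × J × K => a p.1 p.2.1 p.2.2 ^ (1 / 2 : ℝ) * (x p.1 * y p.2.1))
    (fun p : I × J × K => a p.1 p.2.1 p.2.2 ^ (1 / 2 : ℝ) * z p.2.2)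
  have hL : ∑' p : I × J × K, (a p.1 p.2.1 p.2.2 ^ (1 / 2 : ℝ) * (x p.1 * y p.2.1)) *
      (a p.1 p.2.1 p.2.2 ^ (1 / 2 : ℝ) * z p.2.2)
      = ∑' i, ∑' j, ∑' k, a i j k * (x i * y j * z k) := by
    simp_rw [ENNReal.tsum_prod']
    refine tsum_congr fun i => tsum_congr fun j => tsum_congr fun k => ?_
    calc _ = (a i j k ^ (1 / 2 : ℝ)) ^ 2 * (x i * y j * z k) := by ring
      _ = _ := by rw [e]
  have hA : ∑' p : I × J × K, (a p.1 p.2.1 p.2.2 ^ (1 / 2 : ℝ) * (x p.1 * y p.2.1)) ^ 2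
      ≤ C₁ * ((∑' i, x i ^ 2) * ∑' j, y j ^ 2) := by
    simp_rw [ENNReal.tsum_prod', mul_pow, e, ENNReal.tsum_mul_right]
    calc ∑' i, ∑' j, (∑' k, a i j k) * (x i ^ 2 * y j ^ 2)
        ≤ ∑' i, ∑' j, C₁ * (x i ^ 2 * y j ^ 2) := by
          gcongr with i j; exact h₁ i j
      _ = _ := by simp_rw [ENNReal.tsum_mul_left, ENNReal.tsum_mul_right]
  have hB : ∑' p : I × J × K, (a p.1 p.2.1 p.2.2 ^ (1 / 2 : ℝ) * z p.2.2) ^ 2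
      ≤ C₂ * ∑' k, z k ^ 2 := by
    simp_rw [ENNReal.tsum_prod', mul_pow, e]
    calc ∑' i, ∑' j, ∑' k, a i j k * z k ^ 2
        = ∑' k, (∑' j, ∑' i, a i j k) * z k ^ 2 := by
          rw [ENNReal.tsum_comm]
          simp_rw [← ENNReal.tsum_mul_right]
          rw [ENNReal.tsum_comm]
          conv_rhs => rw [ENNReal.tsum_comm]
          rw [ENNReal.tsum_comm]
          refine tsum_congr fun j => ?_
          rw [ENNReal.tsum_comm]
      _ ≤ ∑' k, C₂ * z k ^ 2 := by gcongr with k; exact h₂ k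
      _ = _ := ENNReal.tsum_mul_left
  rw [hL] at key
  refine key.trans ((mul_le_mul' (ENNReal.rpow_le_rpow hA (by norm_num))
    (ENNReal.rpow_le_rpow hB (by norm_num))).trans_eq ?_)
  rw [ENNReal.mul_rpow_of_nonneg _ _ (by norm_num), ENNReal.mul_rpow_of_nonneg _ _ (by norm_num),
    ENNReal.mul_rpow_of_nonneg _ _ (by norm_num)]
  ring

/-- The two-sided geometric weight `2 ^ (-ε |a - b|)`. -/
def geo (ε : ℝ) (a b : ℕ) : ℝ≥0∞ := 2 ^ (-(ε * |(a:ℝ) - b|))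

/-- An upper bound for the sums of `geo`. -/
def geoSum (ε : ℝ) : ℝ≥0∞ := 2 * ∑' k : ℕ, ((2:ℝ≥0∞) ^ (-ε)) ^ k

theorem geoSum_ne_top {ε : ℝ} (hε : 0 < ε) : geoSum ε ≠ ⊤ := by
  have h : (2:ℝ≥0∞) ^ (-ε) < 1 := by
    rw [ENNReal.rpow_neg, ENNReal.inv_lt_one]
    exact ENNReal.one_lt_rpow (by norm_num) hε
  unfold geoSum
  rw [ENNReal.tsum_geometric]
  refine ENNReal.mul_ne_top (by norm_num) ?_
  rw [ENNReal.inv_ne_top]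
  exact (tsub_pos_of_lt h).ne'

theorem tsum_geo_le (ε : ℝ) (b : ℕ) : ∑' a, geo ε a b ≤ geoSum ε := by
  set ρ := (2:ℝ≥0∞) ^ (-ε) with hρ
  have e : ∀ k : ℕ, (2:ℝ≥0∞) ^ (-(ε * k)) = ρ ^ k := fun k => by
    rw [hρ, ← ENNReal.rpow_natCast, ← ENNReal.rpow_mul]; congr 1; ring
  have h1 : ∀ a, geo ε a b ≤ ∑' k : ℕ, ((if a = b + k then ρ ^ k else 0) +
      (if k ≤ b ∧ a = b - k then ρ ^ k else 0)) := by
    intro a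
    rcases le_total b a with h | h
    · obtain ⟨k, rfl⟩ := Nat.exists_eq_add_of_le h
      refine le_trans ?_ (ENNReal.le_tsum k)
      rw [if_pos rfl, ← e, geo]
      refine le_trans (le_of_eq ?_) le_self_add
      congr 3
      push_cast
      rw [add_sub_cancel_left, abs_of_nonneg (by positivity)]
    · obtain ⟨k, rfl⟩ := Nat.exists_eq_add_of_le h
      refine le_trans ?_ (ENNReal.le_tsum k)
      rw [if_pos (⟨by omega, by omega⟩ : k ≤ a + k ∧ a = a + k - k), ← e, geo]
      refine le_trans (le_of_eq ?_) le_add_self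
      congr 3
      push_cast
      rw [sub_add_cancel_left, abs_neg, abs_of_nonneg (by positivity)]
  refine (ENNReal.tsum_le_tsum h1).trans ?_
  rw [ENNReal.tsum_comm, geoSum, ← ENNReal.tsum_mul_left]
  refine ENNReal.tsum_le_tsum fun k => ?_
  rw [ENNReal.tsum_add, tsum_ite_eq, two_mul]
  gcongr
  by_cases hk : k ≤ b
  · simp [hk, tsum_ite_eq, hρ]
  · simp [hk]

theorem tsum_geo_mul_geo_le (ε : ℝ) (b : ℕ) (c : ℕ → ℕ) :
    ∑' p : ℕ × ℕ, geo ε p.1 b * geo ε p.2 (c p.1) ≤ geoSum ε * geoSum ε := by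
  rw [ENNReal.tsum_prod']
  simp_rw [ENNReal.tsum_mul_left]
  calc _ ≤ ∑' n, geo ε n b * geoSum ε := by gcongr; exact tsum_geo_le _ _
    _ = (∑' n, geo ε n b) * geoSum ε := ENNReal.tsum_mul_right
    _ ≤ _ := by gcongr; exact tsum_geo_le _ _

theorem schur_geo {ε : ℝ} (a : ℕ × ℕ → ℕ × ℕ → ℕ × ℕ → ℝ≥0∞)
    (g : ℕ × ℕ → ℕ × ℕ → ℕ) (h₀ : ℕ × ℕ → ℕ × ℕ → ℕ) (h₁ : ℕ × ℕ → ℕ)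
    (hg : ∀ p₀ p₁ p₂, a p₀ p₁ p₂ ≤ geo ε p₂.1 p₁.1 * geo ε p₂.2 (g p₀ p₁))
    (hh : ∀ p₀ p₁ p₂, a p₀ p₁ p₂ ≤
      geo ε p₁.1 p₂.1 * geo ε p₁.2 (h₁ p₂) * (geo ε p₀.1 0 * geo ε p₀.2 (h₀ p₁ p₂)))
    (x y z : ℕ × ℕ → ℝ≥0∞) :
    ∑' i, ∑' j, ∑' k, a i j k * (x i * y j * z k) ≤ geoSum ε ^ 3 *
      ((∑' i, x i ^ 2) ^ (1 / 2 : ℝ) * (∑' j, y j ^ 2) ^ (1 / 2 : ℝ) *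
        (∑' k, z k ^ 2) ^ (1 / 2 : ℝ)) := by
  refine (schur a (C₁ := geoSum ε * geoSum ε) (C₂ := (geoSum ε * geoSum ε) ^ 2) ?_ ?_ x y z).trans ?_
  · intro i j
    refine (ENNReal.tsum_le_tsum (hg i j)).trans ?_
    exact tsum_geo_mul_geo_le ε _ fun _ => _
  · intro k
    calc _ ≤ ∑' j : ℕ × ℕ, ∑' i : ℕ × ℕ,
          geo ε j.1 k.1 * geo ε j.2 (h₁ k) * (geo ε i.1 0 * geo ε i.2 (h₀ j k)) := by
          gcongr with j i; exact hh i j k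
      _ ≤ ∑' j : ℕ × ℕ, geo ε j.1 k.1 * geo ε j.2 (h₁ k) * (geoSum ε * geoSum ε) := by
          simp_rw [ENNReal.tsum_mul_left]
          gcongr with j
          exact tsum_geo_mul_geo_le ε _ fun _ => _
      _ = (∑' j : ℕ × ℕ, geo ε j.1 k.1 * geo ε j.2 (h₁ k)) * (geoSum ε * geoSum ε) :=
          ENNReal.tsum_mul_right
      _ ≤ _ := by
          rw [pow_two]
          gcongr
          exact tsum_geo_mul_geo_le ε _ fun _ => _
  · rw [sq_rpow_half, ← pow_two, sq_rpow_half]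
    gcongr
    exact le_of_eq (by ring)

end Schur

/-! ## Summation over dyadic pieces -/

section Weights

/-- The weight `⟨ξ⟩ ^ (-s) ⟨|τ| - |ξ|⟩ ^ (-b)`. -/
def wt (s b : ℝ) (x : ℝ × Space) : ℝ≥0∞ :=
  ENNReal.ofReal (jap ‖x.2‖ ^ (-s) * jap (|x.1| - ‖x.2‖) ^ (-b))

theorem continuous_jap : Continuous jap := by unfold jap; fun_prop

theorem one_le_jap (r : ℝ) : 1 ≤ jap r :=
  Real.one_le_sqrt.2 (by nlinarith [sq_nonneg r])

theorem measurable_wt (s b : ℝ) : Measurable (wt s b) := by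
  have := continuous_jap.measurable
  unfold wt
  fun_prop

theorem jap_rpow_neg_le {n : ℕ} {r : ℝ} (s : ℝ) (h : (2:ℝ) ^ n ≤ 1 + |r|)
    (h' : 1 + |r| < 2 ^ (n + 1)) : jap r ^ (-s) ≤ 2 ^ (-s * n + |s|) := by
  have hj : 0 < jap r := one_pos.trans_le (one_le_jap r)
  have hsq : jap r ^ 2 = 1 + r ^ 2 := Real.sq_sqrt (by positivity)
  have hr : |r| ^ 2 = r ^ 2 := sq_abs r
  have hr0 := abs_nonneg r
  have up : jap r ≤ 2 ^ (n + 1) := by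
    refine le_trans ?_ h'.le
    exact abs_le_of_sq_le_sq' (by nlinarith) (by positivity) |>.2
  have low : (2:ℝ) ^ n ≤ 2 * jap r := by
    refine h.trans ?_
    exact abs_le_of_sq_le_sq' (by nlinarith [sq_nonneg (1 - |r|)]) (by positivity) |>.2
  set t := Real.logb 2 (jap r) with ht
  have e : jap r = 2 ^ t := (Real.rpow_logb (by norm_num) (by norm_num) hj).symm
  have t1 : t ≤ n + 1 := by
    rw [e, ← Real.rpow_natCast, Real.rpow_le_rpow_left_iff (by norm_num)] at up
    exact_mod_cast up
  have t2 : n ≤ t + 1 := by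
    rw [e, ← Real.rpow_natCast, ← Real.rpow_one_add' (by positivity) , Real.rpow_le_rpow_left_iff (by norm_num)] at low
    · linarith
    · have : 0 ≤ t := Real.logb_nonneg (by norm_num) (one_le_jap r)
      positivity
  rw [e, ← Real.rpow_mul (by norm_num)]
  refine Real.rpow_le_rpow_of_exponent_le (by norm_num) ?_
  have h3 : s * (n - t) ≤ |s| * 1 :=
    mul_sub_le_of_abs_sub_le (abs_le.2 ⟨by linarith, by linarith⟩)
  linarith

theorem wt_le {s b : ℝ} {p : ℕ × ℕ} {x : ℝ × Space} (hx : x ∈ piece p) :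
    wt s b x ≤ 2 ^ (|s| + |b| - s * p.1 - b * p.2) := by
  obtain ⟨⟨h1, h2⟩, h3, h4⟩ := hx
  have hn : |(‖x.2‖)| = ‖x.2‖ := abs_of_nonneg (norm_nonneg _)
  have := mul_le_mul (jap_rpow_neg_le s (by rwa [hn]) (by rwa [hn])) (jap_rpow_neg_le b h3 h4)
    (Real.rpow_nonneg (one_pos.trans_le (one_le_jap _)).le _) (by positivity)
  refine (ENNReal.ofReal_le_ofReal this).trans_eq ?_
  rw [← Real.rpow_add (by norm_num), ← ENNReal.ofReal_rpow_of_pos (by norm_num)]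
  rw [ENNReal.ofReal_ofNat]
  congr 1; ring

theorem tri_le_const_mul {X : Type*} [AddCommGroup X] [MeasureSpace X] {f g h f' g' h' : X → ℝ≥0∞}
    {a b c : ℝ≥0∞} (ha : a ≠ ⊤) (hb : b ≠ ⊤) (hc : c ≠ ⊤) (hf : ∀ x, f x ≤ a * f' x)
    (hg : ∀ x, g x ≤ b * g' x) (hh : ∀ x, h x ≤ c * h' x) :
    tri f g h ≤ a * b * c * tri f' g' h' := by
  have hk : a * b * c ≠ ⊤ := ENNReal.mul_ne_top (ENNReal.mul_ne_top ha hb) hc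
  unfold tri
  rw [← lintegral_const_mul' _ _ hk]
  refine lintegral_mono fun x => ?_
  rw [← lintegral_const_mul' _ _ hk]
  refine lintegral_mono fun y => ?_
  calc _ ≤ a * f' (-x - y) * (b * g' x * (c * h' y)) := by
        gcongr
        exacts [hf _, hg _, hh _]
    _ = _ := by ring

theorem two_rpow_ne_top (t : ℝ) : (2:ℝ≥0∞) ^ t ≠ ⊤ := by simp

theorem cut_wt_le (s b : ℝ) (F : ℝ × Space → ℝ≥0∞) (p : ℕ × ℕ) (x : ℝ × Space) :
    cut (fun x => wt s b x * F x) p x ≤ 2 ^ (|s| + |b| - s * p.1 - b * p.2) * cut F p x := by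
  by_cases h : x ∈ piece p
  · simp only [cut, Set.indicator_of_mem h]
    gcongr
    exact wt_le h
  · rw [cut_of_notMem h]; exact zero_le

theorem tri_cut_wt_le (s₀ s₁ s₂ b₀ b₁ b₂ : ℝ) (F G H : ℝ × Space → ℝ≥0∞) (p₀ p₁ p₂ : ℕ × ℕ) :
    tri (cut (fun x => wt s₀ b₀ x * F x) p₀) (cut (fun x => wt s₁ b₁ x * G x) p₁)
      (cut (fun x => wt s₂ b₂ x * H x) p₂) ≤
      2 ^ (|s₀| + |s₁| + |s₂| + |b₀| + |b₁| + |b₂|) * 2 ^ (- s₀ * p₀.1 - s₁ * p₁.1 - s₂ * p₂.1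
        - b₀ * p₀.2 - b₁ * p₁.2 - b₂ * p₂.2) * tri (cut F p₀) (cut G p₁) (cut H p₂) := by
  refine (tri_le_const_mul (two_rpow_ne_top _) (two_rpow_ne_top _) (two_rpow_ne_top _)
    (cut_wt_le _ _ _ _) (cut_wt_le _ _ _ _) (cut_wt_le _ _ _ _)).trans_eq ?_
  simp only [← ENNReal.rpow_add _ _ (two_ne_zero) (ENNReal.ofNat_ne_top (n := 2))]
  congr 2
  ring

end Weights

section Regions

/-- The trilinear estimate for the interactions of dyadic pieces selected by `R`. -/
def RegionBound (s₀ s₁ s₂ b₀ b₁ b₂ : ℝ) (R : ℕ × ℕ → ℕ × ℕ → ℕ × ℕ → Prop) : Prop :=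
  ∃ C : ℝ≥0∞, C ≠ ⊤ ∧ ∀ F G H : ℝ × Space → ℝ≥0∞, Measurable F → Measurable G → Measurable H →
    ∑' p₀, ∑' p₁, ∑' p₂, ⨆ _ : R p₀ p₁ p₂, tri (cut (fun x => wt s₀ b₀ x * F x) p₀)
      (cut (fun x => wt s₁ b₁ x * G x) p₁) (cut (fun x => wt s₂ b₂ x * H x) p₂) ≤
      C * (nrm F * nrm G * nrm H)

variable {s₀ s₁ s₂ b₀ b₁ b₂ : ℝ} {R R' R'' : ℕ × ℕ → ℕ × ℕ → ℕ × ℕ → Prop}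

theorem measurable_cut_wt (s b : ℝ) {F : ℝ × Space → ℝ≥0∞} (hF : Measurable F) (p : ℕ × ℕ) :
    Measurable (cut (fun x => wt s b x * F x) p) :=
  measurable_cut ((measurable_wt s b).mul hF) p

theorem RegionBound.swap_right (h : RegionBound s₀ s₂ s₁ b₀ b₂ b₁ R) :
    RegionBound s₀ s₁ s₂ b₀ b₁ b₂ fun p₀ p₁ p₂ => R p₀ p₂ p₁ := by
  obtain ⟨C, hC, h⟩ := h
  refine ⟨C, hC, fun F G H hF hG hH => ?_⟩
  have e := h F H G hF hH hG
  rw [show nrm F * nrm H * nrm G = nrm F * nrm G * nrm H by ring] at e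
  refine le_trans (le_of_eq ?_) e
  refine tsum_congr fun p₀ => ?_
  rw [ENNReal.tsum_comm]
  refine tsum_congr fun p₂ => tsum_congr fun p₁ => iSup_congr fun _ => ?_
  exact tri_swap_right (measurable_cut_wt _ _ hF _) (measurable_cut_wt _ _ hG _)
    (measurable_cut_wt _ _ hH _)

theorem RegionBound.swap_left (h : RegionBound s₁ s₀ s₂ b₁ b₀ b₂ R) :
    RegionBound s₀ s₁ s₂ b₀ b₁ b₂ fun p₀ p₁ p₂ => R p₁ p₀ p₂ := by
  obtain ⟨C, hC, h⟩ := h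
  refine ⟨C, hC, fun F G H hF hG hH => ?_⟩
  have e := h G F H hG hF hH
  rw [show nrm G * nrm F * nrm H = nrm F * nrm G * nrm H by ring] at e
  refine le_trans (le_of_eq ?_) e
  rw [ENNReal.tsum_comm]
  refine tsum_congr fun p₁ => tsum_congr fun p₀ => tsum_congr fun p₂ => iSup_congr fun _ => ?_
  exact tri_swap_left (measurable_cut_wt _ _ hF _) (measurable_cut_wt _ _ hG _)
    (measurable_cut_wt _ _ hH _)

theorem RegionBound.union (h : RegionBound s₀ s₁ s₂ b₀ b₁ b₂ R)
    (h' : RegionBound s₀ s₁ s₂ b₀ b₁ b₂ R')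
    (hR : ∀ p₀ p₁ p₂, R'' p₀ p₁ p₂ → R p₀ p₁ p₂ ∨ R' p₀ p₁ p₂) :
    RegionBound s₀ s₁ s₂ b₀ b₁ b₂ R'' := by
  obtain ⟨C, hC, h⟩ := h
  obtain ⟨C', hC', h'⟩ := h'
  refine ⟨C + C', ENNReal.add_ne_top.2 ⟨hC, hC'⟩, fun F G H hF hG hH => ?_⟩
  rw [add_mul]
  refine le_trans ?_ (add_le_add (h F G H hF hG hH) (h' F G H hF hG hH))
  simp_rw [← ENNReal.tsum_add]
  refine ENNReal.tsum_le_tsum fun p₀ => ENNReal.tsum_le_tsum fun p₁ =>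
    ENNReal.tsum_le_tsum fun p₂ => iSup_le fun hr => ?_
  rcases hR _ _ _ hr with h1 | h1
  · refine le_trans ?_ le_self_add
    rw [iSup_pos h1]
  · refine le_trans ?_ le_add_self
    rw [iSup_pos h1]

theorem RegionBound.tri_le (h : RegionBound s₀ s₁ s₂ b₀ b₁ b₂ fun _ _ _ => True) :
    ∃ C : ℝ≥0∞, C ≠ ⊤ ∧ ∀ F G H : ℝ × Space → ℝ≥0∞, Measurable F → Measurable G → Measurable H →
      tri (fun x => wt s₀ b₀ x * F x) (fun x => wt s₁ b₁ x * G x) (fun x => wt s₂ b₂ x * H x) ≤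
        C * (nrm F * nrm G * nrm H) := by
  obtain ⟨C, hC, h⟩ := h
  refine ⟨C, hC, fun F G H hF hG hH => ?_⟩
  refine (tri_eq_tsum_cut (F := fun x => wt s₀ b₀ x * F x) (G := fun x => wt s₁ b₁ x * G x)
    (H := fun x => wt s₂ b₂ x * H x) ((measurable_wt _ _).mul hF) ((measurable_wt _ _).mul hG)
    ((measurable_wt _ _).mul hH)).trans_le ?_
  simpa using h F G H hF hG hH

/-- The interactions whose lowest frequency is the first one and whose modulations of the other two
are ordered. -/
def Ordered (p₀ p₁ p₂ : ℕ × ℕ) : Prop := p₀.1 ≤ p₁.1 ∧ p₀.1 ≤ p₂.1 ∧ p₁.2 ≤ p₂.2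

theorem RegionBound.of_ordered
    (h : ∀ {s₀ s₁ s₂ b₀ b₁ b₂ : ℝ}, Admissible s₀ s₁ s₂ b₀ b₁ b₂ →
      RegionBound s₀ s₁ s₂ b₀ b₁ b₂ Ordered)
    (A : Admissible s₀ s₁ s₂ b₀ b₁ b₂) :
    RegionBound s₀ s₁ s₂ b₀ b₁ b₂ fun _ _ _ => True := by
  have h1 : ∀ {s₀ s₁ s₂ b₀ b₁ b₂ : ℝ}, Admissible s₀ s₁ s₂ b₀ b₁ b₂ →
      RegionBound s₀ s₁ s₂ b₀ b₁ b₂ fun p₀ p₁ p₂ => p₀.1 ≤ p₁.1 ∧ p₀.1 ≤ p₂.1 := fun A =>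
    (h A).union (h A.swap_right).swap_right fun p₀ p₁ p₂ hp => by
      unfold Ordered; omega
  refine RegionBound.union (R' := fun p₀ p₁ p₂ => p₂.1 ≤ p₀.1 ∧ p₂.1 ≤ p₁.1)
    ((h1 A).union (h1 A.swap_left).swap_left
      (R'' := fun p₀ p₁ p₂ => p₀.1 ≤ p₂.1 ∨ p₁.1 ≤ p₂.1) fun p₀ p₁ p₂ hp => by omega)
    (h1 A.swap_right.swap_left).swap_left.swap_right fun p₀ p₁ p₂ _ => by omega

end Regions

section OrderedRegion

variable {s₀ s₁ s₂ b₀ b₁ b₂ ε K : ℝ}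

theorem rpow_half_tsum_nrm_cut {F : ℝ × Space → ℝ≥0∞} (hF : Measurable F) :
    (∑' p, nrm (cut F p) ^ 2) ^ (1 / 2 : ℝ) = nrm F := by
  rw [tsum_nrm_cut_sq hF, sq_rpow_half]

theorem two_rpow_add (a b : ℝ) : (2:ℝ≥0∞) ^ a * 2 ^ b = 2 ^ (a + b) :=
  (ENNReal.rpow_add _ _ two_ne_zero ENNReal.ofNat_ne_top).symm

theorem RegionBound.of_decay (hε : 0 < ε) (q : ℕ × ℕ → ℕ × ℕ → ℕ × ℕ → ℝ)
    (g : ℕ × ℕ → ℕ × ℕ → ℕ) (h₀ : ℕ × ℕ → ℕ × ℕ → ℕ) (h₁ : ℕ × ℕ → ℕ)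
    (hg : ∀ p₀ p₁ p₂, |(p₁.1:ℝ) - p₂.1| + |(p₂.2:ℝ) - g p₀ p₁| ≤ q p₀ p₁ p₂)
    (hh : ∀ p₀ p₁ p₂, |(p₁.1:ℝ) - p₂.1| + |(p₁.2:ℝ) - h₁ p₂| + p₀.1 + |(p₀.2:ℝ) - h₀ p₁ p₂|
      ≤ q p₀ p₁ p₂) :
    RegionBound s₀ s₁ s₂ b₀ b₁ b₂ fun p₀ p₁ p₂ => ∃ e : ℝ,
      TriBound (piece p₀) (piece p₁) (piece p₂) (2 ^ e) ∧
        e - s₀ * p₀.1 - s₁ * p₁.1 - s₂ * p₂.1 - b₀ * p₀.2 - b₁ * p₁.2 - b₂ * p₂.2 ≤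
          K - ε * q p₀ p₁ p₂ := by
  set c := |s₀| + |s₁| + |s₂| + |b₀| + |b₁| + |b₂| with hc
  refine ⟨2 ^ (c + K) * geoSum ε ^ 3, ENNReal.mul_ne_top (two_rpow_ne_top _)
    (ENNReal.pow_ne_top (geoSum_ne_top hε)), fun F G H hF hG hH => ?_⟩
  have key := schur_geo (ε := ε) (fun p₀ p₁ p₂ => 2 ^ (-(ε * q p₀ p₁ p₂))) g h₀ h₁
    (fun p₀ p₁ p₂ => by
      unfold geo
      rw [two_rpow_add]
      refine two_rpow_le_two_rpow ?_
      have := mul_le_mul_of_nonneg_left (hg p₀ p₁ p₂) hε.le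
      rw [abs_sub_comm (p₂.1:ℝ)]
      linarith)
    (fun p₀ p₁ p₂ => by
      unfold geo
      simp only [two_rpow_add]
      refine two_rpow_le_two_rpow ?_
      have := mul_le_mul_of_nonneg_left (hh p₀ p₁ p₂) hε.le
      have e : |(p₀.1:ℝ) - (0:ℕ)| = p₀.1 := by simp
      rw [e]
      linarith)
    (fun p => nrm (cut F p)) (fun p => nrm (cut G p)) (fun p => nrm (cut H p))
  rw [rpow_half_tsum_nrm_cut hF, rpow_half_tsum_nrm_cut hG, rpow_half_tsum_nrm_cut hH] at key
  rw [mul_assoc]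
  refine le_trans ?_ (mul_le_mul_right key _)
  simp_rw [← ENNReal.tsum_mul_left]
  refine ENNReal.tsum_le_tsum fun p₀ => ENNReal.tsum_le_tsum fun p₁ =>
    ENNReal.tsum_le_tsum fun p₂ => iSup_le ?_
  rintro ⟨e, he, hd⟩
  calc _ ≤ _ := tri_cut_wt_le _ _ _ _ _ _ _ _ _ _ _ _
    _ ≤ 2 ^ c * 2 ^ (- s₀ * p₀.1 - s₁ * p₁.1 - s₂ * p₂.1 - b₀ * p₀.2 - b₁ * p₁.2 - b₂ * p₂.2) *
        (2 ^ e * (nrm (cut F p₀) * nrm (cut G p₁) * nrm (cut H p₂))) := by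
      gcongr
      exact he _ _ _ (measurable_cut hF _) (measurable_cut hG _) (measurable_cut hH _)
        (fun _ => cut_of_notMem) (fun _ => cut_of_notMem) (fun _ => cut_of_notMem)
    _ ≤ _ := by
      generalize nrm (cut F p₀) * nrm (cut G p₁) * nrm (cut H p₂) = N
      rw [← mul_assoc, ← mul_assoc, two_rpow_add, two_rpow_add, two_rpow_add]
      refine mul_le_mul_left (two_rpow_le_two_rpow ?_) _
      linarith

theorem regionBound_ordered_of_margins (A : Admissible s₀ s₁ s₂ b₀ b₁ b₂)
    (M : Margins s₀ s₁ s₂ b₀ b₁ b₂ ε K)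
    (hp : 4 * ε ≤ s₁ + s₂ + b₀ ∨ 4 * ε ≤ s₁ + s₂ + b₀ + b₂) :
    RegionBound s₀ s₁ s₂ b₀ b₁ b₂ Ordered := by
  have a := fun x y : ℝ => abs_nonneg (x - y)
  have r₁ : RegionBound s₀ s₁ s₂ b₀ b₁ b₂ _ := RegionBound.of_decay (K := K) M.pos
    (fun p₀ p₁ p₂ => |(p₁.1:ℝ) - p₂.1| + p₀.1 + p₀.2 + p₁.2 + p₂.2)
    (fun _ _ => 0) (fun _ _ => 0) (fun _ => 0)
    (fun p₀ p₁ p₂ => by simp; linarith [Nat.cast_nonneg (α := ℝ) p₀.1, Nat.cast_nonneg (α := ℝ) p₀.2, Nat.cast_nonneg (α := ℝ) p₁.2])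
    (fun p₀ p₁ p₂ => by simp; linarith [Nat.cast_nonneg (α := ℝ) p₂.2])
  have r₂ : RegionBound s₀ s₁ s₂ b₀ b₁ b₂ _ := RegionBound.of_decay (K := K) M.pos
    (fun p₀ p₁ p₂ => |(p₁.1:ℝ) - p₂.1| + |(p₁.2:ℝ) - p₂.2| + p₀.1 + p₀.2)
    (fun _ p₁ => p₁.2) (fun _ _ => 0) (fun p₂ => p₂.2)
    (fun p₀ p₁ p₂ => by rw [abs_sub_comm (p₂.2:ℝ)]; linarith [Nat.cast_nonneg (α := ℝ) p₀.1, Nat.cast_nonneg (α := ℝ) p₀.2])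
    (fun p₀ p₁ p₂ => by simp)
  have r₃ : RegionBound s₀ s₁ s₂ b₀ b₁ b₂ _ := RegionBound.of_decay (K := K) M.pos
    (fun p₀ p₁ p₂ => |(p₁.1:ℝ) - p₂.1| + |(p₀.2:ℝ) - p₂.2| + p₀.1 + p₁.2)
    (fun p₀ _ => p₀.2) (fun _ p₂ => p₂.2) (fun _ => 0)
    (fun p₀ p₁ p₂ => by rw [abs_sub_comm (p₂.2:ℝ)]; linarith [Nat.cast_nonneg (α := ℝ) p₀.1, Nat.cast_nonneg (α := ℝ) p₁.2])
    (fun p₀ p₁ p₂ => by simp; linarith)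
  have r₄ : RegionBound s₀ s₁ s₂ b₀ b₁ b₂ _ := RegionBound.of_decay (K := K) M.pos
    (fun p₀ p₁ p₂ => |(p₁.1:ℝ) - p₂.1| + |(p₀.2:ℝ) - p₁.1| + p₀.1 + p₁.2 + p₂.2)
    (fun _ _ => 0) (fun p₁ _ => p₁.1) (fun _ => 0)
    (fun p₀ p₁ p₂ => by simp; linarith [a p₀.2 p₁.1, Nat.cast_nonneg (α := ℝ) p₀.1, Nat.cast_nonneg (α := ℝ) p₁.2])
    (fun p₀ p₁ p₂ => by simp; linarith [Nat.cast_nonneg (α := ℝ) p₂.2])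
  have r₅ : RegionBound s₀ s₁ s₂ b₀ b₁ b₂ _ := RegionBound.of_decay (K := K) M.pos
    (fun p₀ p₁ p₂ => |(p₁.1:ℝ) - p₂.1| + |(p₀.2:ℝ) - p₁.1| + |(p₁.1:ℝ) - p₂.2| + p₀.1 + p₁.2)
    (fun _ p₁ => p₁.1) (fun p₁ _ => p₁.1) (fun _ => 0)
    (fun p₀ p₁ p₂ => by rw [abs_sub_comm (p₂.2:ℝ)]; linarith [a p₀.2 p₁.1, Nat.cast_nonneg (α := ℝ) p₀.1, Nat.cast_nonneg (α := ℝ) p₁.2])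
    (fun p₀ p₁ p₂ => by simp; linarith [a p₁.1 p₂.2])
  refine (((r₁.union r₂ fun _ _ _ h => h).union r₃ fun _ _ _ h => h).union r₄
    fun _ _ _ h => h).union r₅ fun p₀ p₁ p₂ h => ?_
  obtain ⟨e, he, hd⟩ := triBound_piece A M hp (l₀ := p₀.2) h.1 h.2.1 h.2.2
  rcases hd with hd | hd | hd | hd | hd
  · exact Or.inl (Or.inl (Or.inl (Or.inl ⟨e, he, hd⟩)))
  · exact Or.inl (Or.inl (Or.inl (Or.inr ⟨e, he, hd⟩)))
  · exact Or.inl (Or.inl (Or.inr ⟨e, he, hd⟩))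
  · exact Or.inl (Or.inr ⟨e, he, hd⟩)
  · exact Or.inr ⟨e, he, hd⟩

end OrderedRegion

section Endpoint

variable {s₀ s₁ s₂ b₀ b₁ b₂ ε K : ℝ}

theorem tsum_cut_le {ι : Type*} (F : ℝ × Space → ℝ≥0∞) {p : ι → ℕ × ℕ} (hp : p.Injective)
    (x : ℝ × Space) : ∑' i, cut F (p i) x ≤ F x :=
  (ENNReal.tsum_comp_le_tsum_of_injective hp fun q => cut F q x).trans_eq (tsum_cut F x)

theorem tsum_tri_cut_le {F G H : ℝ × Space → ℝ≥0∞} (hF : Measurable F) (hG : Measurable G)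
    (hH : Measurable H) (n l : ℕ) :
    ∑' m, ∑' k, ∑' p, tri (cut F (n, m)) (cut G (k, l)) (cut H p) ≤
      2 ^ ((3 * n + l + 9 : ℝ) / 2) * (nrm F * nrm G * nrm H) := by
  have hG' : Measurable fun x => ∑' k, cut G (k, l) x :=
    Measurable.tsum fun k => measurable_cut hG _
  have hF' : Measurable fun x => ∑' m, cut F (n, m) x :=
    Measurable.tsum fun m => measurable_cut hF _
  have e : ∑' m, ∑' k, ∑' p, tri (cut F (n, m)) (cut G (k, l)) (cut H p) =
      tri (fun x => ∑' m, cut F (n, m) x) (fun x => ∑' k, cut G (k, l) x) H := by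
    rw [tri_tsum_left hG' (fun m => measurable_cut hF _) hH]
    refine tsum_congr fun m => ?_
    rw [tri_tsum_mid (measurable_cut hF _) (fun k => measurable_cut hG _) hH]
    refine tsum_congr fun k => ?_
    rw [← tri_tsum_right (measurable_cut hF _) (measurable_cut hG _) (measurable_cut hH)]
    simp_rw [tsum_cut]
  rw [e]
  have hb := triBound_low (r := 2 ^ (n + 1)) (L := 2 ^ (l + 1)) (by positivity) (by positivity)
    Set.univ _ _ H hF' hG' hH
    (fun x hx => ENNReal.tsum_eq_zero.2 fun m =>
      cut_of_notMem fun h => hx (piece_subset_lowFreq h))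
    (fun x hx => ENNReal.tsum_eq_zero.2 fun k =>
      cut_of_notMem fun h => hx (piece_subset_coneNhd h)) (fun x hx => absurd trivial hx)
  refine hb.trans (mul_le_mul' ?_ ?_)
  · have := ofReal_rpow_half_le (x := 24 * ((2 ^ (n + 1)) ^ 3 * 2 ^ (l + 1))) (m := 3 * n + l + 9)
      (by
        calc (24:ℝ) * ((2 ^ (n + 1)) ^ 3 * 2 ^ (l + 1)) ≤
            2 ^ 5 * ((2 ^ (n + 1)) ^ 3 * 2 ^ (l + 1)) := by gcongr; norm_num
          _ = _ := by ring)
    exact_mod_cast this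
  · gcongr
    · exact nrm_mono (tsum_cut_le F (Prod.mk_right_injective n))
    · exact nrm_mono (tsum_cut_le G (Prod.mk_left_injective l))

theorem regionBound_ordered_endpoint (M : Margins s₀ s₁ s₂ b₀ b₁ b₂ ε K) (hs : s₁ + s₂ = 0)
    (hb₀ : b₀ = 0) (hb₂ : b₂ = 0) : RegionBound s₀ s₁ s₂ b₀ b₁ b₂ Ordered := by
  have hε := M.pos
  have hM := M.s_double₀
  have hM' := M.b_sum
  set c := |s₀| + |s₁| + |s₂| + |b₀| + |b₁| + |b₂| with hc
  refine ⟨2 ^ (c + |s₁|) * (2 ^ (9 / 2 : ℝ) * geoSum ε ^ 2), ENNReal.mul_ne_top (two_rpow_ne_top _)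
    (ENNReal.mul_ne_top (two_rpow_ne_top _) (ENNReal.pow_ne_top (geoSum_ne_top hε))),
    fun F G H hF hG hH => ?_⟩
  calc _ ≤ ∑' p₀ : ℕ × ℕ, ∑' p₁ : ℕ × ℕ, ∑' p₂ : ℕ × ℕ,
        2 ^ (c + |s₁|) * 2 ^ (-s₀ * p₀.1 - b₁ * p₁.2) *
          tri (cut F p₀) (cut G p₁) (cut H p₂) := by
        refine ENNReal.tsum_le_tsum fun p₀ => ENNReal.tsum_le_tsum fun p₁ =>
          ENNReal.tsum_le_tsum fun p₂ => iSup_le fun hR => ?_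
        refine (tri_cut_wt_le _ _ _ _ _ _ _ _ _ _ _ _).trans ?_
        by_cases hne : ∃ x ∈ piece p₁, ∃ y ∈ piece p₂, -x - y ∈ piece p₀
        · obtain ⟨x, hx, y, hy, hz⟩ := hne
          obtain ⟨h₂₁, h₁₂⟩ := frequency_comparable hx hy hz hR.1 hR.2.1
          have h : |(p₂.1:ℝ) - p₁.1| ≤ 1 := by exact_mod_cast natCast_abs_sub_le h₂₁ h₁₂
          have h' := mul_sub_le_of_abs_sub_le (a := s₁) h
          rw [two_rpow_add, two_rpow_add]
          refine mul_le_mul_left (two_rpow_le_two_rpow ?_) _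
          have e₂ : s₂ * p₂.1 = -(s₁ * p₂.1) := by rw [show s₂ = -s₁ by linarith]; ring
          have e₀ : b₀ * p₀.2 = 0 := by rw [hb₀, zero_mul]
          have e₂' : b₂ * p₂.2 = 0 := by rw [hb₂, zero_mul]
          linarith
        · have := TriBound.of_empty (fun x hx y hy hz => hne ⟨x, hx, y, hy, hz⟩)
            (cut F p₀) (cut G p₁) (cut H p₂) (measurable_cut hF _) (measurable_cut hG _)
            (measurable_cut hH _) (fun _ => cut_of_notMem) (fun _ => cut_of_notMem)
            (fun _ => cut_of_notMem)
          rw [zero_mul] at this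
          rw [le_antisymm this zero_le, mul_zero]
          exact zero_le
    _ = 2 ^ (c + |s₁|) * ∑' n : ℕ, ∑' l : ℕ, 2 ^ (-s₀ * n - b₁ * l) *
          ∑' m, ∑' k, ∑' p, tri (cut F (n, m)) (cut G (k, l)) (cut H p) := by
        simp_rw [mul_assoc, ENNReal.tsum_mul_left]
        rw [ENNReal.tsum_prod']
        refine congrArg _ (tsum_congr fun n => ?_)
        simp_rw [← ENNReal.tsum_mul_left (a := 2 ^ (-s₀ * (n:ℝ) - b₁ * _))]
        refine (tsum_congr fun m => ?_).trans ENNReal.tsum_comm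
        rw [ENNReal.tsum_prod', ENNReal.tsum_comm]
    _ ≤ 2 ^ (c + |s₁|) * ∑' n : ℕ, ∑' l : ℕ, 2 ^ (9 / 2 : ℝ) * (geo ε n 0 * geo ε l 0) *
          (nrm F * nrm G * nrm H) := by
        refine mul_le_mul_right (ENNReal.tsum_le_tsum fun n => ENNReal.tsum_le_tsum fun l => ?_) _
        refine (mul_le_mul_right (tsum_tri_cut_le hF hG hH n l) _).trans ?_
        rw [← mul_assoc]
        refine mul_le_mul_left ?_ _
        unfold geo
        rw [two_rpow_add, two_rpow_add, two_rpow_add]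
        refine two_rpow_le_two_rpow ?_
        have hn : (0:ℝ) ≤ n := n.cast_nonneg
        have hl : (0:ℝ) ≤ l := l.cast_nonneg
        have e : ∀ k : ℕ, |(k:ℝ) - (0:ℕ)| = k := by simp
        rw [e, e]
        nlinarith
    _ ≤ _ := by
        simp_rw [ENNReal.tsum_mul_right, ENNReal.tsum_mul_left, ENNReal.tsum_mul_right]
        rw [← mul_assoc, pow_two]
        gcongr <;> exact tsum_geo_le _ _

theorem Admissible.regionBound_ordered (A : Admissible s₀ s₁ s₂ b₀ b₁ b₂) :
    RegionBound s₀ s₁ s₂ b₀ b₁ b₂ Ordered := by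
  obtain ⟨ε, K, M, h, h'⟩ := A.exists_margins
  by_cases hp : 0 < s₁ + s₂ + b₀
  · exact regionBound_ordered_of_margins A M (Or.inl (h hp))
  by_cases hp' : 0 < s₁ + s₂ + b₀ + b₂
  · exact regionBound_ordered_of_margins A M (Or.inr (h' hp'))
  have h₁ := A.s₁₂
  have h₂ := A.b₀₂
  have h₃ := A.s₁₂_b₀
  exact regionBound_ordered_endpoint M (by linarith) (by linarith) (by linarith)

theorem Admissible.tri_le (A : Admissible s₀ s₁ s₂ b₀ b₁ b₂) :
    ∃ C : ℝ≥0∞, C ≠ ⊤ ∧ ∀ F G H : ℝ × Space → ℝ≥0∞, Measurable F → Measurable G → Measurable H →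
      tri (fun x => wt s₀ b₀ x * F x) (fun x => wt s₁ b₁ x * G x) (fun x => wt s₂ b₂ x * H x) ≤
        C * (nrm F * nrm G * nrm H) :=
  (RegionBound.of_ordered Admissible.regionBound_ordered A).tri_le

end Endpoint

/-! ## The product estimate -/

section Transfer

theorem continuous_spt : Continuous spt :=
  (PiLp.continuous_toLp 2 _).comp (by fun_prop : Continuous fun ζ : SpaceTime => fun i : Fin 3 => ζ i.succ)

theorem continuous_hWt (s b : ℝ) : Continuous (hWt s b) := by
  have h := continuous_spt
  have hj := continuous_jap
  have hne : ∀ r, jap r ≠ 0 := fun r => (one_pos.trans_le (one_le_jap r)).ne'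
  unfold hWt
  refine (Continuous.rpow_const (by fun_prop) fun _ => Or.inl (hne _)).mul
    (Continuous.rpow_const (by fun_prop) fun _ => Or.inl (hne _))

theorem hWt_pos (s b : ℝ) (ζ : SpaceTime) : 0 < hWt s b ζ :=
  mul_pos (Real.rpow_pos_of_pos (one_pos.trans_le (one_le_jap _)) _)
    (Real.rpow_pos_of_pos (one_pos.trans_le (one_le_jap _)) _)

theorem spt_neg (ζ : SpaceTime) : spt (-ζ) = -spt ζ := rfl

theorem hWt_neg (s b : ℝ) (ζ : SpaceTime) : hWt s b (-ζ) = hWt s b ζ := by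
  simp [hWt, spt_neg]

theorem hWt_neg_neg (s b : ℝ) (ζ : SpaceTime) : hWt (-s) (-b) ζ * hWt s b ζ = 1 := by
  have h : ∀ r : ℝ, 0 < jap r := fun r => one_pos.trans_le (one_le_jap r)
  have e : ∀ r t : ℝ, jap r ^ (-t) * jap r ^ t = 1 := fun r t => by
    rw [← Real.rpow_add (h r), neg_add_cancel, Real.rpow_zero]
  unfold hWt
  rw [mul_mul_mul_comm, e, e, one_mul]

theorem norm_spt_le (ζ : SpaceTime) : ‖spt ζ‖ ≤ ‖ζ‖ := by
  have : ‖ζ‖ ^ 2 = ζ 0 ^ 2 + ‖spt ζ‖ ^ 2 := norm_sq_splitHead ζ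
  exact abs_le_of_sq_le_sq' (by nlinarith [sq_nonneg (ζ 0)]) (norm_nonneg ζ) |>.2

theorem jap_rpow_le {r R : ℝ} (h : |r| ≤ R) (s : ℝ) : jap r ^ s ≤ (1 + R) ^ |s| := by
  have hR : 0 ≤ R := (abs_nonneg r).trans h
  have h1 : jap r ≤ 1 + R := by
    refine Real.sqrt_le_iff.2 ⟨by positivity, ?_⟩
    nlinarith [sq_abs r, abs_nonneg r]
  calc jap r ^ s ≤ jap r ^ |s| := Real.rpow_le_rpow_of_exponent_le (one_le_jap r) (le_abs_self s)
    _ ≤ _ := Real.rpow_le_rpow (zero_le_one.trans (one_le_jap r)) h1 (abs_nonneg s)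

theorem exists_hWt_le (s b : ℝ) : ∃ k : ℕ, ∀ ζ, hWt s b ζ ≤ (1 + ‖ζ‖) ^ k := by
  obtain ⟨k, hk⟩ := exists_nat_ge (|s| + |b|)
  refine ⟨k, fun ζ => ?_⟩
  have h0 : |ζ 0| ≤ ‖ζ‖ := by simpa using PiLp.norm_apply_le ζ 0
  have h1 := norm_spt_le ζ
  have h2 : |(|ζ 0| - ‖spt ζ‖)| ≤ ‖ζ‖ :=
    abs_le.2 ⟨by linarith [abs_nonneg (ζ 0)], by linarith [norm_nonneg (spt ζ)]⟩
  have h3 : |(‖spt ζ‖)| ≤ ‖ζ‖ := by rwa [abs_of_nonneg (norm_nonneg _)]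
  have h4 : 0 < 1 + ‖ζ‖ := by positivity
  calc hWt s b ζ ≤ (1 + ‖ζ‖) ^ |s| * (1 + ‖ζ‖) ^ |b| :=
        mul_le_mul (jap_rpow_le h3 s) (jap_rpow_le h2 b)
          (Real.rpow_nonneg (zero_le_one.trans (one_le_jap _)) _) (by positivity)
    _ = (1 + ‖ζ‖) ^ (|s| + |b|) := (Real.rpow_add h4 _ _).symm
    _ ≤ (1 + ‖ζ‖) ^ (k:ℝ) :=
        Real.rpow_le_rpow_of_exponent_le (by linarith [norm_nonneg ζ]) hk
    _ = _ := Real.rpow_natCast _ _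

theorem integrable_hWt_mul_sq (s b : ℝ) (g : SchwartzMap SpaceTime ℂ) :
    Integrable fun ζ => (hWt s b ζ * ‖g ζ‖) ^ 2 := by
  obtain ⟨k, hk⟩ := exists_hWt_le s b
  have hg := fun ζ => SchwartzMap.one_add_le_sup_seminorm_apply (𝕜 := ℝ) (m := (2 * k, 0))
    (k := 2 * k) (n := 0) le_rfl le_rfl g ζ
  set M := 2 ^ (2 * k) * (Finset.Iic (2 * k, 0)).sup
    (fun m : ℕ × ℕ => SchwartzMap.seminorm ℝ m.1 m.2) g
  refine (g.integrable.norm.const_mul M).mono' ?_ (.of_forall fun ζ => ?_)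
  · have := continuous_hWt s b
    have := g.continuous
    exact Continuous.aestronglyMeasurable (by fun_prop)
  · have h := hg ζ
    rw [norm_iteratedFDeriv_zero] at h
    rw [Real.norm_of_nonneg (by positivity)]
    calc (hWt s b ζ * ‖g ζ‖) ^ 2 ≤ ((1 + ‖ζ‖) ^ k * ‖g ζ‖) ^ 2 := by
          have := (hWt_pos s b ζ).le
          gcongr
          exact hk ζ
      _ = ((1 + ‖ζ‖) ^ (2 * k) * ‖g ζ‖) * ‖g ζ‖ := by ring
      _ ≤ M * ‖g ζ‖ := by gcongr

/-- The weighted absolute value of a function, with values in the extended nonnegative reals. -/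
def weighted (s b : ℝ) (g : SpaceTime → ℂ) (ζ : SpaceTime) : ℝ≥0∞ :=
  ENNReal.ofReal (hWt s b ζ) * ‖g ζ‖ₑ

theorem measurable_weighted (s b : ℝ) (g : SchwartzMap SpaceTime ℂ) :
    Measurable (weighted s b g) := by
  have h := continuous_hWt s b
  have h' := g.continuous.measurable
  unfold weighted
  exact h.measurable.ennreal_ofReal.mul h'.enorm

theorem nrm_weighted (s b : ℝ) (g : SpaceTime → ℂ) :
    nrm (weighted s b g) =
      (∫⁻ ζ, ENNReal.ofReal ((hWt s b ζ * ‖g ζ‖) ^ 2)) ^ (1 / 2 : ℝ) := by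
  unfold nrm weighted
  congr 1
  refine lintegral_congr fun ζ => ?_
  have := (hWt_pos s b ζ).le
  rw [ENNReal.ofReal_pow (by positivity), ENNReal.ofReal_mul this, ofReal_norm]

theorem nrm_weighted_ne_top (s b : ℝ) (g : SchwartzMap SpaceTime ℂ) :
    nrm (weighted s b g) ≠ ⊤ := by
  rw [nrm_weighted]
  refine ENNReal.rpow_ne_top_of_nonneg (by norm_num) ?_
  rw [← ofReal_integral_eq_lintegral_ofReal (integrable_hWt_mul_sq s b g)
    (.of_forall fun ζ => sq_nonneg _)]
  exact ENNReal.ofReal_ne_top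

theorem wnorm_eq_toReal (s b : ℝ) (g : SchwartzMap SpaceTime ℂ) :
    wnorm (hWt s b) g = (nrm (weighted s b g)).toReal := by
  rw [nrm_weighted, ← ENNReal.toReal_rpow, wnorm,
    ← ofReal_integral_eq_lintegral_ofReal (integrable_hWt_mul_sq s b g)
    (.of_forall fun ζ => sq_nonneg _), ENNReal.toReal_ofReal (integral_nonneg fun ζ => sq_nonneg _)]

theorem tri_comp_splitHead {F G H : ℝ × Space → ℝ≥0∞} (hF : Measurable F) (hG : Measurable G)
    (hH : Measurable H) :
    tri (fun ζ : SpaceTime => F (splitHead ζ)) (fun ζ => G (splitHead ζ))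
      (fun ζ => H (splitHead ζ)) = tri F G H := by
  have hm := measurable_tri_integrand hF hG hH
  have hp := measurePreserving_splitHead (n := 3)
  unfold tri
  rw [← hp.lintegral_comp hm.lintegral_prod_right']
  refine lintegral_congr fun x => ?_
  exact hp.lintegral_comp (f := fun y => F (-splitHead x - y) * (G (splitHead x) * H y))
    (hm.comp measurable_prodMk_left)

theorem nrm_comp_splitHead {F : ℝ × Space → ℝ≥0∞} (hF : Measurable F) :
    nrm (fun ζ : SpaceTime => F (splitHead ζ)) = nrm F := by
  unfold nrm
  rw [(measurePreserving_splitHead (n := 3)).lintegral_comp (hF.pow_const 2)]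

theorem measurable_stpt : Measurable fun x : ℝ × Space => stpt x.1 x.2 := by
  unfold stpt
  refine (PiLp.continuous_toLp 2 _).measurable.comp (measurable_pi_lambda _ fun μ => ?_)
  cases μ using Fin.cases <;> simp <;> fun_prop

theorem stpt_splitHead (ζ : SpaceTime) : stpt (splitHead ζ).1 (splitHead ζ).2 = ζ := by
  ext μ
  cases μ using Fin.cases <;> rfl

variable {s₀ s₁ s₂ b₀ b₁ b₂ : ℝ}

theorem Admissible.tri_weight_le (A : Admissible s₀ s₁ s₂ b₀ b₁ b₂) :
    ∃ C : ℝ≥0∞, C ≠ ⊤ ∧ ∀ F G H : SpaceTime → ℝ≥0∞, Measurable F → Measurable G → Measurable H →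
      tri (fun ζ => ENNReal.ofReal (hWt (-s₀) (-b₀) ζ) * F ζ)
        (fun ζ => ENNReal.ofReal (hWt (-s₁) (-b₁) ζ) * G ζ)
        (fun ζ => ENNReal.ofReal (hWt (-s₂) (-b₂) ζ) * H ζ) ≤ C * (nrm F * nrm G * nrm H) := by
  obtain ⟨C, hC, h⟩ := A.tri_le
  refine ⟨C, hC, fun F G H hF hG hH => ?_⟩
  have mF := hF.comp measurable_stpt
  have mG := hG.comp measurable_stpt
  have mH := hH.comp measurable_stpt
  have key := h _ _ _ mF mG mH
  rw [← tri_comp_splitHead ((measurable_wt s₀ b₀).fun_mul mF) ((measurable_wt s₁ b₁).fun_mul mG)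
    ((measurable_wt s₂ b₂).fun_mul mH), ← nrm_comp_splitHead mF, ← nrm_comp_splitHead mG,
    ← nrm_comp_splitHead mH] at key
  simp only [Function.comp_apply, stpt_splitHead] at key
  exact key

end Transfer

section Product

theorem enorm_fourier_mul_le (u v P : SchwartzMap SpaceTime ℂ) (hP : ∀ x, P x = u x * v x)
    (ζ : SpaceTime) : ‖𝓕 P ζ‖ₑ ≤ ∫⁻ η, ‖𝓕 u η‖ₑ * ‖𝓕 v (ζ - η)‖ₑ := by
  have hinv : ∀ (f : SchwartzMap SpaceTime ℂ) (ξ : SpaceTime), 𝓕⁻ f ξ = 𝓕 f (-ξ) := fun f ξ => by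
    rw [SchwartzMap.fourierInv_coe, SchwartzMap.fourier_coe, Real.fourierInv_eq_fourier_neg]
  have e : SchwartzMap.convolution (ContinuousLinearMap.mul ℂ ℂ) (𝓕⁻ u) (𝓕⁻ v) = 𝓕⁻ P := by
    have : P = SchwartzMap.pairing (ContinuousLinearMap.mul ℂ ℂ) u v := by
      ext x
      simp [hP]
    rw [this]
    simp [SchwartzMap.convolution]
  have h := congrArg (fun f : SchwartzMap SpaceTime ℂ => f (-ζ)) e
  simp only [SchwartzMap.convolution_apply, MeasureTheory.convolution, hinv, neg_neg,
    ContinuousLinearMap.mul_apply'] at h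
  rw [← h, ← lintegral_neg_eq_self]
  refine (enorm_integral_le_lintegral_enorm _).trans_eq (lintegral_congr fun η => ?_)
  rw [enorm_mul]
  congr 3
  abel

theorem nrm_sq_le_tri (f a b : SchwartzMap SpaceTime ℂ)
    (h : ∀ ζ, ‖f ζ‖ₑ ≤ ∫⁻ η, ‖a η‖ₑ * ‖b (ζ - η)‖ₑ) (s t : ℝ) :
    nrm (weighted s t f) ^ 2 ≤ tri (fun ζ => ENNReal.ofReal (hWt s t ζ) * weighted s t f (-ζ))
      (fun ζ => ‖a ζ‖ₑ) (fun ζ => ‖b ζ‖ₑ) := by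
  have ma := a.continuous.measurable.enorm
  have mb := b.continuous.measurable.enorm
  have mf := measurable_weighted s t f
  have mw := (continuous_hWt s t).measurable.ennreal_ofReal
  set Φ := fun ζ => ENNReal.ofReal (hWt s t ζ) * weighted s t f ζ with hΦ
  have mΦ : Measurable Φ := mw.mul mf
  calc nrm (weighted s t f) ^ 2 = ∫⁻ ζ, Φ ζ * ‖f ζ‖ₑ := by
        rw [nrm_sq]
        refine lintegral_congr fun ζ => ?_
        simp only [hΦ, weighted]
        ring
    _ ≤ ∫⁻ ζ, ∫⁻ η, Φ ζ * (‖a η‖ₑ * ‖b (ζ - η)‖ₑ) := by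
        refine lintegral_mono fun ζ => ?_
        rw [lintegral_const_mul _ (by fun_prop)]
        gcongr
        exact h ζ
    _ = ∫⁻ η, ∫⁻ ζ, Φ ζ * (‖a η‖ₑ * ‖b (ζ - η)‖ₑ) :=
        lintegral_lintegral_swap (Measurable.aemeasurable (by fun_prop))
    _ = _ := by
        refine lintegral_congr fun η => ?_
        rw [← lintegral_add_right_eq_self _ η]
        refine lintegral_congr fun y => ?_
        have e : -(-η - y) = y + η := by abel
        simp only [hΦ, add_sub_cancel_right]
        rw [← hWt_neg s t (-η - y), e]

variable {s₀ s₁ s₂ b₀ b₁ b₂ : ℝ}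

theorem ofReal_hWt_mul_weighted (s b : ℝ) (g : SpaceTime → ℂ) (ζ : SpaceTime) :
    ENNReal.ofReal (hWt (-s) (-b) ζ) * weighted s b g ζ = ‖g ζ‖ₑ := by
  rw [weighted, ← mul_assoc, ← ENNReal.ofReal_mul (hWt_pos _ _ _).le, hWt_neg_neg,
    ENNReal.ofReal_one, one_mul]

theorem Admissible.nrm_le (A : Admissible s₀ s₁ s₂ b₀ b₁ b₂) :
    ∃ C : ℝ≥0∞, C ≠ ⊤ ∧ ∀ f a b : SchwartzMap SpaceTime ℂ,
      (∀ ζ, ‖f ζ‖ₑ ≤ ∫⁻ η, ‖a η‖ₑ * ‖b (ζ - η)‖ₑ) →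
        nrm (weighted (-s₀) (-b₀) f) ≤ C * nrm (weighted s₁ b₁ a) * nrm (weighted s₂ b₂ b) := by
  obtain ⟨C, hC, h⟩ := A.tri_weight_le
  refine ⟨C, hC, fun f a b hf => ?_⟩
  have key := h (fun ζ => weighted (-s₀) (-b₀) f (-ζ)) _ _
    ((measurable_weighted _ _ f).comp measurable_neg) (measurable_weighted s₁ b₁ a)
    (measurable_weighted s₂ b₂ b)
  simp only [ofReal_hWt_mul_weighted] at key
  have hn : nrm (fun ζ => weighted (-s₀) (-b₀) f (-ζ)) = nrm (weighted (-s₀) (-b₀) f) := by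
    unfold nrm
    rw [lintegral_neg_eq_self fun ζ => weighted (-s₀) (-b₀) f ζ ^ 2]
  have h2 := (nrm_sq_le_tri f a b hf _ _).trans key
  rw [hn] at h2
  rcases eq_or_ne (nrm (weighted (-s₀) (-b₀) f)) 0 with h0 | h0
  · rw [h0]; exact zero_le
  · refine (ENNReal.mul_le_mul_iff_right h0 (nrm_weighted_ne_top (-s₀) (-b₀) f)).1 ?_
    calc _ = nrm (weighted (-s₀) (-b₀) f) ^ 2 := (pow_two _).symm
      _ ≤ _ := h2
      _ = _ := by ring

theorem HsbNorm_eq_toReal (s b : ℝ) (u : SchwartzMap SpaceTime ℂ) :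
    HsbNorm s b u = (nrm (weighted s b (𝓕 u : SchwartzMap SpaceTime ℂ))).toReal := by
  rw [← wnorm_eq_toReal, SchwartzMap.fourier_coe]
  rfl

theorem Admissible.HsbNorm_mul_le (A : Admissible s₀ s₁ s₂ b₀ b₁ b₂) :
    ∃ C > 0, ∀ u v : SchwartzMap SpaceTime ℂ,
      HsbNorm (-s₀) (-b₀) (fun x => u x * v x) ≤ C * HsbNorm s₁ b₁ ⇑u * HsbNorm s₂ b₂ ⇑v := by
  obtain ⟨C, hC, h⟩ := A.nrm_le
  refine ⟨C.toReal + 1, by positivity, fun u v => ?_⟩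
  set P := SchwartzMap.pairing (ContinuousLinearMap.mul ℂ ℂ) u v with hP
  have e : (fun x => u x * v x) = P := by
    ext x
    simp [hP]
  rw [e, HsbNorm_eq_toReal, HsbNorm_eq_toReal, HsbNorm_eq_toReal]
  have h1 := h _ _ _ (enorm_fourier_mul_le u v P fun x => (congrFun e x).symm)
  have h2 := ENNReal.toReal_mono (ENNReal.mul_ne_top (ENNReal.mul_ne_top hC
    (nrm_weighted_ne_top s₁ b₁ _)) (nrm_weighted_ne_top s₂ b₂ _)) h1
  rw [ENNReal.toReal_mul, ENNReal.toReal_mul] at h2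
  refine h2.trans ?_
  gcongr
  linarith

end Product

/-- the product estimate `‖uv‖_{H^{-s₀,-b₀}} ≲ ‖u‖_{H^{s₁,b₁}} ‖v‖_{H^{s₂,b₂}}`
in wave-Sobolev spaces on `ℝ^{3+1}`. -/
theorem wave_sobolev_product_estimate
    (s₀ s₁ s₂ b₀ b₁ b₂ : ℝ)
    (h1 : b₀ + b₁ + b₂ > 1/2)
    (h2 : b₀ + b₁ ≥ 0) (h3 : b₀ + b₂ ≥ 0) (h4 : b₁ + b₂ ≥ 0)
    (h5 : s₀ + s₁ + s₂ > 2 - (b₀ + b₁ + b₂))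
    (h6 : s₀ + s₁ + s₂ > 3/2 - min (b₀ + b₁) (min (b₀ + b₂) (b₁ + b₂)))
    (h7 : s₀ + s₁ + s₂ > 1 - min b₀ (min b₁ b₂))
    (h8 : s₀ + s₁ + s₂ > 1)
    (h9 : (s₀ + b₀) + 2*s₁ + 2*s₂ > 3/2)
    (h10 : 2*s₀ + (s₁ + b₁) + 2*s₂ > 3/2)
    (h11 : 2*s₀ + 2*s₁ + (s₂ + b₂) > 3/2)
    (h12 : s₁ + s₂ ≥ max 0 (-b₀))
    (h13 : s₀ + s₂ ≥ max 0 (-b₁))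
    (h14 : s₀ + s₁ ≥ max 0 (-b₂)) :
    ∃ C > 0, ∀ u v : SchwartzMap SpaceTime ℂ,
      HsbNorm (-s₀) (-b₀) (fun x => u x * v x) ≤ C * HsbNorm s₁ b₁ ⇑u * HsbNorm s₂ b₂ ⇑v := by
  have := min_le_left (b₀ + b₁) (min (b₀ + b₂) (b₁ + b₂))
  have := min_le_right (b₀ + b₁) (min (b₀ + b₂) (b₁ + b₂))
  have := min_le_left (b₀ + b₂) (b₁ + b₂)
  have := min_le_right (b₀ + b₂) (b₁ + b₂)
  have := min_le_left b₀ (min b₁ b₂)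
  have := min_le_right b₀ (min b₁ b₂)
  have := min_le_left b₁ b₂
  have := min_le_right b₁ b₂
  obtain ⟨h12, h12'⟩ := max_le_iff.1 h12
  obtain ⟨h13, h13'⟩ := max_le_iff.1 h13
  obtain ⟨h14, h14'⟩ := max_le_iff.1 h14
  exact Admissible.HsbNorm_mul_le (by constructor <;> linarith)
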